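/- Let Ω ⊆ ℂⁿ be a pseudoconvex domain (nonempty, open, connected, admitting a smooth plurisubharmonic exhaustion function). Suppose there exist real-valued functions λ, τ, twice continuously differentiable on Ω with τ > 0, and constants c₁, c₂ > 0 such that (i) Θ_{λ,τ}(z; ξ) ≥ c₁|ξ|²e^{−λ(z)} for all z ∈ Ω and ξ ∈ ℂⁿ, and (ii) e^{−λ(z)}/τ(z) ≥ c₂ for all z ∈ Ω. Then ∂̄ has closed range: the set R(∂̄) = {α ∈ (L²(Ω))ⁿ : ∃u ∈ L²(Ω) with ∂̄u = α distributionally on Ω} is closed in (L²(Ω))ⁿ. -/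

import Mathlib

open MeasureTheory Complex Metric Set

noncomputable section

/-- The Wirtinger derivative `∂φ/∂z̄_j` of `φ : ℂⁿ → ℂ`:
`(1/2)(Dφ_z(e_j) + i·Dφ_z(i·e_j))`. -/
def dbarCoord (n : ℕ) (φ : (Fin n → ℂ) → ℂ) (j : Fin n) (z : Fin n → ℂ) : ℂ :=
  (1 / 2) * (fderiv ℝ φ z (Pi.single j 1) + Complex.I * fderiv ℝ φ z (Pi.single j Complex.I))

/-- A test function on `Ω`: smooth with compact support contained in `Ω`. -/
def IsTest (n : ℕ) (Ω : Set (Fin n → ℂ)) (φ : (Fin n → ℂ) → ℂ) : Prop :=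
  ContDiff ℝ (⊤ : ℕ∞) φ ∧ HasCompactSupport φ ∧ tsupport φ ⊆ Ω

/-- `∂̄u = α` distributionally on `Ω`. -/
def DbarEq (n : ℕ) (Ω : Set (Fin n → ℂ)) (u : (Fin n → ℂ) → ℂ)
    (α : Fin n → (Fin n → ℂ) → ℂ) : Prop :=
  ∀ j : Fin n, ∀ φ : (Fin n → ℂ) → ℂ, IsTest n Ω φ →
    ∫ z in Ω, α j z * φ z = - ∫ z in Ω, u z * dbarCoord n φ j z

/-- `α` is `∂̄`-closed on `Ω`. -/
def DbarClosed (n : ℕ) (Ω : Set (Fin n → ℂ)) (α : Fin n → (Fin n → ℂ) → ℂ) : Prop :=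
  ∀ j k : Fin n, ∀ φ : (Fin n → ℂ) → ℂ, IsTest n Ω φ →
    ∫ z in Ω, α j z * dbarCoord n φ k z = ∫ z in Ω, α k z * dbarCoord n φ j z

/-- The complex Hessian `Hf(z;ξ) = (1/4)(D²f_z(ξ,ξ) + D²f_z(iξ,iξ))`. -/
def hessC (n : ℕ) (f : (Fin n → ℂ) → ℝ) (z ξ : Fin n → ℂ) : ℝ :=
  (1 / 4) * (iteratedFDeriv ℝ 2 f z ![ξ, ξ]
    + iteratedFDeriv ℝ 2 f z ![Complex.I • ξ, Complex.I • ξ])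

/-- The pairing `⟨∂f(z), ξ⟩ = (1/2)(Df_z(ξ) − i·Df_z(iξ))`. -/
def delPair (n : ℕ) (f : (Fin n → ℂ) → ℝ) (z ξ : Fin n → ℂ) : ℂ :=
  (1 / 2) * ((fderiv ℝ f z ξ : ℂ) - Complex.I * (fderiv ℝ f z (Complex.I • ξ) : ℂ))

/-- Squared Euclidean norm of `ξ ∈ ℂⁿ`. -/
def enormSq (n : ℕ) (ξ : Fin n → ℂ) : ℝ := ∑ j, Complex.normSq (ξ j)

/-- The twisted curvature expression
`Θ_{λ,τ}(z;ξ) = τ(z)·Hλ(z;ξ) − Hτ(z;ξ) − τ(z)⁻¹·|⟨∂τ(z),ξ⟩|²`. -/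
def Theta (n : ℕ) (lam tau : (Fin n → ℂ) → ℝ) (z ξ : Fin n → ℂ) : ℝ :=
  tau z * hessC n lam z ξ - hessC n tau z ξ - (tau z)⁻¹ * Complex.normSq (delPair n tau z ξ)

/-- `Φ` is an exhaustion function of `Ω`: every sublevel set has compact closure inside `Ω`. -/
def ExhaustsOn (n : ℕ) (Ω : Set (Fin n → ℂ)) (Φ : (Fin n → ℂ) → ℝ) : Prop :=
  ∀ c : ℝ, IsCompact (closure {z ∈ Ω | Φ z < c}) ∧ closure {z ∈ Ω | Φ z < c} ⊆ Ω

/-- `Ω` is pseudoconvex: it admits a smooth plurisubharmonic exhaustion function. -/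
def Pseudoconvex (n : ℕ) (Ω : Set (Fin n → ℂ)) : Prop :=
  ∃ Φ : (Fin n → ℂ) → ℝ, ContDiffOn ℝ (⊤ : ℕ∞) Φ Ω ∧ (∀ z ∈ Ω, ∀ ξ, 0 ≤ hessC n Φ z ξ) ∧
    ExhaustsOn n Ω Φ

/-- `r` is a smooth defining function for `Ω` which is Levi pseudoconvex. -/
def IsLeviDefiningFn (n : ℕ) (Ω : Set (Fin n → ℂ)) (r : (Fin n → ℂ) → ℝ) : Prop :=
  ContDiff ℝ (⊤ : ℕ∞) r ∧ Ω = {z | r z < 0} ∧ (∀ z, r z = 0 → fderiv ℝ r z ≠ 0) ∧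
    (∀ p, r p = 0 → ∀ ξ, delPair n r p ξ = 0 → 0 ≤ hessC n r p ξ)

/-- The first-order operator `(1/2)(∂/∂x_j + s·∂/∂y_j)`; `s = I` gives `∂/∂z̄_j` and `s = -I`
gives `∂/∂z_j`. -/
def wd {n : ℕ} (s : ℂ) (j : Fin n) (f : (Fin n → ℂ) → ℂ) (z : Fin n → ℂ) : ℂ :=
  (1 / 2) * (fderiv ℝ f z (Pi.single j 1) + s * fderiv ℝ f z (Pi.single j Complex.I))

section Wirtinger

variable {n : ℕ} {s t : ℂ} {j k : Fin n} {f g : (Fin n → ℂ) → ℂ} {z : Fin n → ℂ}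

lemma dbarCoord_eq_wd (f : (Fin n → ℂ) → ℂ) (j : Fin n) : dbarCoord n f j = wd Complex.I j f := rfl

lemma wd_mul (hf : DifferentiableAt ℝ f z) (hg : DifferentiableAt ℝ g z) :
    wd s j (fun z => f z * g z) z = wd s j f z * g z + f z * wd s j g z := by
  simp only [wd, fderiv_fun_mul hf hg]
  simp only [add_apply, smul_apply, smul_eq_mul]
  ring

lemma wd_add (hf : DifferentiableAt ℝ f z) (hg : DifferentiableAt ℝ g z) :
    wd s j (fun z => f z + g z) z = wd s j f z + wd s j g z := by
  simp only [wd, fderiv_fun_add hf hg, add_apply]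
  ring

lemma wd_sub (hf : DifferentiableAt ℝ f z) (hg : DifferentiableAt ℝ g z) :
    wd s j (fun z => f z - g z) z = wd s j f z - wd s j g z := by
  simp only [wd, fderiv_fun_sub hf hg, sub_apply]
  ring

lemma wd_neg : wd s j (fun z => - f z) z = - wd s j f z := by
  simp only [wd, fderiv_fun_neg, neg_apply]
  ring

lemma conj_wd (s : ℂ) (j : Fin n) (f : (Fin n → ℂ) → ℂ) (z : Fin n → ℂ) :
    (starRingEnd ℂ) (wd s j f z) = wd ((starRingEnd ℂ) s) j (fun z => (starRingEnd ℂ) (f z)) z := by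
  have h : fderiv ℝ (fun z => (starRingEnd ℂ) (f z)) z
      = (Complex.conjCLE : ℂ →L[ℝ] ℂ).comp (fderiv ℝ f z) :=
    Complex.conjCLE.comp_fderiv
  simp only [wd, h]
  simp [Complex.conj_ofNat]

lemma wd_congr (h : f =ᶠ[nhds z] g) : wd s j f z = wd s j g z := by
  simp only [wd, h.fderiv_eq]

lemma tsupport_wd_subset (s : ℂ) (j : Fin n) (f : (Fin n → ℂ) → ℂ) :
    tsupport (wd s j f) ⊆ tsupport f := by
  refine closure_minimal (fun z hz => ?_) (isClosed_tsupport f)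
  by_contra h
  have h0 : f =ᶠ[nhds z] fun _ => 0 := notMem_tsupport_iff_eventuallyEq.1 h
  exact hz (by rw [wd_congr h0]; simp [wd])

lemma hasCompactSupport_wd (s : ℂ) (j : Fin n) (hf : HasCompactSupport f) :
    HasCompactSupport (wd s j f) :=
  hf.mono' (subset_closure.trans (tsupport_wd_subset s j f))

lemma contDiffAt_wd {m m' : WithTop ℕ∞} (s : ℂ) (j : Fin n) (hf : ContDiffAt ℝ m f z)
    (hm : m' + 1 ≤ m) : ContDiffAt ℝ m' (wd s j f) z := by
  have h := hf.fderiv_right hm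
  exact contDiffAt_const.mul ((h.clm_apply contDiffAt_const).add
    (contDiffAt_const.mul (h.clm_apply contDiffAt_const)))

lemma contDiff_wd {m m' : WithTop ℕ∞} (s : ℂ) (j : Fin n) (hf : ContDiff ℝ m f)
    (hm : m' + 1 ≤ m) : ContDiff ℝ m' (wd s j f) :=
  contDiff_iff_contDiffAt.2 fun _ => contDiffAt_wd s j hf.contDiffAt hm

lemma continuous_wd (s : ℂ) (j : Fin n) (hf : ContDiff ℝ 1 f) : Continuous (wd s j f) :=
  (contDiff_wd (m' := 0) s j hf (by norm_num)).continuous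

lemma fderiv_wd (s : ℂ) (j : Fin n) (hf : ContDiffAt ℝ 2 f z) (v : Fin n → ℂ) :
    fderiv ℝ (wd s j f) z v = (1 / 2) * (fderiv ℝ (fderiv ℝ f) z v (Pi.single j 1)
      + s * fderiv ℝ (fderiv ℝ f) z v (Pi.single j Complex.I)) := by
  have hd : DifferentiableAt ℝ (fderiv ℝ f) z :=
    (hf.fderiv_right (m := 1) (by norm_num)).differentiableAt (by norm_num)
  have h (w : Fin n → ℂ) : HasFDerivAt (fun z => fderiv ℝ f z w)
      ((fderiv ℝ (fderiv ℝ f) z).flip w) z := by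
    have := hd.hasFDerivAt.clm_apply (hasFDerivAt_const w z)
    simpa using this
  have := ((h (Pi.single j 1)).add ((h (Pi.single j Complex.I)).const_mul s)).const_mul (1 / 2 : ℂ)
  have h2 : fderiv ℝ (wd s j f) z = _ := this.fderiv
  rw [h2]
  simp [mul_add]

/-- The second-order operator obtained by composing two Wirtinger-type derivatives. -/
lemma wd_wd (s t : ℂ) (j k : Fin n) (hf : ContDiffAt ℝ 2 f z) :
    wd s j (wd t k f) z = (1 / 4) * (fderiv ℝ (fderiv ℝ f) z (Pi.single j 1) (Pi.single k 1)
      + t * fderiv ℝ (fderiv ℝ f) z (Pi.single j 1) (Pi.single k Complex.I)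
      + s * fderiv ℝ (fderiv ℝ f) z (Pi.single j Complex.I) (Pi.single k 1)
      + s * t * fderiv ℝ (fderiv ℝ f) z (Pi.single j Complex.I) (Pi.single k Complex.I)) := by
  rw [wd, fderiv_wd t k hf, fderiv_wd t k hf]
  ring

lemma wd_comm (s t : ℂ) (j k : Fin n) (hf : ContDiffAt ℝ 2 f z) :
    wd s j (wd t k f) z = wd t k (wd s j f) z := by
  have hs : IsSymmSndFDerivAt ℝ f z := hf.isSymmSndFDerivAt (by simp)
  rw [wd_wd s t j k hf, wd_wd t s k j hf, hs.eq (Pi.single j 1) (Pi.single k 1),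
    hs.eq (Pi.single j 1) (Pi.single k Complex.I), hs.eq (Pi.single j Complex.I) (Pi.single k 1),
    hs.eq (Pi.single j Complex.I) (Pi.single k Complex.I)]
  ring

lemma integral_mul_wd (s : ℂ) (j : Fin n) (hf : ContDiff ℝ 1 f) (hg : ContDiff ℝ 1 g)
    (hc : HasCompactSupport f ∨ HasCompactSupport g) :
    ∫ z, f z * wd s j g z = - ∫ z, wd s j f z * g z := by
  have hcf (v : Fin n → ℂ) : Continuous fun z => fderiv ℝ f z v :=
    (hf.continuous_fderiv (by norm_num)).clm_apply continuous_const
  have hcg (v : Fin n → ℂ) : Continuous fun z => fderiv ℝ g z v :=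
    (hg.continuous_fderiv (by norm_num)).clm_apply continuous_const
  have hsf (v : Fin n → ℂ) (h : HasCompactSupport f) : HasCompactSupport fun z => fderiv ℝ f z v :=
    h.fderiv_apply ℝ v
  have hsg (v : Fin n → ℂ) (h : HasCompactSupport g) : HasCompactSupport fun z => fderiv ℝ g z v :=
    h.fderiv_apply ℝ v
  have i1 (v : Fin n → ℂ) : Integrable fun z => fderiv ℝ f z v * g z :=
    ((hcf v).mul hg.continuous).integrable_of_hasCompactSupport
      (hc.elim (fun h => (hsf v h).mul_right) fun h => h.mul_left)
  have i2 (v : Fin n → ℂ) : Integrable fun z => f z * fderiv ℝ g z v :=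
    (hf.continuous.mul (hcg v)).integrable_of_hasCompactSupport
      (hc.elim (fun h => h.mul_right) fun h => (hsg v h).mul_left)
  have i3 : Integrable fun z => f z * g z :=
    (hf.continuous.mul hg.continuous).integrable_of_hasCompactSupport
      (hc.elim (fun h => h.mul_right) fun h => h.mul_left)
  have key (v : Fin n → ℂ) : ∫ z, f z * fderiv ℝ g z v = - ∫ z, fderiv ℝ f z v * g z :=
    integral_mul_fderiv_eq_neg_fderiv_mul_of_integrable (i1 v) (i2 v) i3
      (fun x _ => (hf.differentiable (by norm_num)).differentiableAt)
      (fun x _ => (hg.differentiable (by norm_num)).differentiableAt)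
  have e1 : ∀ z, f z * wd s j g z = (1 / 2) * (f z * fderiv ℝ g z (Pi.single j 1))
      + s / 2 * (f z * fderiv ℝ g z (Pi.single j Complex.I)) := fun z => by simp only [wd]; ring
  have e2 : ∀ z, wd s j f z * g z = (1 / 2) * (fderiv ℝ f z (Pi.single j 1) * g z)
      + s / 2 * (fderiv ℝ f z (Pi.single j Complex.I) * g z) := fun z => by simp only [wd]; ring
  simp only [e1, e2]
  rw [integral_add ((i2 _).const_mul _) ((i2 _).const_mul _),
    integral_add ((i1 _).const_mul _) ((i1 _).const_mul _)]
  simp only [integral_const_mul, key]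
  ring

end Wirtinger

section Bochner

variable {n : ℕ}

lemma exists_hessian_ofReal {W : (Fin n → ℂ) → ℝ} {z : Fin n → ℂ} (hW : ContDiffAt ℝ 2 W z)
    (u v : Fin n → ℂ) :
    fderiv ℝ (fderiv ℝ fun z => (W z : ℂ)) z u v = (fderiv ℝ (fderiv ℝ W) z u v : ℂ) := by
  have h1 : (fderiv ℝ fun z => (W z : ℂ)) =ᶠ[nhds z]
      fun z => (Complex.ofRealCLM).comp (fderiv ℝ W z) := by
    filter_upwards [hW.eventually (by simp)] with y hy
    exact (Complex.ofRealCLM.hasFDerivAt.comp y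
      (hy.differentiableAt (by norm_num)).hasFDerivAt).fderiv
  have hd : DifferentiableAt ℝ (fderiv ℝ W) z :=
    (hW.fderiv_right (m := 1) (by norm_num)).differentiableAt (by norm_num)
  rw [h1.fderiv_eq]
  have h2 : HasFDerivAt (fun z => (Complex.ofRealCLM).comp (fderiv ℝ W z))
      ((ContinuousLinearMap.compL ℝ (Fin n → ℂ) ℝ ℂ Complex.ofRealCLM).comp
        (fderiv ℝ (fderiv ℝ W) z)) z :=
    (ContinuousLinearMap.compL ℝ (Fin n → ℂ) ℝ ℂ Complex.ofRealCLM).hasFDerivAt.comp z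
      hd.hasFDerivAt
  rw [h2.fderiv]
  simp

lemma fderiv_ofReal_comp {W : (Fin n → ℂ) → ℝ} {z : Fin n → ℂ} (hW : DifferentiableAt ℝ W z)
    (v : Fin n → ℂ) : fderiv ℝ (fun z => (W z : ℂ)) z v = (fderiv ℝ W z v : ℂ) := by
  have : HasFDerivAt (fun z => (W z : ℂ)) (Complex.ofRealCLM.comp (fderiv ℝ W z)) z :=
    Complex.ofRealCLM.hasFDerivAt.comp z hW.hasFDerivAt
  rw [this.fderiv]
  simp

lemma eq_sum_re_im (ξ : Fin n → ℂ) :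
    ξ = ∑ j, ((ξ j).re • (Pi.single j 1 : Fin n → ℂ)
      + (ξ j).im • (Pi.single j Complex.I : Fin n → ℂ)) := by
  ext k
  simp only [Finset.sum_apply, Pi.add_apply, Pi.smul_apply, Pi.single_apply]
  rw [Finset.sum_eq_single k]
  · simp
  · intro b _ hb
    simp [hb.symm]
  · simp

lemma hessC_eq_fderiv (f : (Fin n → ℂ) → ℝ) (z ξ : Fin n → ℂ) :
    hessC n f z ξ = (1 / 4) * (fderiv ℝ (fderiv ℝ f) z ξ ξ
      + fderiv ℝ (fderiv ℝ f) z (Complex.I • ξ) (Complex.I • ξ)) := by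
  simp [hessC, iteratedFDeriv_two_apply]

lemma delPair_eq_sum {f : (Fin n → ℂ) → ℝ} {z : Fin n → ℂ} (hf : DifferentiableAt ℝ f z)
    (ξ : Fin n → ℂ) :
    delPair n f z ξ = ∑ j, wd (-Complex.I) j (fun z => (f z : ℂ)) z * ξ j := by
  have h1 : fderiv ℝ f z ξ = ∑ j, ((ξ j).re * fderiv ℝ f z (Pi.single j 1)
      + (ξ j).im * fderiv ℝ f z (Pi.single j Complex.I)) := by
    conv_lhs => rw [eq_sum_re_im ξ]
    simp [map_sum, map_add]
  have h2 : fderiv ℝ f z (Complex.I • ξ) = ∑ j, (-(ξ j).im * fderiv ℝ f z (Pi.single j 1)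
      + (ξ j).re * fderiv ℝ f z (Pi.single j Complex.I)) := by
    conv_lhs => rw [eq_sum_re_im (Complex.I • ξ)]
    simp [map_sum, map_add]
  rw [delPair, h1, h2]
  push_cast
  rw [Finset.mul_sum, ← Finset.sum_sub_distrib, Finset.mul_sum]
  refine Finset.sum_congr rfl fun j _ => ?_
  rw [wd, fderiv_ofReal_comp hf, fderiv_ofReal_comp hf]
  nth_rewrite 5 [← Complex.re_add_im (ξ j)]
  linear_combination ((1 / 2 : ℂ) * (ξ j).im * fderiv ℝ f z (Pi.single j Complex.I)) * Complex.I_sq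

lemma hessC_eq_sum {W : (Fin n → ℂ) → ℝ} {z : Fin n → ℂ} (hW : ContDiffAt ℝ 2 W z)
    (ξ : Fin n → ℂ) :
    hessC n W z ξ = (∑ j, ∑ k, wd Complex.I k (wd (-Complex.I) j fun z => (W z : ℂ)) z
      * ξ j * (starRingEnd ℂ) (ξ k)).re := by
  have hs : IsSymmSndFDerivAt ℝ W z := hW.isSymmSndFDerivAt (by simp)
  have hW' : ContDiffAt ℝ 2 (fun z => (W z : ℂ)) z := Complex.ofRealCLM.contDiff.contDiffAt.comp z hW
  set A := fderiv ℝ (fderiv ℝ W) z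
  have h1 (ζ : Fin n → ℂ) : A ζ ζ = ∑ j, ∑ k,
      ((ζ j).re * (ζ k).re * A (Pi.single j 1) (Pi.single k 1)
      + (ζ j).re * (ζ k).im * A (Pi.single j 1) (Pi.single k Complex.I)
      + (ζ j).im * (ζ k).re * A (Pi.single j Complex.I) (Pi.single k 1)
      + (ζ j).im * (ζ k).im * A (Pi.single j Complex.I) (Pi.single k Complex.I)) := by
    conv_lhs => rw [eq_sum_re_im ζ]
    simp only [map_sum, sum_apply, map_add, map_smul, add_apply, smul_apply,
      smul_eq_mul]
    rw [Finset.sum_comm]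
    refine Finset.sum_congr rfl fun j _ => ?_
    rw [Finset.mul_sum, Finset.mul_sum, ← Finset.sum_add_distrib]
    refine Finset.sum_congr rfl fun k _ => ?_
    ring
  rw [hessC_eq_fderiv, h1, h1, ← Finset.sum_add_distrib, Finset.mul_sum, Complex.re_sum]
  refine Finset.sum_congr rfl fun j _ => ?_
  rw [← Finset.sum_add_distrib, Finset.mul_sum, Complex.re_sum]
  refine Finset.sum_congr rfl fun k _ => ?_
  rw [wd_wd _ _ _ _ hW']
  simp only [exists_hessian_ofReal hW]
  rw [hs.eq (Pi.single k 1) (Pi.single j 1), hs.eq (Pi.single k Complex.I) (Pi.single j Complex.I),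
    hs.eq (Pi.single k Complex.I) (Pi.single j 1), hs.eq (Pi.single k 1) (Pi.single j Complex.I)]
  simp [Complex.mul_re, Complex.mul_im]
  ring

lemma wd_exp_neg {W : (Fin n → ℂ) → ℝ} {z : Fin n → ℂ} (hW : DifferentiableAt ℝ W z) (s : ℂ)
    (j : Fin n) : wd s j (fun z => (Real.exp (-W z) : ℂ)) z
      = - (wd s j (fun z => (W z : ℂ)) z * (Real.exp (-W z) : ℂ)) := by
  have h : fderiv ℝ (fun z => Real.exp (-W z)) z = - (Real.exp (-W z) • fderiv ℝ W z) := by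
    rw [(hW.hasFDerivAt.fun_neg.exp).fderiv]; simp
  have hd : DifferentiableAt ℝ (fun z => Real.exp (-W z)) z := hW.fun_neg.exp
  rw [wd, wd, fderiv_ofReal_comp hd, fderiv_ofReal_comp hd, fderiv_ofReal_comp hW,
    fderiv_ofReal_comp hW, h]
  simp
  ring

/-- Integrated commutator identity for `∂/∂z̄_k` and the weighted adjoint of `∂/∂z̄_j`. -/
lemma integral_weighted_adjoint_mul {W : (Fin n → ℂ) → ℝ} (hW : ContDiff ℝ 2 W)
    {f g : (Fin n → ℂ) → ℂ} (hf : ContDiff ℝ 2 f) (hg : ContDiff ℝ 2 g)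
    (hfc : HasCompactSupport f) (j k : Fin n) :
    ∫ z, (wd (-Complex.I) j (fun z => (W z : ℂ)) z * f z - wd (-Complex.I) j f z)
        * (starRingEnd ℂ) (wd (-Complex.I) k (fun z => (W z : ℂ)) z * g z - wd (-Complex.I) k g z)
        * (Real.exp (-W z) : ℂ)
      = ∫ z, (wd Complex.I k f z * (starRingEnd ℂ) (wd Complex.I j g z) * (Real.exp (-W z) : ℂ)
        + wd Complex.I k (wd (-Complex.I) j fun z => (W z : ℂ)) z * f z * (starRingEnd ℂ) (g z)
          * (Real.exp (-W z) : ℂ)) := by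
  set V : (Fin n → ℂ) → ℂ := fun z => (W z : ℂ) with hV
  set e : (Fin n → ℂ) → ℂ := fun z => (Real.exp (-W z) : ℂ) with he
  set G : (Fin n → ℂ) → ℂ := fun z => (starRingEnd ℂ) (g z) with hG
  have hVc : ContDiff ℝ 2 V := Complex.ofRealCLM.contDiff.comp hW
  have hec : ContDiff ℝ 2 e := Complex.ofRealCLM.contDiff.comp (Real.contDiff_exp.comp hW.neg)
  have hGc : ContDiff ℝ 2 G := Complex.conjCLE.contDiff.comp hg
  have h12 : (1 : WithTop ℕ∞) ≤ 2 := by norm_num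
  have hdiff {h : (Fin n → ℂ) → ℂ} (hh : ContDiff ℝ 2 h) (z) : DifferentiableAt ℝ h z :=
    (hh.differentiable (by norm_num)).differentiableAt
  have hdiff1 {h : (Fin n → ℂ) → ℂ} (hh : ContDiff ℝ 1 h) (z) : DifferentiableAt ℝ h z :=
    (hh.differentiable (by norm_num)).differentiableAt
  have hwd {h : (Fin n → ℂ) → ℂ} (hh : ContDiff ℝ 2 h) (s : ℂ) (j : Fin n) :
      ContDiff ℝ 1 (wd s j h) := contDiff_wd s j hh (by norm_num)
  have hec' (s : ℂ) (j : Fin n) (z) : wd s j e z = - (wd s j V z * e z) :=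
    wd_exp_neg ((hW.differentiable (by norm_num)).differentiableAt) s j
  set D : (Fin n → ℂ) → ℂ := fun z => wd (-Complex.I) j V z * f z - wd (-Complex.I) j f z with hD
  have hDc : ContDiff ℝ 1 D := ((hwd hVc _ _).mul (hf.of_le h12)).sub (hwd hf _ _)
  have hDs : HasCompactSupport D := by
    have h1 : HasCompactSupport fun z => wd (-Complex.I) j V z * f z := hfc.mul_left
    exact h1.sub (hasCompactSupport_wd _ _ hfc)
  have cV (z) : (starRingEnd ℂ) (V z) = V z := Complex.conj_ofReal _
  have hcV (z) : (starRingEnd ℂ) (wd (-Complex.I) k V z) = wd Complex.I k V z := by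
    rw [conj_wd]; simp [V]
  have hL : ∀ z, D z * (starRingEnd ℂ) (wd (-Complex.I) k V z * g z - wd (-Complex.I) k g z) * e z
      = - (D z * wd Complex.I k (fun z => G z * e z) z) := by
    intro z
    rw [wd_mul (hdiff hGc z) (hdiff hec z), hec', map_sub, map_mul, hcV, conj_wd]
    simp only [map_neg, Complex.conj_I, neg_neg, hG]
    ring
  set P : (Fin n → ℂ) → ℂ := fun z => wd Complex.I k f z * e z with hP
  have hPc : ContDiff ℝ 1 P := (hwd hf _ _).mul (hec.of_le h12)
  have hPs : HasCompactSupport P := (hasCompactSupport_wd _ _ hfc).mul_right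
  have hR : ∀ z, wd Complex.I k f z * (starRingEnd ℂ) (wd Complex.I j g z) * e z
        + wd Complex.I k (wd (-Complex.I) j V) z * f z * (starRingEnd ℂ) (g z) * e z
      = P z * wd (-Complex.I) j G z
        + wd Complex.I k (wd (-Complex.I) j V) z * f z * G z * e z := by
    intro z
    rw [conj_wd]
    simp only [Complex.conj_I, hP, hG]
    ring
  have hint1 : Integrable fun z => P z * wd (-Complex.I) j G z :=
    (hPc.continuous.mul (continuous_wd _ _ (hGc.of_le h12))).integrable_of_hasCompactSupport
      hPs.mul_right
  have hint2 : Integrable fun z => wd Complex.I k (wd (-Complex.I) j V) z * f z * G z * e z :=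
    ((((continuous_wd _ _ (hwd hVc _ _)).mul hf.continuous).mul hGc.continuous).mul
      hec.continuous).integrable_of_hasCompactSupport
      ((hfc.mul_left (f := wd Complex.I k (wd (-Complex.I) j V))).mul_right.mul_right)
  have hint3 : Integrable fun z => wd (-Complex.I) j P z * G z :=
    ((continuous_wd _ _ hPc).mul hGc.continuous).integrable_of_hasCompactSupport
      (hasCompactSupport_wd _ _ hPs).mul_right
  refine (integral_congr_ae (Filter.Eventually.of_forall hL)).trans ?_
  refine Eq.trans ?_ (integral_congr_ae (Filter.Eventually.of_forall hR)).symm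
  rw [integral_neg,
    integral_mul_wd _ _ hDc ((hGc.mul hec).of_le h12) (Or.inl hDs), neg_neg,
    integral_add hint1 hint2, integral_mul_wd _ _ hPc (hGc.of_le h12) (Or.inl hPs),
    ← integral_neg, ← integral_add hint3.fun_neg hint2]
  refine integral_congr_ae (Filter.Eventually.of_forall fun z => ?_)
  have hD' : wd Complex.I k D z = wd Complex.I k (wd (-Complex.I) j V) z * f z
      + wd (-Complex.I) j V z * wd Complex.I k f z - wd Complex.I k (wd (-Complex.I) j f) z := by
    rw [hD, wd_sub ((hdiff1 (hwd hVc _ _) z).fun_mul (hdiff hf z)) (hdiff1 (hwd hf _ _) z),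
      wd_mul (hdiff1 (hwd hVc _ _) z) (hdiff hf z)]
  have hP' : wd (-Complex.I) j P z = wd Complex.I k (wd (-Complex.I) j f) z * e z
      - wd Complex.I k f z * wd (-Complex.I) j V z * e z := by
    rw [hP, wd_mul (hdiff1 (hwd hf _ _) z) (hdiff hec z), hec', wd_comm _ _ _ _ hf.contDiffAt]
    ring
  simp only [hD', hP']
  ring

/-- Pointwise algebra behind the Morrey–Kohn–Hörmander formula. -/
lemma neg_half_sum_normSq_sub_le (X : Fin n → Fin n → ℂ) :
    - ((1 / 2) * ∑ j, ∑ k, Complex.normSq (X j k - X k j))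
      ≤ (∑ j, ∑ k, X k j * (starRingEnd ℂ) (X j k)).re := by
  have h : ∑ j, ∑ k, Complex.normSq (X j k - X k j) = 2 * (∑ j, ∑ k, Complex.normSq (X j k))
      - 2 * (∑ j, ∑ k, X k j * (starRingEnd ℂ) (X j k)).re := by
    have h1 : ∑ j, ∑ k, Complex.normSq (X k j) = ∑ j, ∑ k, Complex.normSq (X j k) :=
      Finset.sum_comm
    simp only [Complex.re_sum]
    rw [two_mul]
    nth_rewrite 2 [← h1]
    simp only [Finset.mul_sum, ← Finset.sum_add_distrib, ← Finset.sum_sub_distrib]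
    refine Finset.sum_congr rfl fun j _ => Finset.sum_congr rfl fun k _ => ?_
    simp only [Complex.normSq_apply, Complex.sub_re, Complex.sub_im, Complex.mul_re,
      Complex.conj_re, Complex.conj_im]
    ring
  have h2 : 0 ≤ ∑ j, ∑ k, Complex.normSq (X j k) :=
    Finset.sum_nonneg fun j _ => Finset.sum_nonneg fun k _ => Complex.normSq_nonneg _
  linarith

/-- The Morrey–Kohn–Hörmander inequality for compactly supported smooth `(0,1)`-forms. -/
theorem integral_hessC_le {W : (Fin n → ℂ) → ℝ} (hW : ContDiff ℝ 2 W)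
    {b : Fin n → (Fin n → ℂ) → ℂ} (hb : ∀ j, ContDiff ℝ 2 (b j))
    (hc : ∀ j, HasCompactSupport (b j)) :
    ∫ z, hessC n W z (fun j => b j z) * Real.exp (-W z)
      ≤ (1 / 2) * (∑ j, ∑ k, ∫ z,
          Complex.normSq (wd Complex.I j (b k) z - wd Complex.I k (b j) z) * Real.exp (-W z))
        + ∫ z, Complex.normSq (∑ j, (wd (-Complex.I) j (fun z => (W z : ℂ)) z * b j z
            - wd (-Complex.I) j (b j) z)) * Real.exp (-W z) := by
  have h12 : (1 : WithTop ℕ∞) ≤ 2 := by norm_num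
  have hVc : ContDiff ℝ 2 (fun z => (W z : ℂ)) := Complex.ofRealCLM.contDiff.comp hW
  have hwV (s j) : ContDiff ℝ 1 (wd s j (fun z => (W z : ℂ))) :=
    contDiff_wd s j hVc (by norm_num)
  have hwb (s j k) : Continuous (wd s j (b k)) := continuous_wd s j ((hb k).of_le h12)
  have hsb (s j k) : HasCompactSupport (wd s j (b k)) := hasCompactSupport_wd s j (hc k)
  have hbc (j) : Continuous (b j) := (hb j).continuous
  have he : Continuous fun z => (Real.exp (-W z) : ℂ) := by
    have := hW.continuous
    fun_prop
  have heR : Continuous fun z => Real.exp (-W z) := by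
    have := hW.continuous
    fun_prop
  have hconj : Continuous (starRingEnd ℂ) := Complex.continuous_conj
  set δ : Fin n → (Fin n → ℂ) → ℂ := fun j z =>
    wd (-Complex.I) j (fun z => (W z : ℂ)) z * b j z - wd (-Complex.I) j (b j) z with hδ
  have hδc (j) : Continuous (δ j) := ((hwV _ _).continuous.mul (hbc j)).sub (hwb _ _ _)
  have hδs (j) : HasCompactSupport (δ j) := by
    have h1 : HasCompactSupport fun z => wd (-Complex.I) j (fun z => (W z : ℂ)) z * b j z :=
      (hc j).mul_left
    exact h1.sub (hsb _ _ _)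
  have iP (j k) : Integrable fun z => δ j z * (starRingEnd ℂ) (δ k z) * (Real.exp (-W z) : ℂ) :=
    (((hδc j).mul (hconj.comp (hδc k))).mul he).integrable_of_hasCompactSupport
      (hδs j).mul_right.mul_right
  have iQ (j k) : Integrable fun z => wd Complex.I k (b j) z
      * (starRingEnd ℂ) (wd Complex.I j (b k) z) * (Real.exp (-W z) : ℂ) :=
    (((hwb _ _ _).mul (hconj.comp (hwb _ _ _))).mul he).integrable_of_hasCompactSupport
      (hsb _ _ _).mul_right.mul_right
  have iR (j k) : Integrable fun z => wd Complex.I k (wd (-Complex.I) j fun z => (W z : ℂ)) z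
      * b j z * (starRingEnd ℂ) (b k z) * (Real.exp (-W z) : ℂ) :=
    ((((continuous_wd _ _ (hwV _ _)).mul (hbc j)).mul (hconj.comp (hbc k))).mul
      he).integrable_of_hasCompactSupport
      (((hc j).mul_left
        (f := wd Complex.I k (wd (-Complex.I) j fun z => (W z : ℂ)))).mul_right.mul_right)
  have key : ∑ j, ∑ k, ∫ z, δ j z * (starRingEnd ℂ) (δ k z) * (Real.exp (-W z) : ℂ)
      = (∑ j, ∑ k, ∫ z, wd Complex.I k (b j) z
          * (starRingEnd ℂ) (wd Complex.I j (b k) z) * (Real.exp (-W z) : ℂ))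
        + ∑ j, ∑ k, ∫ z, wd Complex.I k (wd (-Complex.I) j fun z => (W z : ℂ)) z
          * b j z * (starRingEnd ℂ) (b k z) * (Real.exp (-W z) : ℂ) := by
    rw [← Finset.sum_add_distrib]
    refine Finset.sum_congr rfl fun j _ => ?_
    rw [← Finset.sum_add_distrib]
    refine Finset.sum_congr rfl fun k _ => ?_
    rw [integral_weighted_adjoint_mul hW (hb j) (hb k) (hc j) j k, integral_add (iQ j k) (iR j k)]
  have sum_int (F : Fin n → Fin n → (Fin n → ℂ) → ℂ) (hF : ∀ j k, Integrable (F j k)) :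
      (∑ j, ∑ k, ∫ z, F j k z).re = ∫ z, (∑ j, ∑ k, F j k z).re := by
    have h1 (j) : Integrable fun z => ∑ k, F j k z := integrable_finsetSum _ fun k _ => hF j k
    have h2 : Integrable fun z => ∑ j, ∑ k, F j k z := integrable_finsetSum _ fun j _ => h1 j
    have h3 : ∑ j, ∑ k, ∫ z, F j k z = ∫ z, ∑ j, ∑ k, F j k z := by
      rw [integral_finsetSum _ fun j _ => h1 j]
      exact Finset.sum_congr rfl fun j _ => (integral_finsetSum _ fun k _ => hF j k).symm
    rw [h3]
    exact (integral_re h2).symm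
  have keyR := congrArg Complex.re key
  rw [Complex.add_re, sum_int _ iP, sum_int _ iQ, sum_int _ iR] at keyR
  have eP : ∀ z, (∑ j, ∑ k, δ j z * (starRingEnd ℂ) (δ k z) * (Real.exp (-W z) : ℂ)).re
      = Complex.normSq (∑ j, δ j z) * Real.exp (-W z) := by
    intro z
    simp_rw [← Finset.sum_mul, ← Finset.mul_sum]
    rw [← Finset.sum_mul, ← map_sum, Complex.mul_conj, ← Complex.ofReal_mul, Complex.ofReal_re]
  have eR : ∀ z, (∑ j, ∑ k, wd Complex.I k (wd (-Complex.I) j fun z => (W z : ℂ)) z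
          * b j z * (starRingEnd ℂ) (b k z) * (Real.exp (-W z) : ℂ)).re
      = hessC n W z (fun j => b j z) * Real.exp (-W z) := by
    intro z
    simp_rw [← Finset.sum_mul]
    rw [Complex.re_mul_ofReal, hessC_eq_sum hW.contDiffAt]
  have iX (j k) : Integrable fun z =>
      Complex.normSq (wd Complex.I j (b k) z - wd Complex.I k (b j) z) * Real.exp (-W z) := by
    refine ((Complex.continuous_normSq.comp ((hwb _ _ _).sub (hwb _ _ _))).mul
      heR).integrable_of_hasCompactSupport ?_
    exact (((hsb _ j k).sub (hsb _ k j)).comp_left (g := Complex.normSq) (by simp)).mul_right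
  have eQ : - ((1 / 2) * ∑ j, ∑ k, ∫ z,
          Complex.normSq (wd Complex.I j (b k) z - wd Complex.I k (b j) z) * Real.exp (-W z))
      ≤ ∫ z, (∑ j, ∑ k, wd Complex.I k (b j) z
          * (starRingEnd ℂ) (wd Complex.I j (b k) z) * (Real.exp (-W z) : ℂ)).re := by
    have i1 (j) := integrable_finsetSum (Finset.univ : Finset (Fin n)) fun k _ => iX j k
    have i2 := integrable_finsetSum (Finset.univ : Finset (Fin n)) fun j _ => i1 j
    have e1 : ∑ j, ∑ k, ∫ z,
          Complex.normSq (wd Complex.I j (b k) z - wd Complex.I k (b j) z) * Real.exp (-W z)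
        = ∫ z, ∑ j, ∑ k,
          Complex.normSq (wd Complex.I j (b k) z - wd Complex.I k (b j) z) * Real.exp (-W z) := by
      rw [integral_finsetSum _ fun j _ => i1 j]
      exact Finset.sum_congr rfl fun j _ => (integral_finsetSum _ fun k _ => iX j k).symm
    rw [e1, ← integral_const_mul, ← integral_neg]
    refine integral_mono (i2.const_mul _).neg ?_ fun z => ?_
    · have h1 (j) := integrable_finsetSum (Finset.univ : Finset (Fin n)) fun k _ => iQ j k
      exact (integrable_finsetSum (Finset.univ : Finset (Fin n)) fun j _ => h1 j).re
    · simp_rw [← Finset.sum_mul]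
      rw [Complex.re_mul_ofReal, ← mul_assoc, ← neg_mul]
      exact mul_le_mul_of_nonneg_right
        (neg_half_sum_normSq_sub_le fun j k => wd Complex.I j (b k) z) (Real.exp_pos _).le
  simp only [eP, eR] at keyR
  linarith

end Bochner

section Mollification

open Filter Topology
open scoped ENNReal Convolution

variable {n : ℕ}

lemma tendsto_eLpNorm_translate_sub {f : (Fin n → ℂ) → ℂ} (hf : MemLp f 2) :
    Tendsto (fun y => eLpNorm (fun x => f (x - y) - f x) 2) (𝓝 0) (𝓝 0) := by
  let F : C((Fin n → ℂ), C((Fin n → ℂ), (Fin n → ℂ))) :=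
    (ContinuousMap.mk (fun a : (Fin n → ℂ) × (Fin n → ℂ) => a.2 - a.1)
      (by fun_prop)).curry
  have hmp (y : Fin n → ℂ) : MeasurePreserving (F y) := measurePreserving_sub_right volume y
  have h1 : Tendsto (fun y => Lp.compMeasurePreserving (F y) (hmp y) (hf.toLp f)) (𝓝 0)
      (𝓝 (Lp.compMeasurePreserving (F 0) (hmp 0) (hf.toLp f))) :=
    tendsto_const_nhds.compMeasurePreservingLp F.continuous.continuousAt _ _ (by simp)
  rw [tendsto_iff_edist_tendsto_0] at h1
  refine h1.congr fun y => ?_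
  rw [Lp.toLp_compMeasurePreserving hf (hmp y), Lp.toLp_compMeasurePreserving hf (hmp 0),
    Lp.edist_toLp_toLp]
  congr 1
  ext x
  simp [F]

lemma eLpNorm_convolution_sub_le {f : (Fin n → ℂ) → ℂ} (hfm : StronglyMeasurable f)
    (hf : MemLp f 2) {ρ : (Fin n → ℂ) → ℝ} (hρ : Continuous ρ) (hρc : HasCompactSupport ρ)
    (hρ0 : ∀ x, 0 ≤ ρ x) (hρ1 : ∫ x, ρ x = 1) {C : ℝ≥0∞}
    (hC : ∀ y, ρ y ≠ 0 → eLpNorm (fun x => f (x - y) - f x) 2 ≤ C) :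
    eLpNorm (fun x => (f ⋆[ContinuousLinearMap.mul ℝ ℂ] fun y => (ρ y : ℂ)) x - f x) 2 ≤ C := by
  set g : (Fin n → ℂ) → ℂ := fun y => (ρ y : ℂ) with hg
  have hgc : HasCompactSupport g := hρc.comp_left (g := ((↑) : ℝ → ℂ)) (by simp)
  have hgcont : Continuous g := by fun_prop
  have hρint : Integrable ρ := hρ.integrable_of_hasCompactSupport hρc
  have hρm : Measurable fun y => ENNReal.ofReal (ρ y) := hρ.measurable.ennreal_ofReal
  let P : Measure (Fin n → ℂ) := volume.withDensity fun y => ENNReal.ofReal (ρ y)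
  have hP : IsProbabilityMeasure P := ⟨by
    simp only [P, withDensity_apply _ MeasurableSet.univ, Measure.restrict_univ]
    rw [← ofReal_integral_eq_lintegral_ofReal hρint (.of_forall hρ0), hρ1, ENNReal.ofReal_one]⟩
  have hmeas : Measurable fun p : (Fin n → ℂ) × (Fin n → ℂ) => f (p.1 - p.2) - f p.1 :=
    (hfm.measurable.comp (measurable_fst.sub measurable_snd)).sub
      (hfm.measurable.comp measurable_fst)
  have hex := hgc.convolutionExists_right (ContinuousLinearMap.mul ℝ ℂ)
    (hf.locallyIntegrable (by norm_num)) hgcont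
  have key (x : Fin n → ℂ) : ‖(f ⋆[ContinuousLinearMap.mul ℝ ℂ] g) x - f x‖ₑ ^ (2 : ℝ)
      ≤ ∫⁻ y, ‖f (x - y) - f x‖ₑ ^ (2 : ℝ) ∂P := by
    have hx : ∫ t, f x * g (x - t) = f x := by
      have h1 : ∫ t, g t = 1 := by rw [hg, integral_complex_ofReal, hρ1, ofReal_one]
      rw [integral_const_mul, integral_sub_left_eq_self g volume x, h1, mul_one]
    have h1 : (f ⋆[ContinuousLinearMap.mul ℝ ℂ] g) x - f x = ∫ t, (f t - f x) * g (x - t) := by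
      conv_lhs => rw [← hx]
      rw [convolution_def, ← integral_sub]
      · congr 1; ext t; simp [sub_mul]
      · exact hex x
      · exact ((hgcont.integrable_of_hasCompactSupport hgc).comp_sub_left x).const_mul _
    have h2 : ‖(f ⋆[ContinuousLinearMap.mul ℝ ℂ] g) x - f x‖ₑ ≤ ∫⁻ y, ‖f (x - y) - f x‖ₑ ∂P := by
      rw [h1]
      refine (enorm_integral_le_lintegral_enorm _).trans_eq ?_
      rw [lintegral_withDensity_eq_lintegral_mul _ hρm (by fun_prop)]
      rw [← lintegral_sub_left_eq_self _ x]
      refine lintegral_congr fun y => ?_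
      simp only [sub_sub_cancel, Pi.mul_apply, enorm_mul, hg]
      rw [mul_comm]
      congr 1
      rw [← ofReal_norm, Complex.norm_real, Real.norm_of_nonneg (hρ0 y)]
    have h3 := eLpNorm_le_eLpNorm_of_exponent_le (p := 1) (q := 2) (μ := P)
      (f := fun y => f (x - y) - f x) (by norm_num)
      (hmeas.comp (measurable_const.prodMk measurable_id)).aestronglyMeasurable
    rw [eLpNorm_one_eq_lintegral_enorm, eLpNorm_eq_lintegral_rpow_enorm_toReal (by simp) (by simp)]
      at h3
    refine (ENNReal.rpow_le_rpow (h2.trans h3) (by norm_num)).trans_eq ?_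
    rw [← ENNReal.rpow_mul]
    norm_num
  rw [eLpNorm_eq_lintegral_rpow_enorm_toReal (by simp) (by simp)]
  have h4 : ∫⁻ x, ‖(f ⋆[ContinuousLinearMap.mul ℝ ℂ] g) x - f x‖ₑ ^ (2 : ℝ) ≤ C ^ (2 : ℝ) := by
    refine (lintegral_mono key).trans ?_
    rw [lintegral_lintegral_swap (by
      have : Measurable fun p : (Fin n → ℂ) × (Fin n → ℂ) => ‖f (p.1 - p.2) - f p.1‖ₑ ^ (2 : ℝ) :=
        hmeas.enorm.pow_const _
      exact this.aemeasurable)]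
    calc ∫⁻ y, ∫⁻ x, ‖f (x - y) - f x‖ₑ ^ (2 : ℝ) ∂volume ∂P
        ≤ ∫⁻ _, C ^ (2 : ℝ) ∂P := by
          refine lintegral_mono_ae ?_
          refine (ae_withDensity_iff hρm).2 (.of_forall fun y hy => ?_)
          have h5 := hC y (fun h => hy (by simp [h]))
          rw [eLpNorm_eq_lintegral_rpow_enorm_toReal (by simp) (by simp)] at h5
          have h6 := ENNReal.rpow_le_rpow h5 (z := 2) (by norm_num)
          rw [← ENNReal.rpow_mul] at h6
          norm_num at h6 ⊢
          exact h6
      _ = C ^ (2 : ℝ) := by simp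
  have h7 := ENNReal.rpow_le_rpow h4 (z := 1 / 2) (by norm_num)
  rw [← ENNReal.rpow_mul] at h7
  norm_num at h7 ⊢
  exact h7

variable (n) in
/-- A sequence of standard mollifiers on `ℂⁿ`. -/
def mollifier (m : ℕ) (x : Fin n → ℂ) : ℂ :=
  (((⟨1 / (m + 2), 1 / (m + 1), by positivity,
    one_div_lt_one_div_of_lt (by positivity) (by linarith)⟩ :
      ContDiffBump (0 : Fin n → ℂ)).normed volume x : ℝ) : ℂ)

lemma contDiff_mollifier (m : ℕ) : ContDiff ℝ (⊤ : ℕ∞) (mollifier n m) :=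
  ofRealCLM.contDiff.comp (ContDiffBump.contDiff_normed _)

lemma hasCompactSupport_mollifier (m : ℕ) : HasCompactSupport (mollifier n m) :=
  (ContDiffBump.hasCompactSupport_normed _).comp_left (g := ((↑) : ℝ → ℂ)) (by simp)

/-- Smooth compactly supported regularisation of `f`. -/
def mollify (m : ℕ) (f : (Fin n → ℂ) → ℂ) : (Fin n → ℂ) → ℂ :=
  f ⋆[ContinuousLinearMap.mul ℝ ℂ] mollifier n m

lemma mollify_congr {f f' : (Fin n → ℂ) → ℂ} (h : f =ᵐ[volume] f') (m : ℕ) :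
    mollify m f = mollify m f' :=
  convolution_congr _ h (ae_eq_refl _)

lemma eLpNorm_mollify_sub_le {f : (Fin n → ℂ) → ℂ} (hfm : StronglyMeasurable f)
    (hf : MemLp f 2) (m : ℕ) {C : ℝ≥0∞}
    (hC : ∀ y ∈ ball (0 : Fin n → ℂ) (1 / (m + 1)), eLpNorm (fun x => f (x - y) - f x) 2 ≤ C) :
    eLpNorm (fun x => mollify m f x - f x) 2 ≤ C :=
  eLpNorm_convolution_sub_le hfm hf (ContDiffBump.continuous_normed _)
    (ContDiffBump.hasCompactSupport_normed _) (fun x => ContDiffBump.nonneg_normed _ x)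
    (ContDiffBump.integral_normed _) fun y hy => hC y
      ((ContDiffBump.support_normed_eq (μ := volume) _).subset hy)

lemma tendsto_eLpNorm_mollify_sub {f : (Fin n → ℂ) → ℂ} (hf : MemLp f 2) :
    Tendsto (fun m => eLpNorm (fun x => mollify m f x - f x) 2) atTop (𝓝 0) := by
  have hae := hf.1.ae_eq_mk
  have hfm : StronglyMeasurable (hf.1.mk f) := hf.1.stronglyMeasurable_mk
  have hf2 : MemLp (hf.1.mk f) 2 := hf.ae_eq hae
  have hcongr (m : ℕ) : eLpNorm (fun x => mollify m f x - f x) 2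
      = eLpNorm (fun x => mollify m (hf.1.mk f) x - hf.1.mk f x) 2 := by
    refine eLpNorm_congr_ae ?_
    rw [mollify_congr hae]
    filter_upwards [hae] with x hx
    rw [hx]
  simp only [hcongr]
  have ht := tendsto_eLpNorm_translate_sub hf2
  rw [ENNReal.tendsto_nhds_zero] at ht ⊢
  intro ε hε
  obtain ⟨δ, hδ, hball⟩ := Metric.eventually_nhds_iff_ball.1 (ht ε hε)
  filter_upwards [(tendsto_one_div_add_atTop_nhds_zero_nat (𝕜 := ℝ)).eventually_lt_const hδ]
    with m hm
  exact eLpNorm_mollify_sub_le hfm hf2 m fun y hy => hball y (ball_subset_ball hm.le hy)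

lemma memLp_mollify {f : (Fin n → ℂ) → ℂ} (hf : MemLp f 2) (m : ℕ) : MemLp (mollify m f) 2 := by
  have hae := hf.1.ae_eq_mk
  have hf2 : MemLp (hf.1.mk f) 2 := hf.ae_eq hae
  rw [mollify_congr hae]
  have htr (y : Fin n → ℂ) : MemLp (fun x => hf.1.mk f (x - y)) 2 :=
    hf2.comp_measurePreserving (measurePreserving_sub_right volume y)
  have hle := eLpNorm_mollify_sub_le hf.1.stronglyMeasurable_mk hf2 m
    (C := 2 * eLpNorm (hf.1.mk f) 2) fun y _ => by
      refine (eLpNorm_sub_le (htr y).1 hf2.1 (by norm_num)).trans_eq ?_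
      have : eLpNorm (fun x => hf.1.mk f (x - y)) 2 = eLpNorm (hf.1.mk f) 2 :=
        eLpNorm_comp_measurePreserving hf2.1 (measurePreserving_sub_right volume y)
      rw [this, two_mul]
  have hcont : Continuous (mollify m (hf.1.mk f)) :=
    (hasCompactSupport_mollifier m).continuous_convolution_right _
      (hf2.locallyIntegrable (by norm_num)) (contDiff_mollifier m).continuous
  have hsub : MemLp (fun x => mollify m (hf.1.mk f) x - hf.1.mk f x) 2 :=
    ⟨hcont.aestronglyMeasurable.sub hf2.1,
      hle.trans_lt (ENNReal.mul_lt_top (by simp) hf2.eLpNorm_lt_top)⟩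
  refine (hsub.add hf2).ae_eq (.of_forall fun x => ?_)
  simp

lemma contDiff_mollify {f : (Fin n → ℂ) → ℂ} (hf : LocallyIntegrable f) (m : ℕ) :
    ContDiff ℝ (⊤ : ℕ∞) (mollify m f) :=
  (hasCompactSupport_mollifier m).contDiff_convolution_right _ hf (contDiff_mollifier m)

lemma hasCompactSupport_mollify {f : (Fin n → ℂ) → ℂ} (hf : HasCompactSupport f) (m : ℕ) :
    HasCompactSupport (mollify m f) :=
  HasCompactSupport.convolution _ hf (hasCompactSupport_mollifier m)

lemma mollify_apply (m : ℕ) (f : (Fin n → ℂ) → ℂ) (x : Fin n → ℂ) :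
    mollify m f x = ∫ t, f t * mollifier n m (x - t) := rfl

lemma wd_comp_sub_left (s : ℂ) (j : Fin n) {g : (Fin n → ℂ) → ℂ}
    (hg : Differentiable ℝ g) (x t : Fin n → ℂ) : wd s j (fun t => g (x - t)) t = - wd s j g (x - t) := by
  have h : fderiv ℝ (fun t => g (x - t)) t = - fderiv ℝ g (x - t) := by
    have := (hg (x - t)).hasFDerivAt.comp t ((hasFDerivAt_id t).const_sub x)
    refine this.fderiv.trans ?_
    ext v
    simp
  simp only [wd, h, neg_apply]
  ring

lemma wd_mollify {f : (Fin n → ℂ) → ℂ} (hf : LocallyIntegrable f) (s : ℂ) (j : Fin n) (m : ℕ)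
    (x : Fin n → ℂ) :
    wd s j (mollify m f) x = - ∫ t, f t * wd s j (fun t => mollifier n m (x - t)) t := by
  have hg1 : ContDiff ℝ 1 (mollifier n m) := (contDiff_mollifier m).of_le (by simp)
  have h := (hasCompactSupport_mollifier m).hasFDerivAt_convolution_right
    (ContinuousLinearMap.mul ℝ ℂ) hf hg1 x
  have hc : HasCompactSupport (fderiv ℝ (mollifier n m)) :=
    (hasCompactSupport_mollifier m).fderiv ℝ
  have hex := hc.convolutionExists_right ((ContinuousLinearMap.mul ℝ ℂ).precompR (Fin n → ℂ)) hf
    (hg1.continuous_fderiv (by norm_num)) x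
  have hv (v : Fin n → ℂ) : fderiv ℝ (mollify m f) x v
      = ∫ t, f t * fderiv ℝ (mollifier n m) (x - t) v := by
    have : fderiv ℝ (mollify m f) x = _ := h.fderiv
    rw [this, convolution_def, ContinuousLinearMap.integral_apply hex]
    rfl
  have hint (v : Fin n → ℂ) : Integrable fun t => f t * fderiv ℝ (mollifier n m) (x - t) v := by
    have := hex.integrable.apply_continuousLinearMap v
    exact this
  simp only [wd_comp_sub_left s j (hg1.differentiable (by norm_num)), mul_neg, integral_neg, neg_neg]
  simp only [wd, hv]
  rw [← integral_const_mul, ← integral_add (hint _) ((hint _).const_mul _), ← integral_const_mul]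
  congr 1
  ext t
  ring

end Mollification

section Approximation

open Filter Topology
open scoped ENNReal

variable {n : ℕ}

/-- Convergence in `L²` of a sequence of square-integrable functions. -/
structure L2Tendsto (x : ℕ → (Fin n → ℂ) → ℂ) (f : (Fin n → ℂ) → ℂ) : Prop where
  memLp_seq : ∀ m, MemLp (x m) 2
  memLp_lim : MemLp f 2
  tendsto : Tendsto (fun m => eLpNorm (fun z => x m z - f z) 2) atTop (𝓝 0)

namespace L2Tendsto

variable {x y : ℕ → (Fin n → ℂ) → ℂ} {f g h : (Fin n → ℂ) → ℂ} {C : ℝ}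

lemma of_toLp (hx : ∀ m, MemLp (x m) 2) (hf : MemLp f 2)
    (h : Tendsto (fun m => (hx m).toLp (x m)) atTop (𝓝 (hf.toLp f))) : L2Tendsto x f :=
  ⟨hx, hf, (Lp.tendsto_Lp_iff_tendsto_eLpNorm'' x hx f hf).1 h⟩

lemma toLp (h : L2Tendsto x f) :
    Tendsto (fun m => (h.memLp_seq m).toLp (x m)) atTop (𝓝 (h.memLp_lim.toLp f)) :=
  (Lp.tendsto_Lp_iff_tendsto_eLpNorm'' x h.memLp_seq f h.memLp_lim).2 h.tendsto

lemma add (h₁ : L2Tendsto x f) (h₂ : L2Tendsto y g) :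
    L2Tendsto (fun m z => x m z + y m z) (fun z => f z + g z) :=
  of_toLp (fun m => (h₁.memLp_seq m).add (h₂.memLp_seq m)) (h₁.memLp_lim.add h₂.memLp_lim)
    (h₁.toLp.add h₂.toLp)

lemma sub (h₁ : L2Tendsto x f) (h₂ : L2Tendsto y g) :
    L2Tendsto (fun m z => x m z - y m z) (fun z => f z - g z) :=
  of_toLp (fun m => (h₁.memLp_seq m).sub (h₂.memLp_seq m)) (h₁.memLp_lim.sub h₂.memLp_lim)
    (h₁.toLp.sub h₂.toLp)

lemma zero : L2Tendsto (n := n) (fun _ _ => 0) fun _ => 0 :=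
  ⟨fun _ => MemLp.zero, MemLp.zero, by simp⟩

lemma sum {ι : Type*} (s : Finset ι) {x : ι → ℕ → (Fin n → ℂ) → ℂ} {f : ι → (Fin n → ℂ) → ℂ}
    (h : ∀ i ∈ s, L2Tendsto (x i) (f i)) :
    L2Tendsto (fun m z => ∑ i ∈ s, x i m z) (fun z => ∑ i ∈ s, f i z) := by
  classical
  induction s using Finset.induction_on with
  | empty => simpa using zero
  | insert a s ha ih =>
    simp only [Finset.sum_insert ha]
    exact (h a (by simp)).add (ih fun i hi => h i (by simp [hi]))

lemma bdd_mul (hx : L2Tendsto x f) (hh : Continuous h) (hC : ∀ z, ‖h z‖ ≤ C) :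
    L2Tendsto (fun m z => h z * x m z) (fun z => h z * f z) := by
  have hm {u : (Fin n → ℂ) → ℂ} (hu : MemLp u 2) : MemLp (fun z => h z * u z) 2 :=
    hu.of_le_mul (c := C) (hh.aestronglyMeasurable.mul hu.1) (.of_forall fun z => by
      rw [norm_mul]; exact mul_le_mul_of_nonneg_right (hC z) (norm_nonneg _))
  refine ⟨fun m => hm (hx.memLp_seq m), hm hx.memLp_lim, ?_⟩
  have h1 : Tendsto (fun m => ENNReal.ofReal C * eLpNorm (fun z => x m z - f z) 2) atTop
      (𝓝 (ENNReal.ofReal C * 0)) :=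
    ENNReal.Tendsto.const_mul hx.tendsto (Or.inr ENNReal.ofReal_ne_top)
  rw [mul_zero] at h1
  refine tendsto_of_tendsto_of_tendsto_of_le_of_le tendsto_const_nhds h1 (fun _ => zero_le)
    fun m => ?_
  refine eLpNorm_le_mul_eLpNorm_of_ae_le_mul (.of_forall fun z => ?_) 2
  rw [← mul_sub, norm_mul]
  exact mul_le_mul_of_nonneg_right (hC z) (norm_nonneg _)

lemma integral_mul_conj (hx : L2Tendsto x f) (hy : L2Tendsto y g) :
    Tendsto (fun m => ∫ z, x m z * (starRingEnd ℂ) (y m z)) atTop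
      (𝓝 (∫ z, f z * (starRingEnd ℂ) (g z))) := by
  have key {u v : (Fin n → ℂ) → ℂ} (hu : MemLp u 2) (hv : MemLp v 2) :
      inner ℂ (hv.toLp v) (hu.toLp u) = ∫ z, u z * (starRingEnd ℂ) (v z) := by
    rw [L2.inner_def]
    refine integral_congr_ae ?_
    filter_upwards [hu.coeFn_toLp, hv.coeFn_toLp] with z h1 h2
    rw [h1, h2]
    simp
  have := hy.toLp.inner (𝕜 := ℂ) hx.toLp
  simpa only [key] using this

end L2Tendsto

lemma integrable_mul_conj {u v : (Fin n → ℂ) → ℂ} {μ : Measure (Fin n → ℂ)} (hu : MemLp u 2 μ)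
    (hv : MemLp v 2 μ) : Integrable (fun z => u z * (starRingEnd ℂ) (v z)) μ :=
  hu.integrable_mul (hv.star)

lemma tendsto_integral_normSq {x : ℕ → (Fin n → ℂ) → ℂ} {f : (Fin n → ℂ) → ℂ} {w : (Fin n → ℂ) → ℝ}
    {C : ℝ} (hx : L2Tendsto x f) (hw : Continuous w) (hC : ∀ z, |w z| ≤ C) :
    Tendsto (fun m => ∫ z, normSq (x m z) * w z) atTop (𝓝 (∫ z, normSq (f z) * w z)) := by
  have h := (hx.bdd_mul (h := fun z => (w z : ℂ)) (by fun_prop)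
    (fun z => by simpa using hC z)).integral_mul_conj hx
  have key (u : (Fin n → ℂ) → ℂ) : ∫ z, (w z : ℂ) * u z * (starRingEnd ℂ) (u z)
      = ((∫ z, normSq (u z) * w z : ℝ) : ℂ) := by
    rw [← integral_complex_ofReal]
    congr 1
    ext z
    rw [mul_assoc, mul_conj]
    push_cast
    ring
  simp only [key] at h
  exact (continuous_re.tendsto _).comp h

lemma l2Tendsto_mollify {f : (Fin n → ℂ) → ℂ} (hf : MemLp f 2) :
    L2Tendsto (fun m => mollify m f) f :=
  ⟨fun m => memLp_mollify hf m, hf, tendsto_eLpNorm_mollify_sub hf⟩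

/-- The basic weighted inequality for `L²` coefficients whose `∂̄` and formal adjoint, in the sense
of distributions, are square integrable. -/
theorem integral_hessC_le_of_memLp {W : (Fin n → ℂ) → ℝ} (hW : ContDiff ℝ 2 W)
    (hWc : HasCompactSupport W) {b : Fin n → (Fin n → ℂ) → ℂ}
    {F : Fin n → Fin n → (Fin n → ℂ) → ℂ} {G : (Fin n → ℂ) → ℂ}
    (hb : ∀ j, MemLp (b j) 2) (hbc : ∀ j, HasCompactSupport (b j))
    (hF : ∀ j k, MemLp (F j k) 2) (hG : MemLp G 2)
    (hbF : ∀ j k, ∀ h : (Fin n → ℂ) → ℂ, ContDiff ℝ (⊤ : ℕ∞) h → HasCompactSupport h →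
      (∫ z, b k z * wd Complex.I j h z) - ∫ z, b j z * wd Complex.I k h z = - ∫ z, F j k z * h z)
    (hbG : ∀ h : (Fin n → ℂ) → ℂ, ContDiff ℝ (⊤ : ℕ∞) h → HasCompactSupport h →
      ∑ j, ∫ z, b j z * wd (-Complex.I) j h z = - ∫ z, G z * h z) :
    ∫ z, hessC n W z (fun j => b j z) * Real.exp (-W z)
      ≤ (1 / 2) * (∑ j, ∑ k, ∫ z, normSq (F j k z) * Real.exp (-W z))
        + ∫ z, normSq ((∑ j, wd (-Complex.I) j (fun z => (W z : ℂ)) z * b j z) - G z)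
          * Real.exp (-W z) := by
  have hWC : ContDiff ℝ 2 fun z => (W z : ℂ) := ofRealCLM.contDiff.comp hW
  have hWCc : HasCompactSupport fun z => (W z : ℂ) := hWc.comp_left (g := ((↑) : ℝ → ℂ)) (by simp)
  have hec : Continuous fun z => Real.exp (-W z) := by have := hW.continuous; fun_prop
  obtain ⟨M, hM⟩ := hWc.exists_bound_of_continuous hW.continuous
  have hebd (z : Fin n → ℂ) : |Real.exp (-W z)| ≤ Real.exp M := by
    rw [abs_of_pos (Real.exp_pos _)]
    exact Real.exp_le_exp.2 ((neg_le_abs _).trans (hM z))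
  have hli (f : (Fin n → ℂ) → ℂ) (hf : MemLp f 2) : LocallyIntegrable f :=
    hf.locallyIntegrable (by norm_num)
  have hdb (j k : Fin n) (m : ℕ) (z : Fin n → ℂ) : wd Complex.I j (mollify m (b k)) z
      - wd Complex.I k (mollify m (b j)) z = mollify m (F j k) z := by
    rw [wd_mollify (hli _ (hb k)), wd_mollify (hli _ (hb j)), mollify_apply]
    have := hbF j k (fun t => mollifier n m (z - t))
      ((contDiff_mollifier m).comp (contDiff_const.sub contDiff_id))
      ((hasCompactSupport_mollifier m).comp_homeomorph (Homeomorph.subLeft z))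
    linear_combination -this
  have hdel (m : ℕ) (z : Fin n → ℂ) :
      ∑ j, wd (-Complex.I) j (mollify m (b j)) z = mollify m G z := by
    have := hbG (fun t => mollifier n m (z - t))
      ((contDiff_mollifier m).comp (contDiff_const.sub contDiff_id))
      ((hasCompactSupport_mollifier m).comp_homeomorph (Homeomorph.subLeft z))
    rw [mollify_apply, ← neg_eq_iff_eq_neg.2 this, ← Finset.sum_neg_distrib]
    exact Finset.sum_congr rfl fun j _ => wd_mollify (hli _ (hb j)) _ _ _ _
  have hineq (m : ℕ) := integral_hessC_le hW (b := fun j => mollify m (b j))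
    (fun j => (contDiff_mollify (hli _ (hb j)) m).of_le (by norm_cast))
    (fun j => hasCompactSupport_mollify (hbc j) m)
  simp only [hdb, Finset.sum_sub_distrib, hdel] at hineq
  have hlim (j : Fin n) : L2Tendsto (fun m => mollify m (b j)) (b j) := l2Tendsto_mollify (hb j)
  have hHc (j k : Fin n) : Continuous (wd Complex.I k (wd (-Complex.I) j fun z => (W z : ℂ))) :=
    continuous_wd _ _ (contDiff_wd _ _ hWC (by norm_num))
  have hlhs : Tendsto (fun m => ∫ z, hessC n W z (fun j => mollify m (b j) z) * Real.exp (-W z))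
      atTop (𝓝 (∫ z, hessC n W z (fun j => b j z) * Real.exp (-W z))) := by
    choose A hA using fun j k => (hasCompactSupport_wd Complex.I k (hasCompactSupport_wd
      (-Complex.I) j hWCc)).exists_bound_of_continuous (hHc j k)
    let H (j k : Fin n) (z : Fin n → ℂ) : ℂ :=
      wd Complex.I k (wd (-Complex.I) j fun z => (W z : ℂ)) z * (Real.exp (-W z) : ℂ)
    have hHcont (j k : Fin n) : Continuous (H j k) := (hHc j k).mul (by fun_prop)
    have hHb (j k : Fin n) (z : Fin n → ℂ) : ‖H j k z‖ ≤ A j k * Real.exp M := by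
      rw [norm_mul, Complex.norm_real]
      exact mul_le_mul (hA j k z) (hebd z) (norm_nonneg _) ((norm_nonneg _).trans (hA j k z))
    have key (u : Fin n → (Fin n → ℂ) → ℂ) (hu : ∀ j, MemLp (u j) 2) :
        ∫ z, hessC n W z (fun j => u j z) * Real.exp (-W z)
          = (∑ j, ∑ k, ∫ z, H j k z * u j z * (starRingEnd ℂ) (u k z)).re := by
      have hi (j k : Fin n) : Integrable fun z => H j k z * u j z * (starRingEnd ℂ) (u k z) :=
        integrable_mul_conj ((hu j).of_le_mul (c := A j k * Real.exp M)
          ((hHcont j k).aestronglyMeasurable.mul (hu j).1) (.of_forall fun z => by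
            rw [norm_mul]; exact mul_le_mul_of_nonneg_right (hHb j k z) (norm_nonneg _))) (hu k)
      have h1 : ∑ j, ∑ k, ∫ z, H j k z * u j z * (starRingEnd ℂ) (u k z)
          = ∫ z, ∑ j, ∑ k, H j k z * u j z * (starRingEnd ℂ) (u k z) := by
        rw [integral_finsetSum _ fun j _ => integrable_finsetSum _ fun k _ => hi j k]
        exact Finset.sum_congr rfl fun j _ => (integral_finsetSum _ fun k _ => hi j k).symm
      rw [h1]
      refine Eq.trans ?_ (integral_re (𝕜 := ℂ) (integrable_finsetSum _ fun j _ =>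
        integrable_finsetSum _ fun k _ => hi j k))
      congr 1
      ext z
      rw [hessC_eq_sum hW.contDiffAt, RCLike.re_to_complex, ← re_mul_ofReal, Finset.sum_mul]
      congr 1
      refine Finset.sum_congr rfl fun j _ => ?_
      rw [Finset.sum_mul]
      refine Finset.sum_congr rfl fun k _ => ?_
      simp only [H]
      ring
    simp only [key _ fun j => (hlim j).memLp_lim, key _ fun j => (hlim j).memLp_seq _]
    refine (continuous_re.tendsto _).comp ?_
    refine tendsto_finsetSum _ fun j _ => tendsto_finsetSum _ fun k _ => ?_
    exact ((hlim j).bdd_mul (hHcont j k) (hHb j k)).integral_mul_conj (hlim k)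
  refine le_of_tendsto_of_tendsto' hlhs (Tendsto.add (Tendsto.const_mul _
    (tendsto_finsetSum _ fun j _ => tendsto_finsetSum _ fun k _ =>
      tendsto_integral_normSq (l2Tendsto_mollify (hF j k)) hec hebd)) ?_) hineq
  refine tendsto_integral_normSq (L2Tendsto.sub (L2Tendsto.sum _ fun j _ => ?_)
    (l2Tendsto_mollify hG)) hec hebd
  have hc : Continuous (wd (-Complex.I) j fun z => (W z : ℂ)) :=
    continuous_wd _ _ (hWC.of_le (by norm_num))
  obtain ⟨A, hA⟩ := (hasCompactSupport_wd (-Complex.I) j hWCc).exists_bound_of_continuous hc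
  exact (hlim j).bdd_mul hc hA

end Approximation

section Cutoff

open Filter Topology
open scoped Manifold

variable {n : ℕ} {D K : Set (Fin n → ℂ)}

lemma exists_contDiff_cutoff (hK : IsCompact K) (hD : IsOpen D) (hKD : K ⊆ D) :
    ∃ χ : (Fin n → ℂ) → ℝ, ContDiff ℝ (⊤ : ℕ∞) χ ∧ HasCompactSupport χ ∧ tsupport χ ⊆ D ∧
      (∀ z ∈ K, χ =ᶠ[𝓝 z] 1) ∧ ∀ z, χ z ∈ Icc (0 : ℝ) 1 := by
  obtain ⟨K', hK', hKK', hK'D⟩ := exists_compact_between hK hD hKD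
  obtain ⟨χ, h1, h0, hχ⟩ := exists_contMDiffMap_one_nhds_of_subset_interior
    (n := (⊤ : ℕ∞)) (𝓘(ℝ, Fin n → ℂ)) hK.isClosed hKK'
  have hts : tsupport χ ⊆ K' := closure_minimal (fun z hz => by
    by_contra h
    exact hz (h0 z h)) hK'.isClosed
  refine ⟨χ, χ.contMDiff.contDiff, hK'.of_isClosed_subset (isClosed_tsupport _) hts,
    hts.trans hK'D, fun z hz => ?_, hχ⟩
  exact (h1.filter_mono (nhds_le_nhdsSet hz))

lemma contDiff_mul_of_tsupport_subset {A : Type*} [NormedRing A] [NormedAlgebra ℝ A]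
    {m : WithTop ℕ∞} {χ f : (Fin n → ℂ) → A} (hχ : ContDiff ℝ m χ) (hf : ContDiffOn ℝ m f D)
    (hD : IsOpen D) (hsupp : tsupport χ ⊆ D) : ContDiff ℝ m fun z => χ z * f z := by
  refine contDiff_iff_contDiffAt.2 fun z => ?_
  by_cases hz : z ∈ D
  · exact hχ.contDiffAt.mul (hf.contDiffAt (hD.mem_nhds hz))
  · have h0 : (fun z => χ z * f z) =ᶠ[𝓝 z] fun _ => 0 := by
      filter_upwards [notMem_tsupport_iff_eventuallyEq.1 fun h => hz (hsupp h)] with w hw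
      simp [hw]
    exact contDiffAt_const.congr_of_eventuallyEq h0

lemma hessC_congr {f g : (Fin n → ℂ) → ℝ} {z : Fin n → ℂ} (h : f =ᶠ[𝓝 z] g) (ξ : Fin n → ℂ) :
    hessC n f z ξ = hessC n g z ξ := by
  simp only [hessC, (h.iteratedFDeriv ℝ 2).eq_of_nhds]

lemma hessC_zero (f : (Fin n → ℂ) → ℝ) (z : Fin n → ℂ) : hessC n f z 0 = 0 := by
  have h : iteratedFDeriv ℝ 2 f z ![0, 0] = 0 :=
    (iteratedFDeriv ℝ 2 f z).map_coord_zero (0 : Fin 2) rfl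
  simp [hessC, h]

/-- A version of `integral_hessC_le_of_memLp` for weights defined near the supports only. -/
theorem integral_hessC_le_of_memLp_of_contDiffOn {W : (Fin n → ℂ) → ℝ} (hD : IsOpen D)
    (hW : ContDiffOn ℝ 2 W D) (hK : IsCompact K) (hKD : K ⊆ D) {b : Fin n → (Fin n → ℂ) → ℂ}
    {F : Fin n → Fin n → (Fin n → ℂ) → ℂ} {G : (Fin n → ℂ) → ℂ}
    (hb : ∀ j, MemLp (b j) 2) (hF : ∀ j k, MemLp (F j k) 2) (hG : MemLp G 2)
    (hbK : ∀ j, ∀ z ∉ K, b j z = 0) (hFK : ∀ j k, ∀ z ∉ K, F j k z = 0) (hGK : ∀ z ∉ K, G z = 0)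
    (hbF : ∀ j k, ∀ h : (Fin n → ℂ) → ℂ, ContDiff ℝ (⊤ : ℕ∞) h → HasCompactSupport h →
      (∫ z, b k z * wd Complex.I j h z) - ∫ z, b j z * wd Complex.I k h z = - ∫ z, F j k z * h z)
    (hbG : ∀ h : (Fin n → ℂ) → ℂ, ContDiff ℝ (⊤ : ℕ∞) h → HasCompactSupport h →
      ∑ j, ∫ z, b j z * wd (-Complex.I) j h z = - ∫ z, G z * h z) :
    ∫ z, hessC n W z (fun j => b j z) * Real.exp (-W z)
      ≤ (1 / 2) * (∑ j, ∑ k, ∫ z, normSq (F j k z) * Real.exp (-W z))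
        + ∫ z, normSq ((∑ j, wd (-Complex.I) j (fun z => (W z : ℂ)) z * b j z) - G z)
          * Real.exp (-W z) := by
  obtain ⟨χ, hχ, hχc, hχD, hχK, -⟩ := exists_contDiff_cutoff hK hD hKD
  have hW' : ContDiff ℝ 2 fun z => χ z * W z :=
    contDiff_mul_of_tsupport_subset (hχ.of_le (by norm_cast)) hW hD hχD
  have heq {z : Fin n → ℂ} (hz : z ∈ K) : (fun z => χ z * W z) =ᶠ[𝓝 z] W := by
    filter_upwards [hχK z hz] with w hw
    simp [hw]
  have main := integral_hessC_le_of_memLp hW' hχc.mul_right hb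
    (fun j => HasCompactSupport.intro hK (hbK j)) hF hG hbF hbG
  have h1 (z : Fin n → ℂ) : hessC n (fun z => χ z * W z) z (fun j => b j z)
      * Real.exp (-(χ z * W z)) = hessC n W z (fun j => b j z) * Real.exp (-W z) := by
    by_cases hz : z ∈ K
    · rw [hessC_congr (heq hz), (heq hz).eq_of_nhds]
    · have : (fun j => b j z) = 0 := funext fun j => hbK j z hz
      rw [this, hessC_zero, hessC_zero, zero_mul, zero_mul]
  have h2 (j k : Fin n) (z : Fin n → ℂ) : normSq (F j k z) * Real.exp (-(χ z * W z))
      = normSq (F j k z) * Real.exp (-W z) := by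
    by_cases hz : z ∈ K
    · rw [(heq hz).eq_of_nhds]
    · simp [hFK j k z hz]
  have h3 (z : Fin n → ℂ) :
      normSq ((∑ j, wd (-Complex.I) j (fun z => ((χ z * W z : ℝ) : ℂ)) z * b j z) - G z)
        * Real.exp (-(χ z * W z))
      = normSq ((∑ j, wd (-Complex.I) j (fun z => (W z : ℂ)) z * b j z) - G z)
        * Real.exp (-W z) := by
    by_cases hz : z ∈ K
    · have (j : Fin n) : wd (-Complex.I) j (fun z => ((χ z * W z : ℝ) : ℂ)) z
          = wd (-Complex.I) j (fun z => (W z : ℂ)) z :=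
        wd_congr ((heq hz).fun_comp ((↑) : ℝ → ℂ))
      simp only [this, (heq hz).eq_of_nhds]
    · simp [hbK _ z hz, hGK z hz]
  simpa only [h1, h2, h3] using main

end Cutoff

section Projection

open Filter Topology
open scoped ENNReal

variable {n : ℕ} {D : Set (Fin n → ℂ)}

lemma integral_mul_eq_inner {μ : Measure (Fin n → ℂ)} {ψ : (Fin n → ℂ) → ℂ} (hψ : MemLp ψ 2 μ)
    (f : Lp ℂ 2 μ) : ∫ z, f z * ψ z ∂μ = inner ℂ (hψ.star.toLp (star ψ)) f := by
  rw [L2.inner_def]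
  refine integral_congr_ae ?_
  filter_upwards [hψ.star.coeFn_toLp] with z hz
  rw [hz]
  simp

lemma memLp_mul_of_tsupport_subset (hD : IsOpen D) {χ f : (Fin n → ℂ) → ℂ} (hχ : Continuous χ)
    (hχc : HasCompactSupport χ) (hχD : tsupport χ ⊆ D) (hf : ContinuousOn f D)
    (μ : Measure (Fin n → ℂ)) [IsFiniteMeasureOnCompacts μ] :
    MemLp (fun z => χ z * f z) 2 μ := by
  have := contDiff_mul_of_tsupport_subset (m := 0) (contDiff_zero.2 hχ) (contDiffOn_zero.2 hf) hD hχD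
  exact this.continuous.memLp_of_hasCompactSupport hχc.mul_right

lemma integral_dbar_symm {f φ : (Fin n → ℂ) → ℂ} (hf : ContDiff ℝ 1 f) (hφ : ContDiff ℝ 2 φ)
    (hc : HasCompactSupport φ) (j k : Fin n) :
    ∫ z, wd Complex.I j f z * wd Complex.I k φ z = ∫ z, wd Complex.I k f z * wd Complex.I j φ z := by
  have h1 (j k : Fin n) : ∫ z, wd Complex.I j f z * wd Complex.I k φ z
      = - ∫ z, f z * wd Complex.I j (wd Complex.I k φ) z := by
    rw [integral_mul_wd _ _ hf (contDiff_wd _ _ hφ (by norm_num))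
      (Or.inr (hasCompactSupport_wd _ _ hc)), neg_neg]
  rw [h1, h1]
  congr 2
  ext z
  rw [wd_comm _ _ _ _ hφ.contDiffAt]

lemma IsTest.memLp_mul_wd {φ : (Fin n → ℂ) → ℂ} (hφ : IsTest n D φ) (hD : IsOpen D)
    {p : (Fin n → ℂ) → ℂ} (hp : ContinuousOn p D) (k : Fin n) (μ : Measure (Fin n → ℂ))
    [IsFiniteMeasureOnCompacts μ] : MemLp (fun z => p z * dbarCoord n φ k z) 2 μ := by
  simp_rw [mul_comm (p _), dbarCoord_eq_wd]
  exact memLp_mul_of_tsupport_subset hD (continuous_wd _ _ (hφ.1.of_le (by norm_cast)))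
    (hasCompactSupport_wd _ _ hφ.2.1) ((tsupport_wd_subset _ _ _).trans hφ.2.2) hp μ

lemma setIntegral_eq_of_tsupport_subset {f : (Fin n → ℂ) → ℂ} (h : ∀ z ∉ D, f z = 0) :
    ∫ z in D, f z = ∫ z, f z :=
  setIntegral_eq_integral_of_forall_compl_eq_zero h

variable (n) in
/-- The tuples `γ` in `L²(D)ⁿ` such that `pγ` is `∂̄`-closed on `D`. -/
def dbarClosedSubmodule (hD : IsOpen D) {p : (Fin n → ℂ) → ℂ} (hp : ContinuousOn p D) :
    Submodule ℂ (PiLp 2 fun _ : Fin n => Lp ℂ 2 (volume.restrict D)) :=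
  ⨅ (j : Fin n) (k : Fin n) (φ : {φ // IsTest n D φ}),
    LinearMap.ker (((innerSL ℂ ((φ.2.memLp_mul_wd hD hp k (volume.restrict D)).star.toLp _)).comp
      (PiLp.proj 2 (fun _ : Fin n => Lp ℂ 2 (volume.restrict D)) j)
      - (innerSL ℂ ((φ.2.memLp_mul_wd hD hp j (volume.restrict D)).star.toLp _)).comp
      (PiLp.proj 2 (fun _ : Fin n => Lp ℂ 2 (volume.restrict D)) k) :
        (PiLp 2 fun _ : Fin n => Lp ℂ 2 (volume.restrict D)) →L[ℂ] ℂ)).toLinearMap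

lemma mem_dbarClosedSubmodule (hD : IsOpen D) {p : (Fin n → ℂ) → ℂ} (hp : ContinuousOn p D)
    (γ : PiLp 2 fun _ : Fin n => Lp ℂ 2 (volume.restrict D)) :
    γ ∈ dbarClosedSubmodule n hD hp ↔ ∀ j k φ, IsTest n D φ →
      ∫ z in D, γ j z * (p z * dbarCoord n φ k z) = ∫ z in D, γ k z * (p z * dbarCoord n φ j z) := by
  simp only [dbarClosedSubmodule, Submodule.mem_iInf, LinearMap.mem_ker, Subtype.forall]
  refine forall_congr' fun j => forall_congr' fun k => forall_congr' fun φ => forall_congr' fun h => ?_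
  rw [integral_mul_eq_inner (h.memLp_mul_wd hD hp k _),
    integral_mul_eq_inner (h.memLp_mul_wd hD hp j _)]
  exact sub_eq_zero

lemma isClosed_dbarClosedSubmodule (hD : IsOpen D) {p : (Fin n → ℂ) → ℂ} (hp : ContinuousOn p D) :
    IsClosed (dbarClosedSubmodule n hD hp : Set (PiLp 2 fun _ : Fin n =>
      Lp ℂ 2 (volume.restrict D))) := by
  simp only [dbarClosedSubmodule, Submodule.coe_iInf]
  exact isClosed_iInter fun j => isClosed_iInter fun k => isClosed_iInter fun φ =>
    ContinuousLinearMap.isClosed_ker _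

/-- Replacing a test form by its projection to the weighted `∂̄`-closed forms. -/
theorem exists_dbarClosed_projection (hD : IsOpen D) {p : (Fin n → ℂ) → ℝ}
    (hp : ContinuousOn p D) (hp0 : ∀ z ∈ D, 0 < p z) {w : Fin n → (Fin n → ℂ) → ℂ}
    (hw : ∀ j, IsTest n D (w j)) :
    ∃ γ : Fin n → (Fin n → ℂ) → ℂ, (∀ j, MemLp (γ j) 2 (volume.restrict D)) ∧
      (∀ j k φ, IsTest n D φ → ∫ z in D, γ j z * (p z * dbarCoord n φ k z)
        = ∫ z in D, γ k z * (p z * dbarCoord n φ j z)) ∧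
      (∀ h, ContDiff ℝ 1 h → HasCompactSupport h → tsupport h ⊆ D →
        ∑ j, ∫ z in D, γ j z * ((p z : ℂ)⁻¹ * (starRingEnd ℂ) (wd Complex.I j h z))
          = ∑ j, ∫ z in D, w j z * (starRingEnd ℂ) (wd Complex.I j h z)) ∧
      (∀ α : Fin n → (Fin n → ℂ) → ℂ, DbarClosed n D α →
        (∀ j, MemLp (fun z => α j z * (p z : ℂ)⁻¹) 2 (volume.restrict D)) →
        ∑ j, ∫ z in D, α j z * (p z : ℂ)⁻¹ * (starRingEnd ℂ) (γ j z)
          = ∑ j, ∫ z in D, α j z * (starRingEnd ℂ) (w j z)) := by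
  have hpC : ContinuousOn (fun z => (p z : ℂ)) D := continuous_ofReal.comp_continuousOn hp
  have hpC0 {z : Fin n → ℂ} (hz : z ∈ D) : (p z : ℂ) ≠ 0 := by exact_mod_cast (hp0 z hz).ne'
  have hpI : ContinuousOn (fun z => (p z : ℂ)⁻¹) D := hpC.inv₀ fun z hz => hpC0 hz
  have hpw (j : Fin n) : MemLp (fun z => w j z * (p z : ℂ)) 2 (volume.restrict D) :=
    memLp_mul_of_tsupport_subset hD (hw j).1.continuous (hw j).2.1 (hw j).2.2 hpC _
  let N := dbarClosedSubmodule n hD hpC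
  have : CompleteSpace N := (isClosed_dbarClosedSubmodule hD hpC).completeSpace_coe
  let f₀ : PiLp 2 fun _ : Fin n => Lp ℂ 2 (volume.restrict D) :=
    WithLp.toLp 2 fun j => (hpw j).toLp _
  let γ := N.starProjection f₀
  have hγ : γ ∈ N := N.starProjection_apply_mem f₀
  have key (q : Fin n → (Fin n → ℂ) → ℂ) (hq : ∀ j, MemLp (q j) 2 (volume.restrict D))
      (hqN : ∀ j k φ, IsTest n D φ → ∫ z in D, q j z * (p z * dbarCoord n φ k z)
        = ∫ z in D, q k z * (p z * dbarCoord n φ j z)) :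
      ∑ j, ∫ z in D, q j z * (starRingEnd ℂ) (γ j z)
        = ∑ j, ∫ z in D, q j z * (starRingEnd ℂ) (w j z * p z) := by
    let Q : PiLp 2 fun _ : Fin n => Lp ℂ 2 (volume.restrict D) :=
      WithLp.toLp 2 fun j => (hq j).toLp _
    have hQ : Q ∈ N := by
      refine (mem_dbarClosedSubmodule hD hpC Q).2 fun j k φ hφ => ?_
      have h1 (j k : Fin n) : ∫ z in D, Q j z * (p z * dbarCoord n φ k z)
          = ∫ z in D, q j z * (p z * dbarCoord n φ k z) := by
        refine integral_congr_ae ?_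
        filter_upwards [(hq j).coeFn_toLp] with z hz
        rw [← hz]
      rw [h1, h1]
      exact hqN j k φ hφ
    have h0 : inner ℂ (f₀ - γ) Q = 0 :=
      Submodule.inner_left_of_mem_orthogonal hQ (N.sub_starProjection_mem_orthogonal f₀)
    rw [inner_sub_left, sub_eq_zero, PiLp.inner_apply, PiLp.inner_apply] at h0
    have h2 (j : Fin n) : inner ℂ (f₀ j) (Q j) = ∫ z in D, q j z * (starRingEnd ℂ) (w j z * p z) := by
      rw [L2.inner_def]
      refine integral_congr_ae ?_
      filter_upwards [(hq j).coeFn_toLp, (hpw j).coeFn_toLp] with z h3 h4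
      simp only [f₀, Q, h3, h4]
      rfl
    have h5 (j : Fin n) : inner ℂ (γ j) (Q j) = ∫ z in D, q j z * (starRingEnd ℂ) (γ j z) := by
      rw [L2.inner_def]
      refine integral_congr_ae ?_
      filter_upwards [(hq j).coeFn_toLp] with z h3
      simp only [Q, h3]
      rfl
    simp only [h2, h5] at h0
    exact h0.symm
  refine ⟨fun j => γ j, fun j => Lp.memLp _, (mem_dbarClosedSubmodule hD hpC γ).1 hγ, ?_, ?_⟩
  · intro h hh hhc hhD
    have h1 := key (fun j z => wd Complex.I j h z * (p z : ℂ)⁻¹) (fun j =>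
      memLp_mul_of_tsupport_subset hD (continuous_wd _ _ hh) (hasCompactSupport_wd _ _ hhc)
        ((tsupport_wd_subset _ _ _).trans hhD) hpI _) (by
      intro j k φ hφ
      have h2 (j k : Fin n) : ∫ z in D, wd Complex.I j h z * (p z : ℂ)⁻¹ * (p z * dbarCoord n φ k z)
          = ∫ z, wd Complex.I j h z * wd Complex.I k φ z := by
        rw [← setIntegral_eq_of_tsupport_subset (D := D)]
        · refine setIntegral_congr_fun hD.measurableSet fun z hz => ?_
          have := hpC0 hz
          simp only [dbarCoord_eq_wd]
          field_simp
        · intro z hz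
          have : wd Complex.I j h z = 0 := image_eq_zero_of_notMem_tsupport
            fun h' => hz (hhD (tsupport_wd_subset _ _ _ h'))
          rw [this, zero_mul]
      rw [h2, h2]
      exact integral_dbar_symm hh (hφ.1.of_le (by norm_cast)) hφ.2.1 j k)
    have h3 := congrArg (starRingEnd ℂ) h1
    simp only [map_sum, ← integral_conj] at h3
    refine (Finset.sum_congr rfl fun j _ => ?_).trans
      (h3.trans (Finset.sum_congr rfl fun j _ => ?_))
    · refine setIntegral_congr_fun hD.measurableSet fun z _ => ?_
      simp only [map_mul, conj_conj, map_inv₀, conj_ofReal]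
      ring
    · refine setIntegral_congr_fun hD.measurableSet fun z hz => ?_
      have := hpC0 hz
      simp only [map_mul, conj_conj, map_inv₀, conj_ofReal]
      field_simp
  · intro α hα hαm
    have h1 := key (fun j z => α j z * (p z : ℂ)⁻¹) hαm (by
      intro j k φ hφ
      have h2 (j k : Fin n) : ∫ z in D, α j z * (p z : ℂ)⁻¹ * (p z * dbarCoord n φ k z)
          = ∫ z in D, α j z * dbarCoord n φ k z := by
        refine setIntegral_congr_fun hD.measurableSet fun z hz => ?_
        have := hpC0 hz
        field_simp
      rw [h2, h2]
      exact hα j k φ hφ)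
    refine h1.trans (Finset.sum_congr rfl fun j _ => ?_)
    refine setIntegral_congr_fun hD.measurableSet fun z hz => ?_
    have := hpC0 hz
    simp only [map_mul, conj_ofReal]
    field_simp

end Projection

section Curvature

open Filter Topology

variable {n : ℕ} {f g : (Fin n → ℂ) → ℝ} {z ξ : Fin n → ℂ}

lemma normSq_delPair (f : (Fin n → ℂ) → ℝ) (z ξ : Fin n → ℂ) :
    normSq (delPair n f z ξ)
      = (1 / 4) * (fderiv ℝ f z ξ ^ 2 + fderiv ℝ f z (Complex.I • ξ) ^ 2) := by
  simp only [delPair, normSq_apply]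
  simp
  ring

lemma hessC_add (hf : ContDiffAt ℝ 2 f z) (hg : ContDiffAt ℝ 2 g z) (ξ : Fin n → ℂ) :
    hessC n (fun z => f z + g z) z ξ = hessC n f z ξ + hessC n g z ξ := by
  have : iteratedFDeriv ℝ 2 (fun z => f z + g z) z
      = iteratedFDeriv ℝ 2 f z + iteratedFDeriv ℝ 2 g z := iteratedFDeriv_add_apply hf hg
  simp only [hessC, this, add_apply]
  ring

lemma delPair_add (hf : DifferentiableAt ℝ f z) (hg : DifferentiableAt ℝ g z) (ξ : Fin n → ℂ) :
    delPair n (fun z => f z + g z) z ξ = delPair n f z ξ + delPair n g z ξ := by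
  simp only [delPair, fderiv_fun_add hf hg, add_apply]
  push_cast
  ring

lemma delPair_comp {θ : ℝ → ℝ} {θ' : ℝ} (hθ : HasDerivAt θ θ' (f z)) (hf : DifferentiableAt ℝ f z)
    (ξ : Fin n → ℂ) : delPair n (fun z => θ (f z)) z ξ = θ' * delPair n f z ξ := by
  have h : HasFDerivAt (fun z => θ (f z)) (θ' • fderiv ℝ f z) z :=
    hθ.comp_hasFDerivAt z hf.hasFDerivAt
  simp only [delPair, h.fderiv, smul_apply, smul_eq_mul]
  push_cast
  ring

lemma hessC_comp {θ θ' : ℝ → ℝ} {θ'' : ℝ} (hθ : ∀ᶠ t in 𝓝 (f z), HasDerivAt θ (θ' t) t)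
    (hθ' : HasDerivAt θ' θ'' (f z)) (hf : ContDiffAt ℝ 2 f z) (ξ : Fin n → ℂ) :
    hessC n (fun z => θ (f z)) z ξ
      = θ' (f z) * hessC n f z ξ + θ'' * normSq (delPair n f z ξ) := by
  have h1 : fderiv ℝ (fun z => θ (f z)) =ᶠ[𝓝 z] fun y => θ' (f y) • fderiv ℝ f y := by
    filter_upwards [hf.continuousAt.eventually hθ, hf.eventually (by simp)] with y hy hfy
    exact (hy.comp_hasFDerivAt y (hfy.differentiableAt (by norm_num)).hasFDerivAt).fderiv
  have hd : DifferentiableAt ℝ (fderiv ℝ f) z :=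
    (hf.fderiv_right (m := 1) (by norm_num)).differentiableAt (by norm_num)
  have h2 := (hθ'.comp_hasFDerivAt z (hf.differentiableAt (by norm_num)).hasFDerivAt).smul
    hd.hasFDerivAt
  have h3 (v : Fin n → ℂ) : fderiv ℝ (fderiv ℝ fun z => θ (f z)) z v v
      = θ' (f z) * fderiv ℝ (fderiv ℝ f) z v v + θ'' * fderiv ℝ f z v ^ 2 := by
    rw [h1.fderiv_eq]
    have : fderiv ℝ (fun y => θ' (f y) • fderiv ℝ f y) z = _ := h2.fderiv
    rw [this]
    simp
    ring
  rw [hessC_eq_fderiv, hessC_eq_fderiv, normSq_delPair, h3, h3]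
  ring

lemma enormSq_nonneg (ξ : Fin n → ℂ) : 0 ≤ enormSq n ξ :=
  Finset.sum_nonneg fun _ _ => normSq_nonneg _

lemma contDiffAt_neg_log (hf : ContDiffAt ℝ 2 f z) (h0 : 0 < f z) :
    ContDiffAt ℝ 2 (fun z => -Real.log (f z)) z :=
  (hf.log h0.ne').neg

lemma delPair_neg_log (hf : ContDiffAt ℝ 2 f z) (h0 : 0 < f z) (ξ : Fin n → ℂ) :
    delPair n (fun z => -Real.log (f z)) z ξ = -((f z)⁻¹ : ℝ) * delPair n f z ξ := by
  have := delPair_comp (θ := fun t => -Real.log t) (Real.hasDerivAt_log h0.ne').fun_neg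
    (hf.differentiableAt (by norm_num)) ξ
  simpa using this

lemma hessC_neg_log (hf : ContDiffAt ℝ 2 f z) (h0 : 0 < f z) (ξ : Fin n → ℂ) :
    hessC n (fun z => -Real.log (f z)) z ξ
      = -(f z)⁻¹ * hessC n f z ξ + (f z ^ 2)⁻¹ * normSq (delPair n f z ξ) := by
  refine hessC_comp (θ := fun t => -Real.log t) (θ' := fun t => -t⁻¹) ?_ ?_ hf ξ
  · filter_upwards [lt_mem_nhds h0] with t ht
    exact (Real.hasDerivAt_log ht.ne').fun_neg
  · simpa using (hasDerivAt_inv h0.ne').fun_neg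

/-- Lower bound for the complex Hessian of the weight `λ - log τ + 2ψ + 3ψ²`. -/
lemma le_hessC_weight {lam tau psi : (Fin n → ℂ) → ℝ} {c₁ : ℝ}
    (hlam : ContDiffAt ℝ 2 lam z) (htau : ContDiffAt ℝ 2 tau z) (hpsi : ContDiffAt ℝ 2 psi z)
    (htau0 : 0 < tau z) (hpsi0 : 0 ≤ psi z) (hpsi' : 0 ≤ hessC n psi z ξ)
    (hTheta : c₁ * enormSq n ξ * Real.exp (-lam z) ≤ Theta n lam tau z ξ) :
    c₁ * enormSq n ξ * (Real.exp (-lam z) / tau z) +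
        2 * normSq (delPair n (fun z => -Real.log (tau z)) z ξ)
        + 6 * normSq (delPair n psi z ξ)
      ≤ hessC n (fun z => (lam z + psi z + 3 * psi z ^ 2) + (psi z + -Real.log (tau z))) z ξ := by
  have hq : ContDiffAt ℝ 2 (fun z => 3 * psi z ^ 2) z := contDiffAt_const.mul (hpsi.pow 2)
  have hl := contDiffAt_neg_log htau htau0
  have h3 : hessC n (fun z => 3 * psi z ^ 2) z ξ
      = 6 * psi z * hessC n psi z ξ + 6 * normSq (delPair n psi z ξ) := by
    refine hessC_comp (θ := fun t => 3 * t ^ 2) (θ' := fun t => 6 * t) (.of_forall fun t => ?_) ?_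
      hpsi ξ
    · exact ((hasDerivAt_pow 2 t).const_mul 3).congr_deriv (by norm_num; ring)
    · simpa using (hasDerivAt_id (psi z)).const_mul 6
  rw [hessC_add ((hlam.add hpsi).add hq) (hpsi.add hl), hessC_add (hlam.add hpsi) hq,
    hessC_add hlam hpsi, hessC_add hpsi hl, h3, hessC_neg_log htau htau0,
    delPair_neg_log htau htau0]
  have hT : c₁ * enormSq n ξ * (Real.exp (-lam z) / tau z)
      ≤ hessC n lam z ξ - (tau z)⁻¹ * hessC n tau z ξ
        - (tau z ^ 2)⁻¹ * normSq (delPair n tau z ξ) := by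
    have := mul_le_mul_of_nonneg_right hTheta (inv_nonneg.2 htau0.le)
    simp only [Theta] at this
    calc _ = c₁ * enormSq n ξ * Real.exp (-lam z) * (tau z)⁻¹ := by ring
      _ ≤ _ := this
      _ = _ := by field_simp
  have hnn : normSq (-(((tau z)⁻¹ : ℝ) : ℂ) * delPair n tau z ξ)
      = (tau z ^ 2)⁻¹ * normSq (delPair n tau z ξ) := by
    rw [normSq_mul, normSq_neg, normSq_ofReal]
    field_simp
  rw [hnn]
  nlinarith [mul_nonneg hpsi0 hpsi']

end Curvature

section CutoffForms

open Filter Topology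
open scoped ENNReal

variable {n : ℕ} {D : Set (Fin n → ℂ)}

lemma MemLp.integrable_mul_of_tsupport_subset (hD : IsOpen D) {u c q : (Fin n → ℂ) → ℂ}
    (hu : MemLp u 2 (volume.restrict D)) (hc : Continuous c) (hcc : HasCompactSupport c)
    (hcD : tsupport c ⊆ D) (hq : ContinuousOn q D) :
    Integrable (fun z => u z * (c z * q z)) (volume.restrict D) :=
  hu.integrable_mul (memLp_mul_of_tsupport_subset hD hc hcc hcD hq _)

lemma memLp_mul_mul_of_tsupport_subset (hD : IsOpen D) {u c q : (Fin n → ℂ) → ℂ}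
    (hu : MemLp u 2 (volume.restrict D)) (hc : Continuous c) (hcc : HasCompactSupport c)
    (hcD : tsupport c ⊆ D) (hq : ContinuousOn q D) :
    MemLp (fun z => c z * q z * u z) 2 volume := by
  have h := contDiff_mul_of_tsupport_subset (m := 0) (contDiff_zero.2 hc) (contDiffOn_zero.2 hq)
    hD hcD
  have hs : HasCompactSupport fun z => c z * q z := hcc.mul_right
  have hinf : MemLp (fun z => c z * q z) ∞ (volume.restrict D) := 
    h.continuous.memLp_top_of_hasCompactSupport hs _
  have h2 : MemLp (fun z => c z * q z * u z) 2 (volume.restrict D) := hu.mul hinf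
  have h3 := (memLp_indicator_iff_restrict hD.measurableSet).2 h2
  refine h3.ae_eq (.of_forall fun z => ?_)
  by_cases hz : z ∈ D
  · simp [hz]
  · simp [hz, image_eq_zero_of_notMem_tsupport fun h => hz (hcD h)]

variable {η : (Fin n → ℂ) → ℝ}

lemma tsupport_ofReal (η : (Fin n → ℂ) → ℝ) : tsupport (fun z => (η z : ℂ)) = tsupport η := by
  have : Function.support (fun z => (η z : ℂ)) = Function.support η := by
    ext z; simp
  simp [tsupport, this]

lemma hasCompactSupport_ofReal (hη : HasCompactSupport η) :
    HasCompactSupport fun z => (η z : ℂ) := by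
  rwa [HasCompactSupport, tsupport_ofReal]

lemma contDiff_ofReal_comp {m : WithTop ℕ∞} (hη : ContDiff ℝ m η) : ContDiff ℝ m fun z => (η z : ℂ) :=
  Complex.ofRealCLM.contDiff.comp hη

lemma contDiffOn_ofReal_comp {m : WithTop ℕ∞} (hη : ContDiffOn ℝ m η D) :
    ContDiffOn ℝ m (fun z => (η z : ℂ)) D :=
  Complex.ofRealCLM.contDiff.comp_contDiffOn hη

/-- The `∂̄` of a cut off `∂̄`-closed form. -/
lemma integral_cutoff_dbar (hD : IsOpen D) {p u v : (Fin n → ℂ) → ℂ} (hp : ContinuousOn p D)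
    (hu : MemLp u 2 (volume.restrict D)) (hv : MemLp v 2 (volume.restrict D)) {j k : Fin n}
    (huv : ∀ φ, IsTest n D φ → ∫ z in D, v z * (p z * dbarCoord n φ j z)
      = ∫ z in D, u z * (p z * dbarCoord n φ k z))
    (hη : ContDiff ℝ (⊤ : ℕ∞) η) (hηc : HasCompactSupport η) (hηD : tsupport η ⊆ D)
    {h : (Fin n → ℂ) → ℂ} (hh : ContDiff ℝ (⊤ : ℕ∞) h) :
    (∫ z, η z * p z * v z * wd Complex.I j h z) - ∫ z, η z * p z * u z * wd Complex.I k h z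
      = - ∫ z, (wd Complex.I j (fun z => (η z : ℂ)) z * p z * v z
          - wd Complex.I k (fun z => (η z : ℂ)) z * p z * u z) * h z := by
  have hηC := contDiff_ofReal_comp hη
  have hηCc := hasCompactSupport_ofReal hηc
  have hηCD : tsupport (fun z => (η z : ℂ)) ⊆ D := by rwa [tsupport_ofReal]
  have h1 (j : Fin n) : Continuous (wd Complex.I j fun z => (η z : ℂ)) :=
    continuous_wd _ _ (hηC.of_le (by norm_cast))
  have h2 (j : Fin n) : Continuous (wd Complex.I j h) :=
    continuous_wd _ _ (hh.of_le (by norm_cast))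
  have hw0 (j : Fin n) {z : Fin n → ℂ} (hz : z ∉ D) :
      wd Complex.I j (fun z => (η z : ℂ)) z = 0 :=
    image_eq_zero_of_notMem_tsupport fun h => hz (hηCD (tsupport_wd_subset _ _ _ h))
  have hη0 {z : Fin n → ℂ} (hz : z ∉ D) : (η z : ℂ) = 0 :=
    image_eq_zero_of_notMem_tsupport (f := fun z => (η z : ℂ)) fun h => hz (hηCD h)
  have htest : IsTest n D fun z => η z * h z :=
    ⟨hηC.mul hh, hηCc.mul_right, (tsupport_mul_subset_left (g := h)).trans hηCD⟩
  have hI1 {u : (Fin n → ℂ) → ℂ} (hu : MemLp u 2 (volume.restrict D)) (j : Fin n) :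
      Integrable (fun z => u z * ((η z * wd Complex.I j h z) * p z)) (volume.restrict D) :=
    MemLp.integrable_mul_of_tsupport_subset hD hu (hηC.continuous.mul (h2 j)) hηCc.mul_right
      ((tsupport_mul_subset_left (g := wd Complex.I j h)).trans hηCD) hp
  have hI2 {u : (Fin n → ℂ) → ℂ} (hu : MemLp u 2 (volume.restrict D)) (j : Fin n) :
      Integrable (fun z => u z * ((wd Complex.I j (fun z => (η z : ℂ)) z * h z) * p z))
        (volume.restrict D) :=
    MemLp.integrable_mul_of_tsupport_subset hD hu ((h1 j).mul hh.continuous)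
      (hasCompactSupport_wd _ _ hηCc).mul_right
      ((tsupport_mul_subset_left (g := h)).trans ((tsupport_wd_subset _ _ _).trans hηCD)) hp
  have key {u : (Fin n → ℂ) → ℂ} (hu : MemLp u 2 (volume.restrict D)) (j : Fin n) :
      ∫ z in D, u z * (p z * dbarCoord n (fun z => η z * h z) j z)
        = (∫ z in D, u z * ((η z * wd Complex.I j h z) * p z))
          + ∫ z in D, u z * ((wd Complex.I j (fun z => (η z : ℂ)) z * h z) * p z) := by
    rw [← integral_add (hI1 hu j) (hI2 hu j)]
    refine setIntegral_congr_fun hD.measurableSet fun z _ => ?_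
    rw [dbarCoord_eq_wd, wd_mul (hηC.differentiable (by simp) z) (hh.differentiable (by simp) z)]
    ring
  have e1 {u : (Fin n → ℂ) → ℂ} (j : Fin n) : ∫ z, η z * p z * u z * wd Complex.I j h z
      = ∫ z in D, u z * ((η z * wd Complex.I j h z) * p z) := by
    rw [← setIntegral_eq_of_tsupport_subset (D := D) fun z hz => by simp [hη0 hz]]
    exact setIntegral_congr_fun hD.measurableSet fun z _ => by ring
  have e2 : ∫ z, (wd Complex.I j (fun z => (η z : ℂ)) z * p z * v z
          - wd Complex.I k (fun z => (η z : ℂ)) z * p z * u z) * h z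
      = (∫ z in D, v z * ((wd Complex.I j (fun z => (η z : ℂ)) z * h z) * p z))
        - ∫ z in D, u z * ((wd Complex.I k (fun z => (η z : ℂ)) z * h z) * p z) := by
    rw [← integral_sub (hI2 hv j) (hI2 hu k),
      ← setIntegral_eq_of_tsupport_subset (D := D) fun z hz => by simp [hw0 _ hz]]
    exact setIntegral_congr_fun hD.measurableSet fun z _ => by ring
  have := huv _ htest
  rw [key hv, key hu] at this
  rw [e1, e1, e2]
  linear_combination this

/-- The weighted divergence of a cut off form. -/
lemma integral_cutoff_adjoint (hD : IsOpen D) {m : (Fin n → ℂ) → ℝ} (hm : ContDiffOn ℝ 2 m D)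
    {γ w : Fin n → (Fin n → ℂ) → ℂ} (hγ : ∀ j, MemLp (γ j) 2 (volume.restrict D))
    (hw : ∀ j, IsTest n D (w j))
    (hγw : ∀ h, ContDiff ℝ 1 h → HasCompactSupport h → tsupport h ⊆ D →
      ∑ j, ∫ z in D, γ j z * ((Real.exp (m z / 2) : ℂ)⁻¹ * (starRingEnd ℂ) (wd Complex.I j h z))
        = ∑ j, ∫ z in D, w j z * (starRingEnd ℂ) (wd Complex.I j h z))
    (hη : ContDiff ℝ (⊤ : ℕ∞) η) (hηc : HasCompactSupport η) (hηD : tsupport η ⊆ D)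
    {h : (Fin n → ℂ) → ℂ} (hh : ContDiff ℝ (⊤ : ℕ∞) h) :
    ∑ j, ∫ z, η z * (Real.exp (m z / 2) : ℂ) * γ j z * wd (-Complex.I) j h z
      = - ∫ z, (η z * (Real.exp (m z) : ℂ) * (∑ j, wd (-Complex.I) j (w j) z)
          + ∑ j, (wd (-Complex.I) j (fun z => (η z : ℂ)) z
              + η z * wd (-Complex.I) j (fun z => (m z : ℂ)) z)
            * (Real.exp (m z / 2) : ℂ) * γ j z) * h z := by
  have hηC := contDiff_ofReal_comp hη
  have hηCc := hasCompactSupport_ofReal hηc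
  have hηCD : tsupport (fun z => (η z : ℂ)) ⊆ D := by rwa [tsupport_ofReal]
  have hmC : ContDiffOn ℝ 2 (fun z => (m z : ℂ)) D := contDiffOn_ofReal_comp hm
  have hE : ContDiffOn ℝ 2 (fun z => (Real.exp (m z) : ℂ)) D := contDiffOn_ofReal_comp hm.exp
  have hP : ContinuousOn (fun z => (Real.exp (m z / 2) : ℂ)) D :=
    continuous_ofReal.comp_continuousOn (hm.continuousOn.div_const 2).rexp
  have hwm (j : Fin n) : ContinuousOn (wd (-Complex.I) j fun z => (m z : ℂ)) D := fun z hz =>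
    ((contDiffAt_wd (m' := 1) _ _ (hmC.contDiffAt (hD.mem_nhds hz))
      (by norm_num)).continuousAt).continuousWithinAt
  have h1 (j : Fin n) : Continuous (wd (-Complex.I) j fun z => (η z : ℂ)) :=
    continuous_wd _ _ (hηC.of_le (by norm_cast))
  have h2 (j : Fin n) : Continuous (wd (-Complex.I) j h) :=
    continuous_wd _ _ (hh.of_le (by norm_cast))
  have hw0 (j : Fin n) {z : Fin n → ℂ} (hz : z ∉ D) :
      wd (-Complex.I) j (fun z => (η z : ℂ)) z = 0 :=
    image_eq_zero_of_notMem_tsupport fun h => hz (hηCD (tsupport_wd_subset _ _ _ h))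
  have hη0 {z : Fin n → ℂ} (hz : z ∉ D) : (η z : ℂ) = 0 :=
    image_eq_zero_of_notMem_tsupport (f := fun z => (η z : ℂ)) fun h => hz (hηCD h)
  have hηh : tsupport (fun z => η z * h z) ⊆ D := (tsupport_mul_subset_left (g := h)).trans hηCD
  set q : (Fin n → ℂ) → ℂ := fun z => (η z * h z) * (Real.exp (m z) : ℂ) with hqdef
  have hq : ContDiff ℝ 1 q := contDiff_mul_of_tsupport_subset
    ((hηC.mul hh).of_le (by norm_cast)) (hE.of_le (by norm_num)) hD hηh
  have hqc : HasCompactSupport q := hηCc.mul_right.mul_right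
  have hqD : tsupport q ⊆ D := (tsupport_mul_subset_left
    (f := fun z => η z * h z) (g := fun z => (Real.exp (m z) : ℂ))).trans hηh
  have hqj (j : Fin n) {z : Fin n → ℂ} (hz : z ∈ D) : wd (-Complex.I) j q z
      = (wd (-Complex.I) j (fun z => (η z : ℂ)) z * h z + η z * wd (-Complex.I) j h z
        + η z * h z * wd (-Complex.I) j (fun z => (m z : ℂ)) z) * (Real.exp (m z) : ℂ) := by
    have hd1 := hηC.differentiable (by simp) z
    have hd2 := hh.differentiable (by simp) z
    have hmz := (hm.contDiffAt (hD.mem_nhds hz)).differentiableAt (by norm_num)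
    have hd3 := (hE.contDiffAt (hD.mem_nhds hz)).differentiableAt (by norm_num)
    have he : wd (-Complex.I) j (fun z => (Real.exp (m z) : ℂ)) z
        = wd (-Complex.I) j (fun z => (m z : ℂ)) z * (Real.exp (m z) : ℂ) := by
      have := wd_exp_neg (W := fun z => -m z) hmz.neg (-Complex.I) j
      simpa only [neg_neg, ofReal_neg, wd_neg, neg_mul] using this
    rw [hqdef, wd_mul (hd1.fun_mul hd2) hd3, wd_mul hd1 hd2, he]
    ring
  have hPE (z : Fin n → ℂ) : (Real.exp (m z / 2) : ℂ)⁻¹ * (Real.exp (m z) : ℂ)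
      = (Real.exp (m z / 2) : ℂ) := by
    rw [← ofReal_inv, ← ofReal_mul, ← Real.exp_neg, ← Real.exp_add]
    ring_nf
  have hA (j : Fin n) : Integrable (fun z => γ j z * ((η z * wd (-Complex.I) j h z)
      * (Real.exp (m z / 2) : ℂ))) (volume.restrict D) :=
    MemLp.integrable_mul_of_tsupport_subset hD (hγ j) (hηC.continuous.mul (h2 j)) hηCc.mul_right
      ((tsupport_mul_subset_left (g := wd (-Complex.I) j h)).trans hηCD) hP
  have hB (j : Fin n) : Integrable (fun z => γ j z *
      ((wd (-Complex.I) j (fun z => (η z : ℂ)) z * h z) * (Real.exp (m z / 2) : ℂ)))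
        (volume.restrict D) :=
    MemLp.integrable_mul_of_tsupport_subset hD (hγ j) ((h1 j).mul hh.continuous)
      (hasCompactSupport_wd _ _ hηCc).mul_right
      ((tsupport_mul_subset_left (g := h)).trans ((tsupport_wd_subset _ _ _).trans hηCD)) hP
  have hC (j : Fin n) : Integrable (fun z => γ j z * ((η z * h z)
      * (wd (-Complex.I) j (fun z => (m z : ℂ)) z * (Real.exp (m z / 2) : ℂ))))
        (volume.restrict D) :=
    MemLp.integrable_mul_of_tsupport_subset hD (hγ j) (hηC.mul hh).continuous hηCc.mul_right
      hηh ((hwm j).mul hP)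
  have hw1 (j : Fin n) : ContDiff ℝ 1 (w j) := (hw j).1.of_le (by norm_cast)
  have hR (j : Fin n) : Integrable (fun z => wd (-Complex.I) j (w j) z * q z)
      (volume.restrict D) :=
    (((continuous_wd _ _ (hw1 j)).mul hq.continuous).integrable_of_hasCompactSupport
      hqc.mul_left).restrict
  have hl (j : Fin n) : ∫ z in D, γ j z * ((Real.exp (m z / 2) : ℂ)⁻¹ * wd (-Complex.I) j q z)
      = ((∫ z in D, γ j z * ((η z * wd (-Complex.I) j h z) * (Real.exp (m z / 2) : ℂ)))
        + ∫ z in D, γ j z * ((wd (-Complex.I) j (fun z => (η z : ℂ)) z * h z)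
          * (Real.exp (m z / 2) : ℂ)))
        + ∫ z in D, γ j z * ((η z * h z)
          * (wd (-Complex.I) j (fun z => (m z : ℂ)) z * (Real.exp (m z / 2) : ℂ))) := by
    rw [← integral_add (hA j) (hB j), ← integral_add ((hA j).fun_add (hB j)) (hC j)]
    refine setIntegral_congr_fun hD.measurableSet fun z hz => ?_
    simp only [hqj j hz]
    linear_combination (γ j z * (wd (-Complex.I) j (fun z => (η z : ℂ)) z * h z
      + η z * wd (-Complex.I) j h z
      + η z * h z * wd (-Complex.I) j (fun z => (m z : ℂ)) z)) * hPE z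
  have hr (j : Fin n) : ∫ z in D, w j z * wd (-Complex.I) j q z
      = - ∫ z in D, wd (-Complex.I) j (w j) z * q z := by
    rw [setIntegral_eq_of_tsupport_subset fun z hz => ?_,
      setIntegral_eq_of_tsupport_subset fun z hz => ?_,
      integral_mul_wd _ _ (hw1 j) hq (Or.inr hqc)]
    · rw [image_eq_zero_of_notMem_tsupport fun h => hz (hqD h), mul_zero]
    · rw [image_eq_zero_of_notMem_tsupport fun h => hz ((hw j).2.2 h), zero_mul]
  have main := hγw (fun z => (starRingEnd ℂ) (q z)) (Complex.conjCLE.contDiff.comp hq)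
    (hqc.comp_left (map_zero _)) ((tsupport_comp_subset (map_zero (starRingEnd ℂ)) q).trans hqD)
  simp only [conj_wd, conj_I, conj_conj, hl, hr, Finset.sum_add_distrib,
    Finset.sum_neg_distrib] at main
  have e1 (j : Fin n) : ∫ z, η z * (Real.exp (m z / 2) : ℂ) * γ j z * wd (-Complex.I) j h z
      = ∫ z in D, γ j z * ((η z * wd (-Complex.I) j h z) * (Real.exp (m z / 2) : ℂ)) := by
    rw [← setIntegral_eq_of_tsupport_subset (D := D) fun z hz => by simp [hη0 hz]]
    exact setIntegral_congr_fun hD.measurableSet fun z _ => by ring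
  have e2 : ∫ z, (η z * (Real.exp (m z) : ℂ) * (∑ j, wd (-Complex.I) j (w j) z)
          + ∑ j, (wd (-Complex.I) j (fun z => (η z : ℂ)) z
              + η z * wd (-Complex.I) j (fun z => (m z : ℂ)) z)
            * (Real.exp (m z / 2) : ℂ) * γ j z) * h z
      = (∑ j, ∫ z in D, wd (-Complex.I) j (w j) z * q z)
        + ((∑ j, ∫ z in D, γ j z * ((wd (-Complex.I) j (fun z => (η z : ℂ)) z * h z)
          * (Real.exp (m z / 2) : ℂ)))
        + ∑ j, ∫ z in D, γ j z * ((η z * h z)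
          * (wd (-Complex.I) j (fun z => (m z : ℂ)) z * (Real.exp (m z / 2) : ℂ)))) := by
    rw [← integral_finsetSum _ fun j _ => hR j, ← integral_finsetSum _ fun j _ => hB j,
      ← integral_finsetSum _ fun j _ => hC j,
      ← integral_add (integrable_finsetSum _ fun j _ => hB j)
        (integrable_finsetSum _ fun j _ => hC j),
      ← integral_add (integrable_finsetSum _ fun j _ => hR j)
        ((integrable_finsetSum _ fun j _ => hB j).fun_add (integrable_finsetSum _ fun j _ => hC j)),
      ← setIntegral_eq_of_tsupport_subset (D := D) fun z hz => by simp [hη0 hz, hw0 _ hz]]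
    refine setIntegral_congr_fun hD.measurableSet fun z _ => ?_
    simp only [hqdef, add_mul, Finset.sum_mul, Finset.mul_sum, ← Finset.sum_add_distrib]
    exact Finset.sum_congr rfl fun j _ => by ring
  simp only [e1, e2]
  linear_combination main

end CutoffForms

section BasicEstimate

open Filter Topology
open scoped ENNReal

variable {n : ℕ} {D K : Set (Fin n → ℂ)} {x : (Fin n → ℂ) → ℂ}

lemma memLp_mul_of_eq_zero (hD : IsOpen D) (hK : IsCompact K) (hKD : K ⊆ D)
    (hx : MemLp x 2 volume) (hx0 : ∀ z ∉ K, x z = 0) {q : (Fin n → ℂ) → ℂ}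
    (hq : ContinuousOn q D) : MemLp (fun z => q z * x z) 2 volume := by
  obtain ⟨χ, hχ, hχc, hχD, hχ1, -⟩ := exists_contDiff_cutoff hK hD hKD
  refine (memLp_mul_mul_of_tsupport_subset hD (c := fun z => (χ z : ℂ)) (hx.restrict D)
    (contDiff_ofReal_comp hχ).continuous (hasCompactSupport_ofReal hχc)
    (by rwa [tsupport_ofReal]) hq).ae_eq (.of_forall fun z => ?_)
  by_cases hz : z ∈ K
  · simp [(hχ1 z hz).eq_of_nhds]
  · simp [hx0 z hz]

lemma integrable_normSq_mul_of_eq_zero (hD : IsOpen D) (hK : IsCompact K) (hKD : K ⊆ D)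
    (hx : MemLp x 2 volume) (hx0 : ∀ z ∉ K, x z = 0) {r : (Fin n → ℂ) → ℝ}
    (hr : ContinuousOn r D) : Integrable (fun z => normSq (x z) * r z) := by
  have h := integrable_mul_conj (memLp_mul_of_eq_zero hD hK hKD hx hx0
    (continuous_ofReal.comp_continuousOn hr)) hx
  refine h.re.congr (.of_forall fun z => ?_)
  simp [mul_assoc, mul_conj, normSq_apply]
  ring

lemma normSq_sum_mul_le (a g : Fin n → ℂ) :
    normSq (∑ j, a j * g j) ≤ (∑ j, normSq (a j)) * ∑ j, normSq (g j) := by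
  simp only [normSq_eq_norm_sq]
  calc ‖∑ j, a j * g j‖ ^ 2 ≤ (∑ j, ‖a j‖ * ‖g j‖) ^ 2 := by
        gcongr
        exact (norm_sum_le _ _).trans_eq (by simp)
    _ ≤ _ := Finset.sum_mul_sq_le_sq_mul_sq _ _ _

lemma normSq_sub_le (a b : ℂ) : normSq (a - b) ≤ 2 * (normSq a + normSq b) := by
  simp only [normSq_apply, sub_re, sub_im]
  nlinarith [sq_nonneg (a.re + b.re), sq_nonneg (a.im + b.im)]

lemma half_sum_normSq_sub_le (a g : Fin n → ℂ) :
    (1 / 2) * ∑ j, ∑ k, normSq (a j * g k - a k * g j)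
      ≤ 2 * ((∑ j, normSq (a j)) * ∑ j, normSq (g j)) := by
  have h : ∑ j, ∑ k, normSq (a j * g k - a k * g j)
      ≤ ∑ j, ∑ k, 2 * (normSq (a j) * normSq (g k) + normSq (a k) * normSq (g j)) := by
    gcongr with j _ k _
    simpa only [normSq_mul] using normSq_sub_le (a j * g k) (a k * g j)
  simp only [← Finset.mul_sum, Finset.sum_add_distrib, ← Finset.sum_mul] at h
  linarith

lemma normSq_four_le (a b c d : ℂ) :
    normSq (a + b - c - d)
      ≤ 2 * normSq a + 6 * normSq b + 6 * normSq c + 6 * normSq d := by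
  simp only [normSq_apply, sub_re, sub_im, add_re, add_im]
  nlinarith [sq_nonneg (a.re - (b.re - c.re - d.re)), sq_nonneg (a.im - (b.im - c.im - d.im)),
    sq_nonneg (b.re + c.re), sq_nonneg (b.re + d.re), sq_nonneg (c.re - d.re),
    sq_nonneg (b.im + c.im), sq_nonneg (b.im + d.im), sq_nonneg (c.im - d.im)]

lemma normSq_wd_ofReal (f : (Fin n → ℂ) → ℝ) (j : Fin n) (z : Fin n → ℂ) :
    normSq (wd (-Complex.I) j (fun z => (f z : ℂ)) z)
      = normSq (wd Complex.I j (fun z => (f z : ℂ)) z) := by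
  rw [← normSq_conj, conj_wd]
  simp

/-- The a priori estimate for the projected test form `γ`, cut off by `η`. -/
theorem integral_cutoff_le {lam tau psi η : (Fin n → ℂ) → ℝ} {c₁ c₂ : ℝ} (hc₁ : 0 < c₁) (hc₂ : 0 < c₂)
    (hD : IsOpen D) (hlam : ContDiffOn ℝ 2 lam D) (htau : ContDiffOn ℝ 2 tau D)
    (hpsi : ContDiffOn ℝ 2 psi D) (htau0 : ∀ z ∈ D, 0 < tau z) (hpsi0 : ∀ z ∈ D, 0 ≤ psi z)
    (hpsi' : ∀ z ∈ D, ∀ ξ, 0 ≤ hessC n psi z ξ)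
    (hTheta : ∀ z ∈ D, ∀ ξ, c₁ * enormSq n ξ * Real.exp (-lam z) ≤ Theta n lam tau z ξ)
    (hratio : ∀ z ∈ D, c₂ ≤ Real.exp (-lam z) / tau z)
    {γ w : Fin n → (Fin n → ℂ) → ℂ} (hγ : ∀ j, MemLp (γ j) 2 (volume.restrict D))
    (hw : ∀ j, IsTest n D (w j))
    (hγc : ∀ j k φ, IsTest n D φ →
      ∫ z in D, γ j z * ((Real.exp ((lam z + psi z + 3 * psi z ^ 2) / 2) : ℝ) * dbarCoord n φ k z)
        = ∫ z in D, γ k z *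
          ((Real.exp ((lam z + psi z + 3 * psi z ^ 2) / 2) : ℝ) * dbarCoord n φ j z))
    (hγw : ∀ h, ContDiff ℝ 1 h → HasCompactSupport h → tsupport h ⊆ D →
      ∑ j, ∫ z in D, γ j z * ((Real.exp ((lam z + psi z + 3 * psi z ^ 2) / 2) : ℂ)⁻¹
          * (starRingEnd ℂ) (wd Complex.I j h z))
        = ∑ j, ∫ z in D, w j z * (starRingEnd ℂ) (wd Complex.I j h z))
    (hη : ContDiff ℝ (⊤ : ℕ∞) η) (hηc : HasCompactSupport η) (hηD : tsupport η ⊆ D) :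
    c₁ * ∫ z in D, η z ^ 2 * enormSq n (fun j => γ j z) * Real.exp (-lam z - psi z)
      ≤ (6 / c₂) * (∫ z in D, η z ^ 2 * Real.exp (3 * psi z ^ 2)
          * normSq (∑ j, wd (-Complex.I) j (w j) z))
        + 8 * ∫ z in D, tau z * Real.exp (-psi z)
          * (∑ j, normSq (wd Complex.I j (fun z => (η z : ℂ)) z)) * enormSq n (fun j => γ j z) := by
  set m : (Fin n → ℂ) → ℝ := fun z => lam z + psi z + 3 * psi z ^ 2 with hmdef
  have hm : ContDiffOn ℝ 2 m D := (hlam.add hpsi).add (contDiffOn_const.mul (hpsi.pow 2))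
  have hlog : ContDiffOn ℝ 2 (fun z => -Real.log (tau z)) D :=
    (htau.log fun z hz => (htau0 z hz).ne').neg
  set W : (Fin n → ℂ) → ℝ := fun z => (lam z + psi z + 3 * psi z ^ 2)
    + (psi z + -Real.log (tau z)) with hWdef
  have hW : ContDiffOn ℝ 2 W D := hm.add (hpsi.add hlog)
  have hηC := contDiff_ofReal_comp hη
  have hηCc := hasCompactSupport_ofReal hηc
  have hηCD : tsupport (fun z => (η z : ℂ)) ⊆ D := by rwa [tsupport_ofReal]
  have hP : ContinuousOn (fun z => (Real.exp (m z / 2) : ℂ)) D :=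
    continuous_ofReal.comp_continuousOn (hm.continuousOn.div_const 2).rexp
  have hE : ContinuousOn (fun z => (Real.exp (m z) : ℂ)) D :=
    continuous_ofReal.comp_continuousOn hm.continuousOn.rexp
  have hwd {f : (Fin n → ℂ) → ℝ} (hf : ContDiffOn ℝ 2 f D) (j : Fin n) :
      ContinuousOn (wd (-Complex.I) j fun z => (f z : ℂ)) D := fun z hz =>
    ((contDiffAt_wd (m' := 1) _ _ ((contDiffOn_ofReal_comp hf).contDiffAt (hD.mem_nhds hz))
      (by norm_num)).continuousAt).continuousWithinAt
  have hwdwd (j k : Fin n) :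
      ContinuousOn (wd Complex.I k (wd (-Complex.I) j fun z => (W z : ℂ))) D := fun z hz =>
    ((contDiffAt_wd (m' := 0) _ _ (contDiffAt_wd (m' := 1) _ _
      ((contDiffOn_ofReal_comp hW).contDiffAt (hD.mem_nhds hz))
      (by norm_num)) (by norm_num)).continuousAt).continuousWithinAt
  have h1 (s : ℂ) (j : Fin n) : Continuous (wd s j fun z => (η z : ℂ)) :=
    continuous_wd _ _ (hηC.of_le (by norm_cast))
  have h1c (s : ℂ) (j : Fin n) : HasCompactSupport (wd s j fun z => (η z : ℂ)) :=
    hasCompactSupport_wd _ _ hηCc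
  have h1D (s : ℂ) (j : Fin n) : tsupport (wd s j fun z => (η z : ℂ)) ⊆ D :=
    (tsupport_wd_subset _ _ _).trans hηCD
  have hK : IsCompact (tsupport η) := hηc
  have hη0 {z : Fin n → ℂ} (hz : z ∉ tsupport η) : η z = 0 := image_eq_zero_of_notMem_tsupport hz
  have hw0 (s : ℂ) (j : Fin n) {z : Fin n → ℂ} (hz : z ∉ tsupport η) :
      wd s j (fun z => (η z : ℂ)) z = 0 :=
    image_eq_zero_of_notMem_tsupport fun h => hz
      (by have := tsupport_wd_subset _ _ _ h; rwa [tsupport_ofReal] at this)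
  set b : Fin n → (Fin n → ℂ) → ℂ := fun j z => η z * (Real.exp (m z / 2) : ℂ) * γ j z with hb
  set F : Fin n → Fin n → (Fin n → ℂ) → ℂ := fun j k z =>
    wd Complex.I j (fun z => (η z : ℂ)) z * (Real.exp (m z / 2) : ℂ) * γ k z
      - wd Complex.I k (fun z => (η z : ℂ)) z * (Real.exp (m z / 2) : ℂ) * γ j z with hF
  set G : (Fin n → ℂ) → ℂ := fun z =>
    η z * (Real.exp (m z) : ℂ) * (∑ j, wd (-Complex.I) j (w j) z)
          + ∑ j, (wd (-Complex.I) j (fun z => (η z : ℂ)) z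
              + η z * wd (-Complex.I) j (fun z => (m z : ℂ)) z)
            * (Real.exp (m z / 2) : ℂ) * γ j z with hG
  have hdivc : Continuous fun z => ∑ j, wd (-Complex.I) j (w j) z :=
    continuous_finsetSum _ fun j _ => continuous_wd _ _ ((hw j).1.of_le (by norm_cast))
  have hbm (j : Fin n) : MemLp (b j) 2 :=
    memLp_mul_mul_of_tsupport_subset hD (hγ j) hηC.continuous hηCc hηCD hP
  have hFm (j k : Fin n) : MemLp (F j k) 2 :=
    (memLp_mul_mul_of_tsupport_subset hD (hγ k) (h1 _ j) (h1c _ j) (h1D _ j) hP).sub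
      (memLp_mul_mul_of_tsupport_subset hD (hγ j) (h1 _ k) (h1c _ k) (h1D _ k) hP)
  have hGm : MemLp G 2 := by
    refine ((memLp_mul_of_tsupport_subset hD hηC.continuous hηCc hηCD
      (hE.mul hdivc.continuousOn) volume).add (memLp_finsetSum Finset.univ fun j _ =>
      (memLp_mul_mul_of_tsupport_subset hD (hγ j) (h1 (-Complex.I) j) (h1c _ j) (h1D _ j) hP).add
      (memLp_mul_mul_of_tsupport_subset hD (hγ j) hηC.continuous hηCc hηCD
        ((hwd hm j).mul hP)))).ae_eq (.of_forall fun z => ?_)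
    simp only [hG, Pi.add_apply, Pi.mul_apply]
    congr 1
    · ring
    · exact Finset.sum_congr rfl fun j _ => by ring
  have hb0 (j : Fin n) (z) (hz : z ∉ tsupport η) : b j z = 0 := by simp [hb, hη0 hz]
  have hF0 (j k : Fin n) (z) (hz : z ∉ tsupport η) : F j k z = 0 := by simp [hF, hw0 _ _ hz]
  have hG0 (z) (hz : z ∉ tsupport η) : G z = 0 := by simp [hG, hw0 _ _ hz, hη0 hz]
  have main := integral_hessC_le_of_memLp_of_contDiffOn hD hW hK hηD hbm hFm hGm hb0 hF0 hG0
    (fun j k h hh _ => integral_cutoff_dbar hD hP (hγ j) (hγ k)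
      (fun φ hφ => (hγc j k φ hφ).symm) hη hηc hηD hh)
    (fun h hh _ => integral_cutoff_adjoint hD hm hγ hw hγw hη hηc hηD hh)
  have hWc : ContinuousOn (fun z => Real.exp (-W z)) D := hW.continuousOn.neg.rexp
  have hWcC : ContinuousOn (fun z => (Real.exp (-W z) : ℂ)) D :=
    continuous_ofReal.comp_continuousOn hWc
  have hδm : MemLp (fun z => (∑ j, wd (-Complex.I) j (fun z => (W z : ℂ)) z * b j z) - G z) 2 :=
    (memLp_finsetSum Finset.univ fun j _ =>
      memLp_mul_of_eq_zero hD hK hηD (hbm j) (hb0 j) (hwd hW j)).sub hGm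
  have hI1 : Integrable fun z => hessC n W z (fun j => b j z) * Real.exp (-W z) := by
    have h := integrable_finsetSum Finset.univ fun j _ => integrable_finsetSum Finset.univ
      fun k _ => integrable_mul_conj (memLp_mul_of_eq_zero hD hK hηD (hbm j) (hb0 j)
        ((hwdwd j k).mul hWcC)) (hbm k)
    refine h.re.congr (.of_forall fun z => ?_)
    beta_reduce
    by_cases hz : z ∈ D
    · rw [hessC_eq_sum (hW.contDiffAt (hD.mem_nhds hz)), ← re_mul_ofReal, Finset.sum_mul]
      refine congrArg Complex.re (Finset.sum_congr rfl fun j _ => ?_)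
      rw [Finset.sum_mul]
      exact Finset.sum_congr rfl fun k _ => by simp only [Pi.mul_apply]; ring
    · have h0 : (fun j => b j z) = 0 := funext fun j => hb0 j z fun h => hz (hηD h)
      have h0' (j : Fin n) : b j z = 0 := congrFun h0 j
      rw [h0, hessC_zero]
      simp [h0']
  have hI3 := integrable_normSq_mul_of_eq_zero hD hK hηD hδm
    (fun z hz => by simp [hb0 _ z hz, hG0 z hz]) hWc
  have hIF (j k : Fin n) := integrable_normSq_mul_of_eq_zero hD hK hηD (hFm j k) (hF0 j k) hWc
  set S : (Fin n → ℂ) → ℝ := fun z => ∑ j, normSq (wd Complex.I j (fun z => (η z : ℂ)) z) with hS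
  have hexpm (z : Fin n → ℂ) : Real.exp (m z / 2) * Real.exp (m z / 2) = Real.exp (m z) := by
    rw [← Real.exp_add]; ring_nf
  have hexpW {z : Fin n → ℂ} (hz : z ∈ D) :
      Real.exp (m z) * Real.exp (-W z) = tau z * Real.exp (-psi z) := by
    rw [← Real.exp_add]
    conv_rhs => rw [← Real.exp_log (htau0 z hz), ← Real.exp_add]
    simp only [hWdef, hmdef]
    ring_nf
  have hY1 : Integrable (fun z => η z ^ 2 * Real.exp (3 * psi z ^ 2)
      * normSq (∑ j, wd (-Complex.I) j (w j) z)) (volume.restrict D) := by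
    have := integrable_normSq_mul_of_eq_zero hD hK hηD (memLp_mul_of_tsupport_subset hD
      hηC.continuous hηCc hηCD hdivc.continuousOn volume) (fun z hz => by simp [hη0 hz])
      (continuousOn_const.mul (hpsi.continuousOn.pow 2) : ContinuousOn (fun z => 3 * psi z ^ 2) D).rexp
    refine this.restrict.congr (.of_forall fun z => ?_)
    simp only [normSq_mul, normSq_ofReal, Pi.mul_apply]
    ring
  have hY2 : Integrable (fun z => tau z * Real.exp (-psi z) * S z * enormSq n (fun j => γ j z))
      (volume.restrict D) := by
    have h := integrable_finsetSum Finset.univ fun j _ => integrable_finsetSum Finset.univ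
      fun k _ => integrable_normSq_mul_of_eq_zero hD hK hηD
        (memLp_mul_mul_of_tsupport_subset hD (hγ k) (h1 Complex.I j) (h1c _ j) (h1D _ j) hP)
        (fun z hz => by simp [hw0 _ _ hz]) hWc
    refine Integrable.congr h.restrict ?_
    filter_upwards [ae_restrict_mem hD.measurableSet] with z hz
    simp only [hS, enormSq, ← hexpW hz, ← hexpm, Finset.mul_sum, Finset.sum_mul, normSq_mul,
      normSq_ofReal]
    rw [Finset.sum_comm]
    exact Finset.sum_congr rfl fun j _ => Finset.sum_congr rfl fun k _ => by ring
  have hpt2 {z : Fin n → ℂ} (hz : z ∈ D) :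
      (1 / 2) * ∑ j, ∑ k, normSq (F j k z) * Real.exp (-W z)
        ≤ 2 * (tau z * Real.exp (-psi z) * S z * enormSq n (fun j => γ j z)) := by
    have h := half_sum_normSq_sub_le (fun j => wd Complex.I j (fun z => (η z : ℂ)) z)
      (fun j => γ j z)
    have h2 (j k : Fin n) : normSq (F j k z) = Real.exp (m z) *
        normSq (wd Complex.I j (fun z => (η z : ℂ)) z * γ k z
          - wd Complex.I k (fun z => (η z : ℂ)) z * γ j z) := by
      rw [← hexpm, ← normSq_ofReal, ← normSq_mul]
      congr 1
      simp only [hF]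
      ring
    have h3 : ∑ j, ∑ k, normSq (F j k z) * Real.exp (-W z) = (tau z * Real.exp (-psi z)) *
        ∑ j, ∑ k, normSq (wd Complex.I j (fun z => (η z : ℂ)) z * γ k z
          - wd Complex.I k (fun z => (η z : ℂ)) z * γ j z) := by
      simp only [h2, ← hexpW hz, Finset.mul_sum]
      exact Finset.sum_congr rfl fun j _ => Finset.sum_congr rfl fun k _ => by ring
    have h4 := mul_le_mul_of_nonneg_left h (mul_pos (htau0 z hz) (Real.exp_pos (-psi z))).le
    rw [h3]
    simp only [enormSq, hS]
    linarith
  have hpt {z : Fin n → ℂ} (hz : z ∈ D) :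
      c₁ * (η z ^ 2 * enormSq n (fun j => γ j z) * Real.exp (-lam z - psi z))
        ≤ hessC n W z (fun j => b j z) * Real.exp (-W z)
          - normSq ((∑ j, wd (-Complex.I) j (fun z => (W z : ℂ)) z * b j z) - G z)
            * Real.exp (-W z)
          + ((6 / c₂) * (η z ^ 2 * Real.exp (3 * psi z ^ 2)
            * normSq (∑ j, wd (-Complex.I) j (w j) z))
          + 6 * (tau z * Real.exp (-psi z) * S z * enormSq n (fun j => γ j z))) := by
    have hDz := hD.mem_nhds hz
    have hlamz := hlam.contDiffAt hDz
    have htauz := htau.contDiffAt hDz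
    have hpsiz := hpsi.contDiffAt hDz
    have hmz := (hm.contDiffAt hDz).differentiableAt (by norm_num)
    have hpd := hpsiz.differentiableAt (by norm_num)
    have hld := (hlog.contDiffAt hDz).differentiableAt (by norm_num)
    have hH := le_hessC_weight hlamz htauz hpsiz (htau0 z hz) (hpsi0 z hz)
      (hpsi' z hz fun j => b j z) (hTheta z hz fun j => b j z)
    have hen : enormSq n (fun j => b j z) = η z ^ 2 * Real.exp (m z) * enormSq n fun j => γ j z := by
      simp only [enormSq, hb, normSq_mul, normSq_ofReal, Finset.mul_sum, ← hexpm]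
      exact Finset.sum_congr rfl fun j _ => by ring
    have hδ : (∑ j, wd (-Complex.I) j (fun z => (W z : ℂ)) z * b j z) - G z
        = delPair n (fun z => -Real.log (tau z)) z (fun j => b j z)
          + delPair n psi z (fun j => b j z)
          - η z * (Real.exp (m z) : ℂ) * (∑ j, wd (-Complex.I) j (w j) z)
          - (Real.exp (m z / 2) : ℂ)
            * ∑ j, wd (-Complex.I) j (fun z => (η z : ℂ)) z * γ j z := by
      have e1 := delPair_eq_sum ((hW.contDiffAt hDz).differentiableAt (by norm_num)) fun j => b j z
      have e2 : delPair n W z (fun j => b j z) = delPair n m z (fun j => b j z)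
          + (delPair n psi z (fun j => b j z)
            + delPair n (fun z => -Real.log (tau z)) z fun j => b j z) := by
        rw [← delPair_add hpd hld, ← delPair_add hmz (hpd.fun_add hld)]
      rw [← e1, e2, delPair_eq_sum hmz]
      simp only [hG, hb, add_mul, Finset.sum_add_distrib, Finset.mul_sum]
      have e3 : ∑ j, wd (-Complex.I) j (fun z => (m z : ℂ)) z
            * (η z * (Real.exp (m z / 2) : ℂ) * γ j z)
          = ∑ j, η z * wd (-Complex.I) j (fun z => (m z : ℂ)) z
            * (Real.exp (m z / 2) : ℂ) * γ j z := Finset.sum_congr rfl fun j _ => by ring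
      have e4 : ∑ j, (Real.exp (m z / 2) : ℂ)
            * (wd (-Complex.I) j (fun z => (η z : ℂ)) z * γ j z)
          = ∑ j, wd (-Complex.I) j (fun z => (η z : ℂ)) z
            * (Real.exp (m z / 2) : ℂ) * γ j z := Finset.sum_congr rfl fun j _ => by ring
      rw [e3, e4]
      ring
    have h4 := normSq_four_le (delPair n (fun z => -Real.log (tau z)) z (fun j => b j z))
      (delPair n psi z (fun j => b j z))
      (η z * (Real.exp (m z) : ℂ) * (∑ j, wd (-Complex.I) j (w j) z))
      ((Real.exp (m z / 2) : ℂ) * ∑ j, wd (-Complex.I) j (fun z => (η z : ℂ)) z * γ j z)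
    rw [← hδ] at h4
    have hB : normSq ((Real.exp (m z / 2) : ℂ)
        * ∑ j, wd (-Complex.I) j (fun z => (η z : ℂ)) z * γ j z)
        ≤ Real.exp (m z) * (S z * enormSq n fun j => γ j z) := by
      have := normSq_sum_mul_le (fun j => wd (-Complex.I) j (fun z => (η z : ℂ)) z)
        (fun j => γ j z)
      simp only [normSq_wd_ofReal] at this
      rw [normSq_mul, normSq_ofReal, hexpm]
      gcongr
      exact this
    have hA : normSq (η z * (Real.exp (m z) : ℂ) * (∑ j, wd (-Complex.I) j (w j) z))
          * Real.exp (-W z)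
        ≤ c₂⁻¹ * (η z ^ 2 * Real.exp (3 * psi z ^ 2)
          * normSq (∑ j, wd (-Complex.I) j (w j) z)) := by
      have hr : tau z * Real.exp (lam z) ≤ c₂⁻¹ := by
        have := hratio z hz
        rw [le_div_iff₀ (htau0 z hz), Real.exp_neg] at this
        rw [le_inv_comm₀ (by have := htau0 z hz; positivity) hc₂, mul_inv, mul_comm]
        rwa [← le_div_iff₀ (htau0 z hz), div_eq_mul_inv] at this
      have hm' : tau z * Real.exp (-psi z) * Real.exp (m z)
          = tau z * Real.exp (lam z) * Real.exp (3 * psi z ^ 2) := by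
        rw [mul_assoc, mul_assoc, ← Real.exp_add, ← Real.exp_add]
        simp only [hmdef]
        ring_nf
      calc _ = η z ^ 2 * normSq (∑ j, wd (-Complex.I) j (w j) z)
            * (Real.exp (m z) * Real.exp (-W z) * Real.exp (m z)) := by
              simp only [normSq_mul, normSq_ofReal]; ring
        _ = η z ^ 2 * normSq (∑ j, wd (-Complex.I) j (w j) z) * Real.exp (3 * psi z ^ 2)
            * (tau z * Real.exp (lam z)) := by rw [hexpW hz, hm']; ring
        _ ≤ η z ^ 2 * normSq (∑ j, wd (-Complex.I) j (w j) z) * Real.exp (3 * psi z ^ 2)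
            * c₂⁻¹ := mul_le_mul_of_nonneg_left hr
              (mul_nonneg (mul_nonneg (sq_nonneg _) (normSq_nonneg _)) (Real.exp_pos _).le)
        _ = _ := by ring
    have hX : c₁ * (η z ^ 2 * enormSq n (fun j => γ j z) * Real.exp (-lam z - psi z))
        = c₁ * enormSq n (fun j => b j z) * (Real.exp (-lam z) / tau z) * Real.exp (-W z) := by
      have ht := (htau0 z hz).ne'
      rw [hen, sub_eq_add_neg, Real.exp_add]
      calc _ = c₁ * (η z ^ 2 * enormSq n fun j => γ j z) * (Real.exp (-lam z) / tau z)
            * (tau z * Real.exp (-psi z)) := by field_simp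
        _ = _ := by rw [← hexpW hz]; ring
    have hB' := mul_le_mul_of_nonneg_right hB (Real.exp_pos (-W z)).le
    have hH' := mul_le_mul_of_nonneg_right hH (Real.exp_pos (-W z)).le
    have h4' := mul_le_mul_of_nonneg_right h4 (Real.exp_pos (-W z)).le
    have hBe : Real.exp (m z) * (S z * enormSq n fun j => γ j z) * Real.exp (-W z)
        = tau z * Real.exp (-psi z) * S z * enormSq n fun j => γ j z := by
      rw [← hexpW hz]; ring
    rw [hBe] at hB'
    rw [hX]
    simp only [add_mul] at hH' h4'
    have : 6 / c₂ = 6 * c₂⁻¹ := div_eq_mul_inv _ _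
    rw [this]
    linarith
  have hIs := (hI1.sub hI3).restrict (s := D)
  simp only [Pi.sub_def] at hIs
  have hIle := integral_mono_of_nonneg (μ := volume.restrict D)
    (f := fun z => c₁ * (η z ^ 2 * enormSq n (fun j => γ j z) * Real.exp (-lam z - psi z)))
    (.of_forall fun z => mul_nonneg hc₁.le (mul_nonneg
      (mul_nonneg (sq_nonneg _) (enormSq_nonneg _)) (Real.exp_pos _).le))
    (hIs.fun_add ((hY1.const_mul (6 / c₂)).fun_add (hY2.const_mul 6)))
    ((ae_restrict_iff' hD.measurableSet).2 (.of_forall fun z hz => hpt hz))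
  beta_reduce at hIle
  rw [integral_add hIs ((hY1.const_mul _).fun_add (hY2.const_mul 6)),
    integral_sub hI1.restrict hI3.restrict, integral_add (hY1.const_mul _) (hY2.const_mul 6),
    integral_const_mul, integral_const_mul, integral_const_mul] at hIle
  have hIF2 : (1 / 2) * ∑ j, ∑ k, ∫ z, normSq (F j k z) * Real.exp (-W z)
      ≤ 2 * ∫ z in D, tau z * Real.exp (-psi z) * S z * enormSq n (fun j => γ j z) := by
    have e (j k : Fin n) : ∫ z, normSq (F j k z) * Real.exp (-W z)
        = ∫ z in D, normSq (F j k z) * Real.exp (-W z) :=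
      (setIntegral_eq_integral_of_forall_compl_eq_zero fun z hz => by
        simp [hF0 j k z fun h => hz (hηD h)]).symm
    simp only [e]
    rw [← integral_const_mul]
    have e2 : ∑ j, ∑ k, ∫ z in D, normSq (F j k z) * Real.exp (-W z)
        = ∫ z in D, ∑ j, ∑ k, normSq (F j k z) * Real.exp (-W z) := by
      rw [integral_finsetSum _ fun j _ => integrable_finsetSum _ fun k _ => (hIF j k).restrict]
      exact Finset.sum_congr rfl fun j _ =>
        (integral_finsetSum _ fun k _ => (hIF j k).restrict).symm
    rw [e2, ← integral_const_mul]
    refine setIntegral_mono_on ?_ (hY2.const_mul 2) hD.measurableSet fun z hz => hpt2 hz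
    exact (integrable_finsetSum _ fun j _ => integrable_finsetSum _ fun k _ =>
      (hIF j k).restrict).const_mul _
  have hf1 : ∫ z in D, hessC n W z (fun j => b j z) * Real.exp (-W z)
      = ∫ z, hessC n W z (fun j => b j z) * Real.exp (-W z) :=
    setIntegral_eq_integral_of_forall_compl_eq_zero fun z hz => by
      have h0 : (fun j => b j z) = 0 := funext fun j => hb0 j z fun h => hz (hηD h)
      rw [h0, hessC_zero, zero_mul]
  have hf3 : ∫ z in D, normSq ((∑ j, wd (-Complex.I) j (fun z => (W z : ℂ)) z * b j z) - G z)
        * Real.exp (-W z)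
      = ∫ z, normSq ((∑ j, wd (-Complex.I) j (fun z => (W z : ℂ)) z * b j z) - G z)
        * Real.exp (-W z) :=
    setIntegral_eq_integral_of_forall_compl_eq_zero fun z hz => by
      simp [hb0 _ z fun h => hz (hηD h), hG0 z fun h => hz (hηD h)]
  rw [hf1, hf3] at hIle
  linarith

end BasicEstimate

section Exhaustion

open Filter Topology

variable {n : ℕ} {Ω D : Set (Fin n → ℂ)}

lemma ExhaustsOn.isCompact_sublevel {Φ : (Fin n → ℂ) → ℝ} (h : ExhaustsOn n Ω Φ)
    (hΦ : ContinuousOn Φ Ω) (c : ℝ) : IsCompact {z ∈ Ω | Φ z ≤ c} := by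
  obtain ⟨h1, h2⟩ := h (c + 1)
  have : {z ∈ Ω | Φ z ≤ c} = closure {z ∈ Ω | Φ z < c + 1} ∩ Φ ⁻¹' Iic c := by
    ext z
    refine ⟨fun hz => ⟨subset_closure ⟨hz.1, hz.2.trans_lt (lt_add_one c)⟩, hz.2⟩,
      fun hz => ⟨h2 hz.1, hz.2⟩⟩
  rw [this]
  exact h1.of_isClosed_subset
    ((hΦ.mono h2).preimage_isClosed_of_isClosed h1.isClosed isClosed_Iic) inter_subset_left

lemma exists_smooth_step : ∃ (θ : ℝ → ℝ) (C : ℝ), ContDiff ℝ (⊤ : ℕ∞) θ ∧ (∀ s ≤ 1, θ s = 0) ∧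
    (∀ s, 2 ≤ s → θ s = 1) ∧ (∀ s, θ s ∈ Icc (0 : ℝ) 1) ∧ ∀ s, |s * deriv θ s| ≤ C := by
  let θ : ℝ → ℝ := fun s => Real.smoothTransition (s - 1)
  have hθ : ContDiff ℝ (⊤ : ℕ∞) θ :=
    Real.smoothTransition.contDiff.comp (contDiff_id.sub contDiff_const)
  have h0 (s : ℝ) (hs : s ≤ 1) : θ s = 0 := Real.smoothTransition.zero_of_nonpos (by linarith)
  have h1 (s : ℝ) (hs : 2 ≤ s) : θ s = 1 := Real.smoothTransition.one_of_one_le (by linarith)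
  have hcont : Continuous fun s => s * deriv θ s :=
    continuous_id.mul (hθ.continuous_deriv (by simp))
  have hsupp : HasCompactSupport fun s => s * deriv θ s := by
    refine HasCompactSupport.intro (isCompact_Icc (a := (1 : ℝ)) (b := 2)) fun s hs => ?_
    have : deriv θ s = 0 := by
      rcases lt_or_ge s 1 with h | h
      · have : θ =ᶠ[𝓝 s] fun _ => 0 := by
          filter_upwards [gt_mem_nhds h] with t ht using h0 t ht.le
        rw [this.deriv_eq, deriv_const]
      · have h' : 2 < s := by
          by_contra h'
          exact hs ⟨h, not_lt.1 h'⟩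
        have : θ =ᶠ[𝓝 s] fun _ => 1 := by
          filter_upwards [lt_mem_nhds h'] with t ht using h1 t ht.le
        rw [this.deriv_eq, deriv_const]
    rw [this, mul_zero]
  obtain ⟨C, hC⟩ := hcont.bounded_above_of_compact_support hsupp
  exact ⟨θ, C, hθ, h0, h1, fun s => ⟨Real.smoothTransition.nonneg _,
    Real.smoothTransition.le_one _⟩, hC⟩

/-- Cutoff functions exhausting a domain `D = {ρ > 0}`, with gradients controlled by `1 / ρ`. -/
lemma exists_cutoff_seq (hD : IsOpen D) {ρ : (Fin n → ℂ) → ℝ} (hρ : ContDiffOn ℝ (⊤ : ℕ∞) ρ D)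
    (hρ0 : ∀ z ∈ D, 0 < ρ z) (hρc : ∀ ε > 0, IsCompact {z ∈ D | ε ≤ ρ z}) :
    ∃ (η : ℕ → (Fin n → ℂ) → ℝ) (C : ℝ), (∀ ν, ContDiff ℝ (⊤ : ℕ∞) (η ν)) ∧
      (∀ ν, HasCompactSupport (η ν)) ∧ (∀ ν, tsupport (η ν) ⊆ D) ∧
      (∀ ν z, η ν z ∈ Icc (0 : ℝ) 1) ∧ (∀ z ∈ D, ∀ᶠ ν in atTop, η ν =ᶠ[𝓝 z] 1) ∧
      ∀ ν, ∀ z ∈ D, ρ z ^ 2 * ∑ j, normSq (wd Complex.I j (fun z => (η ν z : ℂ)) z)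
        ≤ C * ∑ j, normSq (wd Complex.I j (fun z => (ρ z : ℂ)) z) := by
  classical
  obtain ⟨θ, C, hθ, hθ0, hθ1, hθI, hC⟩ := exists_smooth_step
  let η : ℕ → (Fin n → ℂ) → ℝ := fun ν => D.indicator fun z => θ ((ν + 1) * ρ z)
  let K : ℕ → Set (Fin n → ℂ) := fun ν => {z ∈ D | ((ν : ℝ) + 1)⁻¹ ≤ ρ z}
  have hK (ν : ℕ) : IsCompact (K ν) := hρc _ (by positivity)
  have hηK (ν : ℕ) (z) (hz : z ∉ K ν) : η ν z = 0 := by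
    by_cases hzD : z ∈ D
    · have h : ρ z < ((ν : ℝ) + 1)⁻¹ := by
        by_contra h
        exact hz ⟨hzD, not_lt.1 h⟩
      have h2 : ((ν : ℝ) + 1) * ρ z ≤ 1 := by
        have := mul_le_mul_of_nonneg_left h.le (by positivity : (0 : ℝ) ≤ ν + 1)
        rwa [mul_inv_cancel₀ (by positivity)] at this
      simp only [η, indicator_of_mem hzD, hθ0 _ h2]
    · simp only [η, indicator_of_notMem hzD]
  have hts (ν : ℕ) : tsupport (η ν) ⊆ K ν := closure_minimal (fun z hz => by
    by_contra h
    exact hz (hηK ν z h)) (hK ν).isClosed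
  have hηD (ν : ℕ) {z} (hz : z ∈ D) : η ν =ᶠ[𝓝 z] fun z => θ ((ν + 1) * ρ z) := by
    filter_upwards [hD.mem_nhds hz] with y hy
    simp only [η, indicator_of_mem hy]
  refine ⟨η, C ^ 2, fun ν => ?_, fun ν => HasCompactSupport.intro (hK ν) (hηK ν),
    fun ν => (hts ν).trans fun z hz => hz.1, fun ν z => ?_, fun z hz => ?_, fun ν z hz => ?_⟩
  · refine contDiff_iff_contDiffAt.2 fun z => ?_
    by_cases hz : z ∈ D
    · exact (hθ.contDiffAt.comp z (contDiffAt_const.mul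
        (hρ.contDiffAt (hD.mem_nhds hz)))).congr_of_eventuallyEq (hηD ν hz)
    · refine contDiffAt_const.congr_of_eventuallyEq
        (notMem_tsupport_iff_eventuallyEq.1 fun h => hz (hts ν h).1)
  · by_cases hz : z ∈ D
    · simp only [η, indicator_of_mem hz]
      exact hθI _
    · simp [η, indicator_of_notMem hz]
  · have h0 := hρ0 z hz
    obtain ⟨N, hN⟩ := exists_nat_gt (2 / ρ z)
    filter_upwards [eventually_ge_atTop N] with ν hν
    have h2 : 2 < ((ν : ℝ) + 1) * ρ z := by
      rw [← div_lt_iff₀ h0]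
      have : (N : ℝ) ≤ ν := by exact_mod_cast hν
      linarith
    have hcont : ContinuousAt (fun z => ((ν : ℝ) + 1) * ρ z) z :=
      continuousAt_const.mul (hρ.contDiffAt (hD.mem_nhds hz)).continuousAt
    filter_upwards [hηD ν hz, hcont.eventually (lt_mem_nhds h2)] with y hy hy2
    rw [hy, hθ1 _ hy2.le]
    rfl
  · have hd := (hρ.contDiffAt (hD.mem_nhds hz)).differentiableAt (by simp)
    set a : ℝ := ((ν : ℝ) + 1) * ρ z with ha
    have h1 : HasFDerivAt (fun z => θ ((ν + 1) * ρ z))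
        (deriv θ a • (((ν : ℝ) + 1) • fderiv ℝ ρ z)) z :=
      (hθ.differentiable (by simp) a).hasDerivAt.comp_hasFDerivAt z
        (hd.hasFDerivAt.const_mul _)
    have h2 (j : Fin n) : wd Complex.I j (fun z => (η ν z : ℂ)) z
        = ((deriv θ a * (ν + 1) : ℝ) : ℂ) * wd Complex.I j (fun z => (ρ z : ℂ)) z := by
      have h3 : (fun z => (η ν z : ℂ)) =ᶠ[𝓝 z] fun z => ((θ ((ν + 1) * ρ z) : ℝ) : ℂ) :=
        (hηD ν hz).fun_comp ((↑) : ℝ → ℂ)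
      rw [wd_congr h3]
      simp only [wd, fderiv_ofReal_comp h1.differentiableAt, fderiv_ofReal_comp hd, h1.fderiv]
      simp
      ring
    simp only [h2, normSq_mul, ← Finset.mul_sum, normSq_ofReal]
    rw [← mul_assoc]
    refine mul_le_mul_of_nonneg_right ?_ (Finset.sum_nonneg fun _ _ => normSq_nonneg _)
    calc ρ z ^ 2 * (deriv θ a * (ν + 1) * (deriv θ a * (ν + 1))) = |a * deriv θ a| ^ 2 := by
          rw [sq_abs, ha]; ring
      _ ≤ C ^ 2 := pow_le_pow_left₀ (abs_nonneg _) (hC a) 2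

end Exhaustion

section ClosedForms

open Filter Topology

variable {n : ℕ} {D : Set (Fin n → ℂ)}

lemma integrable_normSq {μ : Measure (Fin n → ℂ)} {f : (Fin n → ℂ) → ℂ} (hf : MemLp f 2 μ) :
    Integrable (fun z => normSq (f z)) μ := by
  simpa only [normSq_eq_norm_sq] using hf.norm.integrable_sq

lemma norm_integral_mul_le {μ : Measure (Fin n → ℂ)} {f g : (Fin n → ℂ) → ℂ} (hf : MemLp f 2 μ)
    (hg : MemLp g 2 μ) : ‖∫ z, f z * g z ∂μ‖ ≤ √(∫ z, normSq (f z) ∂μ) * √(∫ z, normSq (g z) ∂μ) := by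
  calc ‖∫ z, f z * g z ∂μ‖ ≤ ∫ z, ‖f z‖ * ‖g z‖ ∂μ :=
        (norm_integral_le_integral_norm _).trans_eq (by simp)
    _ ≤ (∫ z, ‖f z‖ ^ (2 : ℝ) ∂μ) ^ (1 / (2 : ℝ)) * (∫ z, ‖g z‖ ^ (2 : ℝ) ∂μ) ^ (1 / (2 : ℝ)) :=
        integral_mul_norm_le_Lp_mul_Lq (by constructor <;> norm_num)
          (by simpa using hf) (by simpa using hg)
    _ = _ := by simp [normSq_eq_norm_sq, Real.sqrt_eq_rpow]

lemma normSq_sum_integral_mul_le {μ : Measure (Fin n → ℂ)} {f g : Fin n → (Fin n → ℂ) → ℂ}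
    (hf : ∀ j, MemLp (f j) 2 μ) (hg : ∀ j, MemLp (g j) 2 μ) :
    normSq (∑ j, ∫ z, f j z * g j z ∂μ)
      ≤ (∑ j, ∫ z, normSq (f j z) ∂μ) * ∑ j, ∫ z, normSq (g j z) ∂μ := by
  rw [normSq_eq_norm_sq]
  calc ‖∑ j, ∫ z, f j z * g j z ∂μ‖ ^ 2
      ≤ (∑ j, √(∫ z, normSq (f j z) ∂μ) * √(∫ z, normSq (g j z) ∂μ)) ^ 2 := by
        gcongr
        exact (norm_sum_le _ _).trans (Finset.sum_le_sum fun j _ =>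
          norm_integral_mul_le (hf j) (hg j))
    _ ≤ _ := (Finset.sum_mul_sq_le_sq_mul_sq _ _ _).trans_eq (by
        congr 1 <;> refine Finset.sum_congr rfl fun j _ => Real.sq_sqrt
          (integral_nonneg fun z => normSq_nonneg _))

/-- The basic estimate on a sublevel set `D = {ρ > 0}`. -/
theorem normSq_pairing_le_of_cutoff (hD : IsOpen D) {lam tau ρ : (Fin n → ℂ) → ℝ} {c₁ c₂ M : ℝ}
    (hc₁ : 0 < c₁) (hc₂ : 0 < c₂) (hlam : ContDiffOn ℝ 2 lam D) (htau : ContDiffOn ℝ 2 tau D)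
    (htau0 : ∀ z ∈ D, 0 < tau z)
    (hTheta : ∀ z ∈ D, ∀ ξ, c₁ * enormSq n ξ * Real.exp (-lam z) ≤ Theta n lam tau z ξ)
    (hratio : ∀ z ∈ D, c₂ ≤ Real.exp (-lam z) / tau z)
    (hρ : ContDiffOn ℝ (⊤ : ℕ∞) ρ D) (hρ0 : ∀ z ∈ D, 0 < ρ z) (hρ1 : ∀ z ∈ D, ρ z ≤ 1)
    (hρc : ∀ ε > 0, IsCompact {z ∈ D | ε ≤ ρ z})
    (hρ' : ∀ z ∈ D, ∀ ξ, 0 ≤ hessC n (fun z => -2 * Real.log (ρ z)) z ξ)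
    (hlamM : ∀ z ∈ D, Real.exp (-lam z) ≤ M) (htauM : ∀ z ∈ D, tau z ≤ M)
    (hρM : ∀ z ∈ D, ∑ j, normSq (wd Complex.I j (fun z => (ρ z : ℂ)) z) ≤ M)
    {α w : Fin n → (Fin n → ℂ) → ℂ} (hα : ∀ j, MemLp (α j) 2 (volume.restrict D))
    (hαc : DbarClosed n D α) (hw : ∀ j, IsTest n D (w j))
    (hwρ : ∀ j, ∀ z ∈ tsupport (w j), 3 / 4 ≤ ρ z) :
    normSq (∑ j, ∫ z in D, α j z * (starRingEnd ℂ) (w j z))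
      ≤ (∑ j, ∫ z in D, normSq (α j z)) * (c₁⁻¹ * ((6 / c₂) * (Real.exp 3
        * ∫ z in D, normSq (∑ j, wd (-Complex.I) j (w j) z)))) := by
  set psi : (Fin n → ℂ) → ℝ := fun z => -2 * Real.log (ρ z) with hpsidef
  have hpsi : ContDiffOn ℝ 2 psi D :=
    contDiffOn_const.mul ((hρ.of_le (by norm_cast)).log fun z hz => (hρ0 z hz).ne')
  have hpsi0 (z) (hz : z ∈ D) : 0 ≤ psi z := by
    have := Real.log_nonpos (hρ0 z hz).le (hρ1 z hz)
    simp only [psi]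
    linarith
  have hpsie (z) (hz : z ∈ D) : Real.exp (-psi z) = ρ z ^ 2 := by
    have : -psi z = Real.log (ρ z ^ 2) := by
      rw [Real.log_pow]; simp [psi]
    rw [this, Real.exp_log (pow_pos (hρ0 z hz) 2)]
  set p : (Fin n → ℂ) → ℝ := fun z => Real.exp ((lam z + psi z + 3 * psi z ^ 2) / 2) with hpdef
  have hp : ContinuousOn p D :=
    (((hlam.continuousOn.add hpsi.continuousOn).add
      (continuousOn_const.mul (hpsi.continuousOn.pow 2))).div_const 2).rexp
  have hp0 (z) : 0 < p z := Real.exp_pos _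
  have hpinv (z) (hz : z ∈ D) : (p z)⁻¹ ^ 2 ≤ Real.exp (-lam z - psi z) := by
    rw [← Real.exp_neg, ← Real.exp_nat_mul]
    refine Real.exp_le_exp.2 ?_
    push_cast
    nlinarith [sq_nonneg (psi z)]
  have hexpM (z) (hz : z ∈ D) : Real.exp (-lam z - psi z) ≤ M :=
    (Real.exp_le_exp.2 (by linarith [hpsi0 z hz])).trans (hlamM z hz)
  have hpM (z) (hz : z ∈ D) : (p z)⁻¹ ≤ √M :=
    Real.le_sqrt_of_sq_le ((hpinv z hz).trans (hexpM z hz))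
  have hpI : AEStronglyMeasurable (fun z => (p z : ℂ)⁻¹) (volume.restrict D) :=
    ((continuous_ofReal.comp_continuousOn hp).inv₀ fun z _ => by
      simpa using (hp0 z).ne').aestronglyMeasurable hD.measurableSet
  obtain ⟨γ, hγ, hγc, hγw, hγα⟩ := exists_dbarClosed_projection hD hp (fun z _ => hp0 z) hw
  obtain ⟨η, C, hη, hηc, hηD, hη01, hη1, hηC⟩ := exists_cutoff_seq hD hρ hρ0 hρc
  have hpMem {f : (Fin n → ℂ) → ℂ} (hf : MemLp f 2 (volume.restrict D)) :
      MemLp (fun z => f z * (p z : ℂ)⁻¹) 2 (volume.restrict D) := by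
    refine hf.of_le_mul (c := √M) (hf.1.mul hpI) ?_
    filter_upwards [ae_restrict_mem hD.measurableSet] with z hz
    rw [norm_mul, mul_comm, norm_inv, norm_real, Real.norm_of_nonneg (hp0 z).le]
    exact mul_le_mul_of_nonneg_right (hpM z hz) (norm_nonneg _)
  have hηMem (ν : ℕ) {f : (Fin n → ℂ) → ℂ} (hf : MemLp f 2 (volume.restrict D)) :
      MemLp (fun z => η ν z * f z) 2 (volume.restrict D) := by
    refine hf.of_le ((contDiff_ofReal_comp (hη ν)).continuous.aestronglyMeasurable.mul hf.1)
      (.of_forall fun z => ?_)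
    rw [norm_mul, norm_real, Real.norm_of_nonneg (hη01 ν z).1]
    exact mul_le_of_le_one_left (norm_nonneg _) (hη01 ν z).2
  have hγn : Integrable (fun z => enormSq n fun j => γ j z) (volume.restrict D) :=
    integrable_finsetSum _ fun j _ => integrable_normSq (hγ j)
  have hest (ν : ℕ) := integral_cutoff_le hc₁ hc₂ hD hlam htau hpsi htau0 hpsi0 hρ' hTheta hratio
    hγ hw hγc hγw (hη ν) (hηc ν) (hηD ν)
  -- the error term tends to zero
  have hE : Tendsto (fun ν => ∫ z in D, tau z * Real.exp (-psi z)
      * (∑ j, normSq (wd Complex.I j (fun z => (η ν z : ℂ)) z)) * enormSq n (fun j => γ j z))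
      atTop (𝓝 0) := by
    rw [← integral_zero (Fin n → ℂ) ℝ (μ := volume.restrict D)]
    refine tendsto_integral_of_dominated_convergence
      (fun z => M * (|C| * M) * enormSq n fun j => γ j z) (fun ν => ?_) (hγn.const_mul _)
      (fun ν => ?_) ?_
    · refine AEStronglyMeasurable.mul (ContinuousOn.aestronglyMeasurable ?_ hD.measurableSet) hγn.1
      refine (htau.continuousOn.mul hpsi.continuousOn.neg.rexp).mul
        (Continuous.continuousOn ?_)
      exact continuous_finsetSum _ fun j _ => continuous_normSq.comp
        (continuous_wd _ _ (contDiff_ofReal_comp ((hη ν).of_le (by norm_cast))))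
    · filter_upwards [ae_restrict_mem hD.measurableSet] with z hz
      have h1 := hηC ν z hz
      have h2 : 0 ≤ ∑ j, normSq (wd Complex.I j (fun z => (η ν z : ℂ)) z) :=
        Finset.sum_nonneg fun _ _ => normSq_nonneg _
      have h3 : 0 ≤ ∑ j, normSq (wd Complex.I j (fun z => (ρ z : ℂ)) z) :=
        Finset.sum_nonneg fun _ _ => normSq_nonneg _
      have h4 := (htau0 z hz).le
      have h5 := enormSq_nonneg (n := n) fun j => γ j z
      rw [Real.norm_of_nonneg (by positivity), hpsie z hz, mul_assoc (tau z)]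
      refine mul_le_mul_of_nonneg_right (mul_le_mul (htauM z hz) (h1.trans ?_)
        (by positivity) (h4.trans (htauM z hz))) h5
      exact mul_le_mul (le_abs_self C) (hρM z hz) h3 (abs_nonneg _)
    · filter_upwards [ae_restrict_mem hD.measurableSet] with z hz
      refine tendsto_const_nhds.congr' ?_
      filter_upwards [hη1 z hz] with ν hν
      have h3 : (fun z => (η ν z : ℂ)) =ᶠ[𝓝 z] fun _ => ((1 : ℝ) : ℂ) :=
        hν.fun_comp ((↑) : ℝ → ℂ)
      simp only [wd_congr h3]
      simp [wd]
  -- the pairing converges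
  have hL : Tendsto (fun ν => ∑ j, ∫ z in D, α j z
      * (η ν z * ((starRingEnd ℂ) (γ j z) * (p z : ℂ)⁻¹)))
      atTop (𝓝 (∑ j, ∫ z in D, α j z * (starRingEnd ℂ) (w j z))) := by
    rw [← hγα α hαc fun j => hpMem (hα j)]
    refine tendsto_finsetSum _ fun j _ => ?_
    refine tendsto_integral_of_dominated_convergence
      (fun z => ‖α j z * (p z : ℂ)⁻¹ * (starRingEnd ℂ) (γ j z)‖) (fun ν => ?_)
      (integrable_mul_conj (hpMem (hα j)) (hγ j)).norm (fun ν => ?_) ?_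
    · exact (hα j).1.mul (hηMem ν (hpMem (hγ j).star)).1
    · refine .of_forall fun z => ?_
      have h : α j z * (η ν z * ((starRingEnd ℂ) (γ j z) * (p z : ℂ)⁻¹))
          = η ν z * (α j z * (p z : ℂ)⁻¹ * (starRingEnd ℂ) (γ j z)) := by ring
      rw [h, norm_mul, norm_real, Real.norm_of_nonneg (hη01 ν z).1]
      exact mul_le_of_le_one_left (norm_nonneg _) (hη01 ν z).2
    · filter_upwards [ae_restrict_mem hD.measurableSet] with z hz
      refine tendsto_const_nhds.congr' ?_
      filter_upwards [hη1 z hz] with ν hν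
      rw [hν.eq_of_nhds]
      simp
      ring
  have hdiv : HasCompactSupport fun z => ∑ j, wd (-Complex.I) j (w j) z := by
    refine HasCompactSupport.intro (isCompact_iUnion fun j => (hw j).2.1) fun z hz => ?_
    refine Finset.sum_eq_zero fun j _ => image_eq_zero_of_notMem_tsupport fun h => hz ?_
    exact mem_iUnion.2 ⟨j, tsupport_wd_subset _ _ _ h⟩
  have hdivC : Continuous fun z => ∑ j, wd (-Complex.I) j (w j) z :=
    continuous_finsetSum _ fun j _ => continuous_wd _ _ ((hw j).1.of_le (by norm_cast))
  have hdivI : Integrable (fun z => normSq (∑ j, wd (-Complex.I) j (w j) z))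
      (volume.restrict D) := integrable_normSq (hdivC.memLp_of_hasCompactSupport hdiv)
  have hN (ν : ℕ) : ∫ z in D, η ν z ^ 2 * Real.exp (3 * psi z ^ 2)
      * normSq (∑ j, wd (-Complex.I) j (w j) z)
      ≤ Real.exp 3 * ∫ z in D, normSq (∑ j, wd (-Complex.I) j (w j) z) := by
    rw [← integral_const_mul]
    refine integral_mono_of_nonneg (.of_forall fun z => by
      have := normSq_nonneg (∑ j, wd (-Complex.I) j (w j) z)
      positivity) (hdivI.const_mul _) ?_
    filter_upwards [ae_restrict_mem hD.measurableSet] with z hz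
    by_cases h0 : ∃ j, z ∈ tsupport (w j)
    · obtain ⟨j, hj⟩ := h0
      refine mul_le_mul_of_nonneg_right ?_ (normSq_nonneg _)
      have h1 : psi z ≤ 1 := by
        have h2 : 1 - (ρ z)⁻¹ ≤ Real.log (ρ z) := Real.one_sub_inv_le_log_of_pos (hρ0 z hz)
        have h3 : (ρ z)⁻¹ ≤ (3 / 4)⁻¹ := inv_anti₀ (by norm_num) (hwρ j z hj)
        simp only [psi]
        norm_num at h3
        linarith
      have h2 : η ν z ^ 2 ≤ 1 := pow_le_one₀ (hη01 ν z).1 (hη01 ν z).2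
      have h3 : Real.exp (3 * psi z ^ 2) ≤ Real.exp 3 :=
        Real.exp_le_exp.2 (by nlinarith [hpsi0 z hz])
      calc η ν z ^ 2 * Real.exp (3 * psi z ^ 2) ≤ 1 * Real.exp 3 := by gcongr
        _ = _ := one_mul _
    · have : ∑ j, wd (-Complex.I) j (w j) z = 0 := Finset.sum_eq_zero fun j _ =>
        image_eq_zero_of_notMem_tsupport fun h => h0 ⟨j, tsupport_wd_subset _ _ _ h⟩
      simp [this]
  have hCS (ν : ℕ) : normSq (∑ j, ∫ z in D, α j z
      * (η ν z * ((starRingEnd ℂ) (γ j z) * (p z : ℂ)⁻¹)))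
      ≤ (∑ j, ∫ z in D, normSq (α j z))
        * ∫ z in D, η ν z ^ 2 * enormSq n (fun j => γ j z) * Real.exp (-lam z - psi z) := by
    refine (normSq_sum_integral_mul_le hα fun j => hηMem ν (hpMem (hγ j).star)).trans ?_
    refine mul_le_mul_of_nonneg_left ?_
      (Finset.sum_nonneg fun j _ => integral_nonneg fun z => normSq_nonneg _)
    rw [← integral_finsetSum _ fun j _ => integrable_normSq (hηMem ν (hpMem (hγ j).star))]
    refine integral_mono_of_nonneg
      (.of_forall fun z => Finset.sum_nonneg fun j _ => normSq_nonneg _) ?_ ?_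
    · refine (hγn.const_mul M).mono' ?_ ?_
      · refine (AEStronglyMeasurable.mul ?_ hγn.1).mul (ContinuousOn.aestronglyMeasurable
          (hlam.continuousOn.neg.sub hpsi.continuousOn).rexp hD.measurableSet)
        exact ((hη ν).continuous.pow 2).aestronglyMeasurable
      · filter_upwards [ae_restrict_mem hD.measurableSet] with z hz
        have h5 := enormSq_nonneg (n := n) fun j => γ j z
        have h2 : η ν z ^ 2 ≤ 1 := pow_le_one₀ (hη01 ν z).1 (hη01 ν z).2
        rw [Real.norm_of_nonneg (by positivity), mul_comm]
        exact mul_le_mul (hexpM z hz) (mul_le_of_le_one_left h5 h2) (by positivity)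
          ((Real.exp_pos _).le.trans (hexpM z hz))
    · filter_upwards [ae_restrict_mem hD.measurableSet] with z hz
      have h5 := enormSq_nonneg (n := n) fun j => γ j z
      have h : ∑ j, normSq (η ν z * ((starRingEnd ℂ) (γ j z) * (p z : ℂ)⁻¹))
          = η ν z ^ 2 * enormSq n (fun j => γ j z) * (p z)⁻¹ ^ 2 := by
        simp only [normSq_mul, normSq_conj, normSq_inv, normSq_ofReal, enormSq, Finset.mul_sum,
          Finset.sum_mul]
        refine Finset.sum_congr rfl fun j _ => ?_
        rw [mul_inv]
        ring
      exact h.trans_le (mul_le_mul_of_nonneg_left (hpinv z hz) (by positivity))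
  refine le_of_tendsto_of_tendsto' ((continuous_normSq.tendsto _).comp hL) (b := atTop)
    (g := fun ν => (∑ j, ∫ z in D, normSq (α j z)) * (c₁⁻¹ * ((6 / c₂) * (Real.exp 3
        * ∫ z in D, normSq (∑ j, wd (-Complex.I) j (w j) z)) + 8 * ∫ z in D, tau z
      * Real.exp (-psi z) * (∑ j, normSq (wd Complex.I j (fun z => (η ν z : ℂ)) z))
      * enormSq n (fun j => γ j z)))) ?_ fun ν => (hCS ν).trans ?_
  · have := ((tendsto_const_nhds (x := (6 / c₂) * (Real.exp 3
        * ∫ z in D, normSq (∑ j, wd (-Complex.I) j (w j) z)))).add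
        (hE.const_mul 8)).const_mul c₁⁻¹ |>.const_mul (∑ j, ∫ z in D, normSq (α j z))
    simpa using this
  · refine mul_le_mul_of_nonneg_left ?_
      (Finset.sum_nonneg fun j _ => integral_nonneg fun z => normSq_nonneg _)
    rw [← div_eq_inv_mul, le_div_iff₀' hc₁]
    refine (hest ν).trans (add_le_add_left (mul_le_mul_of_nonneg_left (hN ν) ?_) _)
    positivity

end ClosedForms

section Solvability

open Filter Topology

variable {n : ℕ} {D Ω : Set (Fin n → ℂ)}

lemma IsTest.mono {φ : (Fin n → ℂ) → ℂ} (hφ : IsTest n D φ) (h : D ⊆ Ω) : IsTest n Ω φ :=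
  ⟨hφ.1, hφ.2.1, hφ.2.2.trans h⟩

lemma DbarClosed.mono {α : Fin n → (Fin n → ℂ) → ℂ} (hα : DbarClosed n Ω α) (h : D ⊆ Ω) :
    DbarClosed n D α := by
  intro j k φ hφ
  have key (U : Set (Fin n → ℂ)) (hU : IsTest n U φ) (j k) :
      ∫ z in U, α j z * dbarCoord n φ k z = ∫ z, α j z * dbarCoord n φ k z := by
    refine setIntegral_eq_of_tsupport_subset fun z hz => ?_
    rw [dbarCoord_eq_wd, image_eq_zero_of_notMem_tsupport fun h' =>
      hz (hU.2.2 (tsupport_wd_subset _ _ _ h')), mul_zero]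
  rw [key D hφ, key D hφ, ← key Ω (hφ.mono h), ← key Ω (hφ.mono h)]
  exact hα j k φ (hφ.mono h)

lemma hessC_neg_log_nonneg {Φ : (Fin n → ℂ) → ℝ} {z : Fin n → ℂ} {a m : ℝ} (hm : m < a)
    (hz : Φ z < a) (hΦ : ContDiffAt ℝ 2 Φ z) (ξ : Fin n → ℂ) (hΦ' : 0 ≤ hessC n Φ z ξ) :
    0 ≤ hessC n (fun z => -2 * Real.log ((a - Φ z) / (a - m))) z ξ := by
  have ha : 0 < a - Φ z := sub_pos.2 hz
  have hm' : 0 < a - m := sub_pos.2 hm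
  have hsub (t : ℝ) : HasDerivAt (fun t => a - t) (-1) t := (hasDerivAt_id t).const_sub a
  rw [hessC_comp (f := Φ) (θ := fun t => -2 * Real.log ((a - t) / (a - m)))
    (θ' := fun t => 2 * (a - t)⁻¹) (θ'' := 2 * ((a - Φ z) ^ 2)⁻¹) ?_ ?_ hΦ ξ]
  · have := normSq_nonneg (delPair n Φ z ξ)
    positivity
  · filter_upwards [gt_mem_nhds hz] with t ht
    have ht' : 0 < a - t := sub_pos.2 ht
    refine ((((hsub t).div_const (a - m)).log (by positivity)).const_mul (-2)).congr_deriv ?_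
    field_simp
  · refine (((hsub (Φ z)).inv ha.ne').const_mul 2).congr_deriv ?_
    field_simp

/-- The duality estimate for `∂̄`-closed forms on `Ω`. -/
theorem normSq_pairing_le (hΩ : IsOpen Ω) (hpsc : Pseudoconvex n Ω)
    {lam tau : (Fin n → ℂ) → ℝ} {c₁ c₂ : ℝ}
    (hc₁ : 0 < c₁) (hc₂ : 0 < c₂) (hlam : ContDiffOn ℝ 2 lam Ω) (htau : ContDiffOn ℝ 2 tau Ω)
    (htau0 : ∀ z ∈ Ω, 0 < tau z)
    (hTheta : ∀ z ∈ Ω, ∀ ξ, c₁ * enormSq n ξ * Real.exp (-lam z) ≤ Theta n lam tau z ξ)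
    (hratio : ∀ z ∈ Ω, c₂ ≤ Real.exp (-lam z) / tau z)
    {α w : Fin n → (Fin n → ℂ) → ℂ} (hα : ∀ j, MemLp (α j) 2 (volume.restrict Ω))
    (hαc : DbarClosed n Ω α) (hw : ∀ j, IsTest n Ω (w j)) :
    normSq (∑ j, ∫ z in Ω, α j z * (starRingEnd ℂ) (w j z))
      ≤ (∑ j, ∫ z in Ω, normSq (α j z)) * (c₁⁻¹ * ((6 / c₂) * (Real.exp 3
        * ∫ z in Ω, normSq (∑ j, wd (-Complex.I) j (w j) z)))) := by
  obtain ⟨Φ, hΦ, hΦ', hex⟩ := hpsc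
  have hΦc := hΦ.continuousOn
  obtain ⟨m, hm⟩ : ∃ m, ∀ z ∈ Ω, m ≤ Φ z := by
    obtain ⟨m, hm⟩ := (hex.isCompact_sublevel hΦc 0).bddBelow_image
      (hΦc.mono fun z hz => hz.1)
    refine ⟨min m 0, fun z hz => ?_⟩
    rcases le_total (Φ z) 0 with h | h
    · exact (min_le_left _ _).trans (hm ⟨z, ⟨hz, h⟩, rfl⟩)
    · exact (min_le_right _ _).trans h
  obtain ⟨B, hB⟩ : ∃ B, ∀ j, ∀ z ∈ tsupport (w j), Φ z ≤ B := by
    obtain ⟨B, hB⟩ := (isCompact_iUnion fun j => (hw j).2.1).bddAbove_image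
      (hΦc.mono (iUnion_subset fun j => (hw j).2.2))
    exact ⟨B, fun j z hz => hB ⟨z, mem_iUnion.2 ⟨j, hz⟩, rfl⟩⟩
  set a : ℝ := m + 4 * (|B - m| + 1) with ha
  have hma : m < a := by have := abs_nonneg (B - m); linarith
  have hma' : 0 < a - m := sub_pos.2 hma
  set D : Set (Fin n → ℂ) := {z ∈ Ω | Φ z < a} with hDdef
  have hDΩ : D ⊆ Ω := fun z hz => hz.1
  have hD : IsOpen D := hΦc.isOpen_inter_preimage hΩ isOpen_Iio
  obtain ⟨hK, hKΩ⟩ := hex a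
  set ρ : (Fin n → ℂ) → ℝ := fun z => (a - Φ z) / (a - m) with hρdef
  have hρ : ContDiffOn ℝ (⊤ : ℕ∞) ρ Ω := (contDiffOn_const.sub hΦ).div_const _
  have hbdd {f : (Fin n → ℂ) → ℝ} (hf : ContinuousOn f Ω) : ∃ M, ∀ z ∈ D, f z ≤ M := by
    obtain ⟨M, hM⟩ := hK.bddAbove_image (hf.mono hKΩ)
    exact ⟨M, fun z hz => hM ⟨z, subset_closure hz, rfl⟩⟩
  obtain ⟨M₁, hM₁⟩ := hbdd hlam.continuousOn.neg.rexp
  obtain ⟨M₂, hM₂⟩ := hbdd htau.continuousOn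
  obtain ⟨M₃, hM₃⟩ := hbdd (f := fun z => ∑ j, normSq (wd Complex.I j (fun z => (ρ z : ℂ)) z)) (by
    refine continuousOn_finsetSum _ fun j _ => continuous_normSq.comp_continuousOn fun z hz => ?_
    exact (contDiffAt_wd (m := 1) (m' := 0) _ _ ((contDiffOn_ofReal_comp (hρ.of_le
      (by norm_cast))).contDiffAt (hΩ.mem_nhds hz)) (by norm_num)).continuousAt.continuousWithinAt)
  have hBa (j z) (hz : z ∈ tsupport (w j)) : Φ z - m ≤ (a - m) / 4 := by
    have := hB j z hz
    have := le_abs_self (B - m)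
    linarith
  have hwD (j) : IsTest n D (w j) := by
    refine ⟨(hw j).1, (hw j).2.1, fun z hz => ⟨(hw j).2.2 hz, ?_⟩⟩
    have := hBa j z hz
    linarith
  have key := normSq_pairing_le_of_cutoff (M := max M₁ (max M₂ M₃)) hD hc₁ hc₂ (hlam.mono hDΩ)
    (htau.mono hDΩ) (fun z hz => htau0 z hz.1) (fun z hz => hTheta z hz.1)
    (fun z hz => hratio z hz.1) (hρ.mono hDΩ)
    (fun z hz => div_pos (sub_pos.2 hz.2) hma')
    (fun z hz => (div_le_one hma').2 (by linarith [hm z hz.1]))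
    (fun ε hε => by
      convert hex.isCompact_sublevel hΦc (a - ε * (a - m)) using 1
      ext z
      simp only [hDdef, hρdef, mem_ofPred_eq, le_div_iff₀ hma', and_assoc]
      refine and_congr_right fun _ => ⟨fun h => by linarith, fun h => ⟨?_, by linarith⟩⟩
      have := mul_pos hε hma'
      linarith)
    (fun z hz ξ => hessC_neg_log_nonneg hma hz.2
      ((hΦ.of_le (by norm_cast)).contDiffAt (hΩ.mem_nhds hz.1)) ξ (hΦ' z hz.1 ξ))
    (fun z hz => (hM₁ z hz).trans (le_max_left _ _))
    (fun z hz => (hM₂ z hz).trans ((le_max_left _ _).trans (le_max_right _ _)))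
    (fun z hz => (hM₃ z hz).trans ((le_max_right _ _).trans (le_max_right _ _)))
    (fun j => (hα j).mono_measure (Measure.restrict_mono hDΩ le_rfl)) (hαc.mono hDΩ) hwD
    (fun j z hz => by
      rw [le_div_iff₀ hma']
      have := hBa j z hz
      linarith)
  have h0 (U : Set (Fin n → ℂ)) (hU : ∀ j, IsTest n U (w j)) (j) :
      ∫ z in U, α j z * (starRingEnd ℂ) (w j z) = ∫ z, α j z * (starRingEnd ℂ) (w j z) :=
    setIntegral_eq_of_tsupport_subset fun z hz => by
      rw [image_eq_zero_of_notMem_tsupport fun h => hz ((hU j).2.2 h), map_zero, mul_zero]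
  have h1 (U : Set (Fin n → ℂ)) (hU : ∀ j, IsTest n U (w j)) :
      ∫ z in U, normSq (∑ j, wd (-Complex.I) j (w j) z)
        = ∫ z, normSq (∑ j, wd (-Complex.I) j (w j) z) :=
    setIntegral_eq_integral_of_forall_compl_eq_zero fun z hz => by
      rw [Finset.sum_eq_zero fun j _ => image_eq_zero_of_notMem_tsupport fun h =>
        hz ((hU j).2.2 (tsupport_wd_subset _ _ _ h)), map_zero]
  simp only [h0 D hwD, h1 D hwD] at key
  simp only [h0 Ω hw, h1 Ω hw]
  refine key.trans (mul_le_mul_of_nonneg_right (Finset.sum_le_sum fun j _ => ?_) ?_)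
  · exact setIntegral_mono_set (integrable_normSq (hα j)) (.of_forall fun z => normSq_nonneg _)
      hDΩ.eventuallyLE
  · have : 0 ≤ ∫ z, normSq (∑ j, wd (-Complex.I) j (w j) z) :=
      integral_nonneg fun z => normSq_nonneg _
    positivity

end Solvability

section ClosedRange

variable {n : ℕ} {Ω : Set (Fin n → ℂ)}

lemma exists_inner_eq_of_norm_le {V H : Type*} [AddCommGroup V] [Module ℂ V]
    [NormedAddCommGroup H] [InnerProductSpace ℂ H] [CompleteSpace H] (A : V →ₗ[ℂ] H)
    (ℓ : V →ₗ[ℂ] ℂ) (C : ℝ) (h : ∀ v, ‖ℓ v‖ ≤ C * ‖A v‖) : ∃ y : H, ∀ v, ℓ v = inner ℂ y (A v) := by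
  obtain ⟨s, hs⟩ := A.rangeRestrict.exists_rightInverse_of_surjective A.range_rangeRestrict
  have hs' (r : LinearMap.range A) : A (s r) = r := congrArg Subtype.val (LinearMap.congr_fun hs r)
  let f : LinearMap.range A →L[ℂ] ℂ := (ℓ.comp s).mkContinuous C fun r => by
    simpa [hs'] using h (s r)
  obtain ⟨g, hg, -⟩ := exists_extension_norm_eq _ f
  refine ⟨(InnerProductSpace.toDual ℂ H).symm g, fun v => ?_⟩
  rw [InnerProductSpace.toDual_symm_apply]
  have h1 : g (A v) = ℓ (s (A.rangeRestrict v)) := hg (A.rangeRestrict v)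
  have h2 := h (v - s (A.rangeRestrict v))
  have h3 : (A.rangeRestrict v : H) = A v := rfl
  rw [map_sub A, hs', h3, sub_self, norm_zero, mul_zero, map_sub] at h2
  rw [h1]
  exact sub_eq_zero.1 (norm_le_zero_iff.1 h2)

variable (n Ω) in
/-- The space of `n`-tuples of test functions on `Ω`. -/
def testTuples : Submodule ℂ (Fin n → (Fin n → ℂ) → ℂ) where
  carrier := {φ | ∀ j, IsTest n Ω (φ j)}
  zero_mem' j := ⟨contDiff_const, HasCompactSupport.zero, by simp [tsupport]⟩
  add_mem' {φ ψ} hφ hψ j := ⟨(hφ j).1.add (hψ j).1, (hφ j).2.1.add (hψ j).2.1,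
    (tsupport_add (φ j) (ψ j)).trans (union_subset (hφ j).2.2 (hψ j).2.2)⟩
  smul_mem' c φ hφ j := ⟨contDiff_const.mul (hφ j).1, (hφ j).2.1.mul_left,
    (closure_mono fun z hz => right_ne_zero_of_mul hz).trans (hφ j).2.2⟩

lemma IsTest.memLp {φ : (Fin n → ℂ) → ℂ} (hφ : IsTest n Ω φ) (μ : Measure (Fin n → ℂ))
    [IsFiniteMeasureOnCompacts μ] : MemLp φ 2 μ :=
  hφ.1.continuous.memLp_of_hasCompactSupport hφ.2.1

lemma IsTest.memLp_dbarCoord {φ : (Fin n → ℂ) → ℂ} (hφ : IsTest n Ω φ) (j : Fin n)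
    (μ : Measure (Fin n → ℂ)) [IsFiniteMeasureOnCompacts μ] : MemLp (dbarCoord n φ j) 2 μ :=
  (continuous_wd _ _ (hφ.1.of_le (by norm_cast))).memLp_of_hasCompactSupport
    (hasCompactSupport_wd _ _ hφ.2.1)

lemma IsTest.differentiable {φ : (Fin n → ℂ) → ℂ} (hφ : IsTest n Ω φ) : Differentiable ℝ φ :=
  hφ.1.differentiable (by simp)

lemma IsTest.conj {φ : (Fin n → ℂ) → ℂ} (hφ : IsTest n Ω φ) :
    IsTest n Ω fun z => (starRingEnd ℂ) (φ z) :=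
  ⟨Complex.conjCLE.contDiff.comp hφ.1, hφ.2.1.comp_left (map_zero _),
    (tsupport_comp_subset (map_zero _) φ).trans hφ.2.2⟩

lemma IsTest.dbarCoord {φ : (Fin n → ℂ) → ℂ} (hφ : IsTest n Ω φ) (j : Fin n) :
    IsTest n Ω (dbarCoord n φ j) :=
  ⟨contDiff_wd _ _ hφ.1 (by simp), hasCompactSupport_wd _ _ hφ.2.1,
    (tsupport_wd_subset _ _ _).trans hφ.2.2⟩

lemma DbarEq.dbarClosed {u : (Fin n → ℂ) → ℂ} {α : Fin n → (Fin n → ℂ) → ℂ}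
    (h : DbarEq n Ω u α) : DbarClosed n Ω α := by
  intro j k φ hφ
  rw [h j _ (hφ.dbarCoord k), h k _ (hφ.dbarCoord j)]
  congr 2 with z
  exact congrArg _ (wd_comm _ _ j k (hφ.1.of_le (by norm_cast)).contDiffAt)

/-- A duality estimate against test forms yields solvability of `∂̄u = α` in `L²`. -/
lemma exists_dbarEq_of_pairing_le {C : ℝ}
    {α : Fin n → Lp ℂ 2 ((volume : Measure (Fin n → ℂ)).restrict Ω)}
    (h : ∀ w : Fin n → (Fin n → ℂ) → ℂ, (∀ j, IsTest n Ω (w j)) →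
      normSq (∑ j, ∫ z in Ω, α j z * (starRingEnd ℂ) (w j z))
        ≤ C * ∫ z in Ω, normSq (∑ j, wd (-Complex.I) j (w j) z)) :
    ∃ u : Lp ℂ 2 ((volume : Measure (Fin n → ℂ)).restrict Ω),
      DbarEq n Ω (⇑u) (fun j => ⇑(α j)) := by
  have hdiv (φ : testTuples n Ω) : MemLp (fun z => ∑ j, dbarCoord n (φ.1 j) j z) 2
      (volume.restrict Ω) :=
    memLp_finsetSum _ fun j _ => (φ.2 j).memLp_dbarCoord j _
  have hint (j : Fin n) {φ : (Fin n → ℂ) → ℂ} (hφ : IsTest n Ω φ) :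
      Integrable (fun z => α j z * φ z) (volume.restrict Ω) :=
    (Lp.memLp (α j)).integrable_mul (hφ.memLp _)
  let A : testTuples n Ω →ₗ[ℂ] Lp ℂ 2 ((volume : Measure (Fin n → ℂ)).restrict Ω) :=
    { toFun φ := (hdiv φ).toLp _
      map_add' φ ψ := by
        rw [← MemLp.toLp_add]
        congr 1 with z
        simp only [Pi.add_apply, ← Finset.sum_add_distrib]
        exact Finset.sum_congr rfl fun j _ =>
          wd_add (φ.2 j).differentiable.differentiableAt (ψ.2 j).differentiable.differentiableAt
      map_smul' c φ := by
        rw [RingHom.id_apply, ← MemLp.toLp_const_smul]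
        congr 1 with z
        simp only [Pi.smul_apply, smul_eq_mul, Finset.mul_sum]
        refine Finset.sum_congr rfl fun j _ => ?_
        exact (wd_mul (differentiableAt_const c)
          (φ.2 j).differentiable.differentiableAt).trans (by simp [wd, dbarCoord]) }
  let ℓ : testTuples n Ω →ₗ[ℂ] ℂ :=
    { toFun φ := ∑ j, ∫ z in Ω, α j z * φ.1 j z
      map_add' φ ψ := by
        rw [← Finset.sum_add_distrib]
        refine Finset.sum_congr rfl fun j _ => ?_
        rw [← integral_add (hint j (φ.2 j)) (hint j (ψ.2 j))]
        congr 1 with z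
        exact mul_add _ _ _
      map_smul' c φ := by
        rw [RingHom.id_apply, smul_eq_mul, Finset.mul_sum]
        refine Finset.sum_congr rfl fun j _ => ?_
        rw [← integral_const_mul]
        congr 1 with z
        exact mul_left_comm _ _ _ }
  have hle (φ : testTuples n Ω) : ‖ℓ φ‖ ≤ √C * ‖A φ‖ := by
    have h1 := h (fun j z => (starRingEnd ℂ) (φ.1 j z)) fun j => (φ.2 j).conj
    have h2 : ∫ z in Ω, normSq (∑ j, wd (-Complex.I) j (fun z => (starRingEnd ℂ) (φ.1 j z)) z)
        = ‖A φ‖ ^ 2 := by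
      have h3 := inner_self_eq_norm_sq_to_K (𝕜 := ℂ) (A φ)
      rw [L2.inner_def] at h3
      have h4 : ∫ z in Ω, inner ℂ (A φ z) (A φ z) = ∫ z in Ω,
          ((normSq (∑ j, wd (-Complex.I) j (fun z => (starRingEnd ℂ) (φ.1 j z)) z) : ℝ) : ℂ) := by
        refine integral_congr_ae ?_
        filter_upwards [(hdiv φ).coeFn_toLp] with z hz
        have h5 : A φ z = ∑ j, dbarCoord n (φ.1 j) j z := hz
        have h6 : ∑ j, wd (-Complex.I) j (fun z => (starRingEnd ℂ) (φ.1 j z)) z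
            = (starRingEnd ℂ) (∑ j, dbarCoord n (φ.1 j) j z) := by
          rw [map_sum]
          refine Finset.sum_congr rfl fun j _ => ?_
          rw [dbarCoord_eq_wd, conj_wd, conj_I]
        rw [h5, h6, normSq_conj, ← mul_conj]
        rfl
      rw [h4, integral_complex_ofReal] at h3
      refine ofReal_injective (h3.trans ?_)
      push_cast
      rfl
    rw [h2] at h1
    simp only [conj_conj, normSq_eq_norm_sq] at h1
    rw [← Real.sqrt_sq (norm_nonneg (A φ)), ← Real.sqrt_mul' _ (sq_nonneg _)]
    exact Real.le_sqrt_of_sq_le h1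
  obtain ⟨y, hy⟩ := exists_inner_eq_of_norm_le A ℓ √C hle
  refine ⟨-star y, fun j φ hφ => ?_⟩
  have hzero : IsTest n Ω 0 := (testTuples n Ω).zero_mem j
  have hsingle : Pi.single j φ ∈ testTuples n Ω := by
    intro k
    rcases eq_or_ne k j with rfl | hk
    · rwa [Pi.single_eq_same]
    · rwa [Pi.single_eq_of_ne hk]
  have h1 := hy ⟨_, hsingle⟩
  have h2 : ℓ ⟨_, hsingle⟩ = ∫ z in Ω, α j z * φ z := by
    change ∑ k, ∫ z in Ω, α k z * Pi.single (M := fun _ => (Fin n → ℂ) → ℂ) j φ k z = _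
    refine (Finset.sum_eq_single j (fun k _ hk => ?_) (by simp)).trans (by simp)
    simp [Pi.single_eq_of_ne hk]
  rw [← h2, h1, L2.inner_def, ← integral_neg]
  refine integral_congr_ae ?_
  filter_upwards [(hdiv ⟨_, hsingle⟩).coeFn_toLp, Lp.coeFn_neg (star y), Lp.coeFn_star y]
    with z hz1 hz2 hz3
  have h5 : A ⟨_, hsingle⟩ z = dbarCoord n φ j z := by
    refine hz1.trans ((Finset.sum_eq_single j (fun k _ hk => ?_) (by simp)).trans (by simp))
    simp [Pi.single_eq_of_ne hk, dbarCoord]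
  rw [h5, hz2, Pi.neg_apply, hz3, Pi.star_apply]
  simp [mul_comm]

lemma isClosed_setOf_dbarClosed :
    IsClosed {α : Fin n → Lp ℂ 2 ((volume : Measure (Fin n → ℂ)).restrict Ω) |
      DbarClosed n Ω fun j => ⇑(α j)} := by
  simp only [DbarClosed, ofPred_forall]
  refine isClosed_iInter fun j => isClosed_iInter fun k => isClosed_iInter fun φ =>
    isClosed_iInter fun hφ => ?_
  simp only [integral_mul_eq_inner (hφ.memLp_dbarCoord _ _)]
  exact isClosed_eq (continuous_const.inner (continuous_apply j))
    (continuous_const.inner (continuous_apply k))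

end ClosedRange

/-- **Main theorem (q = 0).** Let `Ω ⊆ ℂⁿ` be a pseudoconvex domain. If `Ω` admits
`λ, τ ∈ C²(Ω)` with `τ > 0` and constants `c₁, c₂ > 0` such that
`Θ_{λ,τ}(z;ξ) ≥ c₁|ξ|²e^{−λ(z)}` and `e^{−λ(z)}/τ(z) ≥ c₂` on `Ω`, then `∂̄` has
closed range: `R(∂̄) = {α ∈ (L²(Ω))ⁿ : ∃u ∈ L²(Ω), ∂̄u = α}` is closed in `(L²(Ω))ⁿ`. -/
theorem closed_range_of_uniform_twisted_estimates
    {n : ℕ} (Ω : Set (Fin n → ℂ)) (hne : Ω.Nonempty) (hop : IsOpen Ω)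
    (hconn : IsConnected Ω) (hpsc : Pseudoconvex n Ω)
    (lam tau : (Fin n → ℂ) → ℝ)
    (hlam : ContDiffOn ℝ 2 lam Ω) (htau : ContDiffOn ℝ 2 tau Ω)
    (htaupos : ∀ z ∈ Ω, 0 < tau z)
    (c₁ c₂ : ℝ) (hc₁ : 0 < c₁) (hc₂ : 0 < c₂)
    (hTheta : ∀ z ∈ Ω, ∀ ξ : Fin n → ℂ,
      c₁ * enormSq n ξ * Real.exp (-lam z) ≤ Theta n lam tau z ξ)
    (hratio : ∀ z ∈ Ω, c₂ ≤ Real.exp (-lam z) / tau z) :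
    IsClosed {α : Fin n → Lp ℂ 2 ((volume : Measure (Fin n → ℂ)).restrict Ω) |
      ∃ u : Lp ℂ 2 ((volume : Measure (Fin n → ℂ)).restrict Ω),
        DbarEq n Ω (⇑u) (fun j => ⇑(α j))} := by
  have h : {α : Fin n → Lp ℂ 2 ((volume : Measure (Fin n → ℂ)).restrict Ω) |
      ∃ u : Lp ℂ 2 ((volume : Measure (Fin n → ℂ)).restrict Ω),
        DbarEq n Ω (⇑u) (fun j => ⇑(α j))} =
        {α : Fin n → Lp ℂ 2 ((volume : Measure (Fin n → ℂ)).restrict Ω) |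
          DbarClosed n Ω fun j => ⇑(α j)} := by
    ext α
    refine ⟨fun ⟨u, hu⟩ => hu.dbarClosed, fun hα => exists_dbarEq_of_pairing_le
      (C := (∑ j, ∫ z in Ω, normSq (α j z)) * (c₁⁻¹ * ((6 / c₂) * Real.exp 3))) fun w hw => ?_⟩
    refine (normSq_pairing_le hop hpsc hc₁ hc₂ hlam htau htaupos hTheta hratio
      (fun j => Lp.memLp (α j)) hα hw).trans_eq ?_
    ring
  rw [h]
  exact isClosed_setOf_dbarClosed
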